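/- arXiv:2301.05001 — 2 statements merged into one kernel-verified Lean document; each statement's English description precedes it below -/
import Mathlib

section
/- Let R be a commutative Noetherian ring of finite Krull dimension d ≥ 1, let f ∈ R[T] \ R be a non-zero divisor of R[T], and let n ∈ ℤ. Let A be a geometric subring of R[T, f^n]. Let P be a finitely generated projective A-module whose localization at every prime ideal of A has rank at least d + 1. Then P is cancellative: for every finitely generated A-module Q, if A ⊕ Q ≅ A ⊕ P as A-modules, then Q ≅ P. -/
open Polynomial

set_option maxHeartbeats 1000000
set_option synthInstance.maxHeartbeats 400000

/-- The element `f^n` (`n ∈ ℤ`) in the localization `R[T]_f`. -/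
noncomputable def fzpow {R : Type*} [CommRing R] (f : Polynomial R) (n : ℤ) :
    Localization.Away f :=
  ((IsLocalization.map_units (M := Submonoid.powers f) (Localization.Away f)
    ⟨f, Submonoid.mem_powers f⟩).unit ^ n : (Localization.Away f)ˣ)

/-- The subring `R[T, f^n]` of `R[T]_f`: the `R[T]`-subalgebra generated by `f^n`. -/
noncomputable def RTfn {R : Type*} [CommRing R] (f : Polynomial R) (n : ℤ) :
    Subalgebra (Polynomial R) (Localization.Away f) :=
  Algebra.adjoin (Polynomial R) {fzpow f n}

/-- The rank of the localization `M_p` at a prime `p`. -/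
noncomputable def rankAt {R : Type*} [CommRing R] (M : Type*) [AddCommGroup M] [Module R M]
    (p : Ideal R) (hp : p.IsPrime) : ℕ :=
  letI := hp
  Module.finrank (Localization p.primeCompl) (LocalizedModule p.primeCompl M)

universe v

/-- Translates of a single element by multiples of `c` avoid finitely many incomparable primes
not containing `c`. -/
theorem exists_add_mul_notMem_of_antichain {A : Type*} [CommRing A] (S : Finset (Ideal A))
    (hprime : ∀ q ∈ S, q.IsPrime) (hanti : ∀ p ∈ S, ∀ q ∈ S, p ≤ q → p = q)
    (c x : A) (hc : ∀ q ∈ S, c ∉ q) : ∃ b : A, ∀ q ∈ S, x + c * b ∉ q := by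
  classical
  have key : ¬ (((S.filter (x ∉ ·)).inf id : Ideal A) : Set A) ⊆
      ⋃ q ∈ (↑(S.filter (x ∈ ·)) : Set (Ideal A)), (q : Set A) := by
    intro h
    obtain ⟨q, hq, hle⟩ := (Ideal.subset_union_prime (f := id) ⊥ ⊥
      (fun q hq _ _ => hprime q (Finset.mem_filter.1 hq).1)).1 h
    rw [Finset.mem_filter] at hq
    obtain ⟨q', hq', hle'⟩ := (hprime q hq.1).inf_le'.1 hle
    rw [Finset.mem_filter] at hq'
    obtain rfl := hanti q' hq'.1 q hq.1 hle'
    exact hq'.2 hq.2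
  obtain ⟨b, hb, hbn⟩ := Set.not_subset.1 key
  refine ⟨b, fun q hq hmem => ?_⟩
  by_cases hx : x ∈ q
  · have hcb : c * b ∈ q := by simpa using q.sub_mem hmem hx
    rcases (hprime q hq).mem_or_mem hcb with h | h
    · exact hc q hq h
    · exact hbn (Set.mem_biUnion (Finset.mem_coe.2 (Finset.mem_filter.2 ⟨hq, hx⟩)) h)
  · have hbq : b ∈ q := (Finset.inf_le (f := id) (Finset.mem_filter.2 ⟨hq, hx⟩) :
      (S.filter (x ∉ ·)).inf id ≤ q) hb
    exact hx (by simpa using q.sub_mem hmem (q.mul_mem_left c hbq))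

/-- General position: after translating `x` by multiples of `c`, a prime over `I` containing all
coordinates contains `c` or is the top of a chain of primes over `I` of length `r`. -/
theorem exists_general_position {A : Type*} [CommRing A] [IsNoetherianRing A] (I : Ideal A)
    (c : A) (r : ℕ) (x : Fin r → A) :
    ∃ b : Fin r → A, ∀ M : PrimeSpectrum A, I ≤ M.asIdeal →
      (∀ i, x i + c * b i ∈ M.asIdeal) → c ∈ M.asIdeal ∨
      ∃ l : LTSeries (PrimeSpectrum A), I ≤ l.head.asIdeal ∧ l.last = M ∧ l.length = r := by
  induction r with
  | zero => exact ⟨fun _ => 0, fun M hM _ => Or.inr ⟨RelSeries.singleton _ M, hM, rfl, rfl⟩⟩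
  | succ r ih =>
    obtain ⟨b, hb⟩ := ih (fun i => x i.castSucc)
    set J : Ideal A := I ⊔ Ideal.span (Set.range fun i : Fin r => x i.castSucc + c * b i) with hJ
    have hfin := J.finite_minimalPrimes_of_isNoetherianRing
    classical
    obtain ⟨y, hy⟩ := exists_add_mul_notMem_of_antichain (hfin.toFinset.filter (c ∉ ·))
      (fun q hq => by
        simp only [Finset.mem_filter, Set.Finite.mem_toFinset] at hq
        exact hq.1.1.1)
      (fun p hp q hq hle => by
        simp only [Finset.mem_filter, Set.Finite.mem_toFinset] at hp hq
        exact le_antisymm hle (hq.1.2 hp.1.1 hle))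
      c (x (Fin.last r)) (fun q hq => by simpa using (Finset.mem_filter.1 hq).2)
    refine ⟨Fin.snoc b y, fun M hIM hM => ?_⟩
    by_cases hcM : c ∈ M.asIdeal
    · exact Or.inl hcM
    refine Or.inr ?_
    have hJM : J ≤ M.asIdeal := by
      refine sup_le hIM (Ideal.span_le.2 ?_)
      rintro _ ⟨i, rfl⟩
      simpa using hM i.castSucc
    obtain ⟨q, hq, hqM⟩ := Ideal.exists_minimalPrimes_le hJM
    have hcq : c ∉ q := fun h => hcM (hqM h)
    have hyq := hy q (by simpa [hcq] using hq)
    have hlast : x (Fin.last r) + c * y ∈ M.asIdeal := by simpa using hM (Fin.last r)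
    have hlt : q < M.asIdeal := lt_of_le_of_ne hqM (fun h => hyq (h ▸ hlast))
    have hqp : q.IsPrime := hq.1.1
    obtain ⟨l, hl, hlast', hlen⟩ := (hb ⟨q, hqp⟩ (le_sup_left.trans hq.1.2)
      (fun i => hq.1.2 (le_sup_right (a := I) (Ideal.subset_span ⟨i, rfl⟩)))).resolve_left hcq
    refine ⟨l.snoc M (by rw [hlast']; exact hlt), by simpa using hl, by simp, by simp [hlen]⟩

/-- The height version of `exists_general_position`. -/
theorem exists_general_position_height {A : Type*} [CommRing A] [IsNoetherianRing A]
    (c : A) (r : ℕ) (x : Fin r → A) :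
    ∃ b : Fin r → A, ∀ M : Ideal A, M.IsPrime →
      (∀ i, x i + c * b i ∈ M) → c ∈ M ∨ (r : ℕ∞) ≤ M.height := by
  obtain ⟨b, hb⟩ := exists_general_position ⊥ c r x
  refine ⟨b, fun M hM hx => (hb ⟨M, hM⟩ bot_le hx).imp_right ?_⟩
  rintro ⟨l, -, hl, hlen⟩
  have h := Order.length_le_height (p := l) (x := ⟨M, hM⟩) hl.le
  rw [hlen] at h
  rwa [← PrimeSpectrum.height_eq_orderHeight] at h

/-- A prime of `R[X]` of height greater than `dim R` is maximal, lies over a maximal ideal, and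
contains a monic polynomial. -/
theorem exists_monic_mem_of_dim_lt_height {R : Type*} [CommRing R] [IsNoetherianRing R] {d : ℕ}
    (hd : ringKrullDim R ≤ d) (M : Ideal R[X]) [M.IsPrime] (hM : ((d + 1 : ℕ) : ℕ∞) ≤ M.height) :
    M.IsMaximal ∧ ∃ h ∈ M, h.Monic := by
  have hdimX : ringKrullDim R[X] ≤ ((d + 1 : ℕ) : WithBot ℕ∞) := by
    rw [Polynomial.ringKrullDim_of_isNoetherianRing]
    push_cast
    gcongr
  have htop : M.height = ((d + 1 : ℕ) : ℕ∞) := by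
    refine le_antisymm ?_ hM
    exact WithBot.coe_le_coe.1 (M.height_le_ringKrullDim_of_isPrime.trans hdimX)
  have hmax : M.IsMaximal := by
    have : Nontrivial R[X] := ⟨0, 1, fun h => ‹M.IsPrime›.ne_top
      ((Ideal.eq_top_iff_one _).2 (h ▸ M.zero_mem))⟩
    have : FiniteRingKrullDim R[X] := by
      rw [finiteRingKrullDim_iff_ne_bot_and_top]
      exact ⟨((WithBot.bot_lt_coe _).trans_le ringKrullDim_nonneg_of_nontrivial).ne', fun h => by
        rw [h] at hdimX; exact absurd hdimX (by rw [top_le_iff]; exact fun h => by cases h)⟩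
    apply Ideal.isMaximal_of_height_eq_ringKrullDim
    refine le_antisymm M.height_le_ringKrullDim_of_isPrime ?_
    rw [htop]; exact hdimX
  set m : Ideal R := M.under R with hm
  have : M.LiesOver m := ⟨rfl⟩
  have hmht : m.height = d := by
    have h := Polynomial.height_eq_height_add_one m M
    rw [htop] at h
    push_cast at h
    exact (ENat.add_left_injective_of_ne_top (by simp) h).symm
  have hnt : Nontrivial R := ⟨0, 1, fun h => (inferInstance : m.IsPrime).ne_top
      ((Ideal.eq_top_iff_one _).2 (h ▸ m.zero_mem))⟩
  have hmmax : m.IsMaximal := by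
    have : FiniteRingKrullDim R := by
      rw [finiteRingKrullDim_iff_ne_bot_and_top]
      exact ⟨((WithBot.bot_lt_coe _).trans_le ringKrullDim_nonneg_of_nontrivial).ne', fun h => by
        rw [h] at hd; exact absurd hd (by rw [top_le_iff]; exact fun h => by cases h)⟩
    apply Ideal.isMaximal_of_height_eq_ringKrullDim
    refine le_antisymm m.height_le_ringKrullDim_of_isPrime ?_
    rw [hmht]; exact hd
  refine ⟨hmax, ?_⟩
  have hne : ¬ M ≤ m.map C := by
    intro h
    have : M.height ≤ d := (Ideal.height_mono h).trans (by rw [Polynomial.height_map_C, hmht])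
    rw [htop] at this
    exact absurd this (by norm_cast; omega)
  obtain ⟨p, hpM, hpm⟩ := Set.not_subset.1 hne
  let : Field (R ⧸ m) := Ideal.Quotient.field m
  have hp0 : p.map (Ideal.Quotient.mk m) ≠ 0 := by
    intro h
    apply hpm
    rw [SetLike.mem_coe, Ideal.mem_map_C_iff]
    intro n
    have := congrArg (fun q => q.coeff n) h
    simpa [Ideal.Quotient.eq_zero_iff_mem] using this
  set pb := p.map (Ideal.Quotient.mk m) with hpb
  obtain ⟨u, hu⟩ := Ideal.Quotient.mk_surjective (pb.leadingCoeff⁻¹)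
  have hmon : (pb * C (pb.leadingCoeff⁻¹)).Monic := monic_mul_leadingCoeff_inv hp0
  have hlift : pb * C (pb.leadingCoeff⁻¹) ∈ lifts (Ideal.Quotient.mk m) :=
    ⟨p * C u, by simp [hpb, hu]⟩
  obtain ⟨h, hh, -, hmonic⟩ := lifts_and_natDegree_eq_and_monic hlift hmon
  refine ⟨h, ?_, hmonic⟩
  have hdiff : h - p * C u ∈ m.map C := by
    rw [Ideal.mem_map_C_iff]
    intro n
    have := congrArg (fun q => q.coeff n) (show (h - p * C u).map (Ideal.Quotient.mk m) = 0 by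
      rw [Polynomial.map_sub, hh]; simp [hpb, hu])
    rw [coeff_map, coeff_zero] at this
    exact Ideal.Quotient.eq_zero_iff_mem.1 this
  have hle : m.map C ≤ M := Ideal.map_le_iff_le_comap.2 le_rfl
  have := M.add_mem (hle hdiff) (M.mul_mem_right (C u) hpM)
  simpa using this

open Matrix in
/-- Two rows are equivalent modulo `s` if an invertible matrix congruent to `1` modulo `s`
carries the first to the second. -/
def RowEquivMod {B ι : Type*} [CommRing B] [Fintype ι] [DecidableEq ι] (s : B) (v w : ι → B) :
    Prop :=
  ∃ γ : Matrix ι ι B, IsUnit (1 + s • γ).det ∧ (1 + s • γ) *ᵥ v = w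

namespace RowEquivMod

open Matrix

section

variable {B ι : Type*} [CommRing B] [Fintype ι] [DecidableEq ι] {s : B} {u v w : ι → B}

theorem refl (s : B) (v : ι → B) : RowEquivMod s v v := ⟨0, by simp, by simp⟩

theorem trans (h₁ : RowEquivMod s u v) (h₂ : RowEquivMod s v w) : RowEquivMod s u w := by
  obtain ⟨γ₁, hu₁, rfl⟩ := h₁
  obtain ⟨γ₂, hu₂, rfl⟩ := h₂
  have h : 1 + s • (γ₁ + γ₂ + s • (γ₂ * γ₁)) = (1 + s • γ₂) * (1 + s • γ₁) := by
    rw [add_mul, mul_add, mul_add, smul_mul_smul_comm, smul_add, smul_add, smul_smul]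
    simp only [one_mul, mul_one]
    abel
  refine ⟨γ₁ + γ₂ + s • (γ₂ * γ₁), ?_, ?_⟩
  · rw [h, det_mul]; exact hu₂.mul hu₁
  · rw [h, mulVec_mulVec]

theorem symm (h : RowEquivMod s v w) : RowEquivMod s w v := by
  obtain ⟨γ, hu, rfl⟩ := h
  have h : 1 + s • (-(γ * (1 + s • γ)⁻¹)) = (1 + s • γ)⁻¹ := by
    calc 1 + s • (-(γ * (1 + s • γ)⁻¹))
        = (1 + s • γ) * (1 + s • γ)⁻¹ - (s • γ) * (1 + s • γ)⁻¹ := by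
          rw [mul_nonsing_inv _ hu, smul_neg, ← sub_eq_add_neg, smul_mul_assoc]
      _ = _ := by rw [← sub_mul]; simp
  refine ⟨-(γ * (1 + s • γ)⁻¹), ?_, ?_⟩
  · rw [h]; exact isUnit_nonsing_inv_det _ hu
  · rw [h, mulVec_mulVec, nonsing_inv_mul _ hu, one_mulVec]

theorem of_det {M : Matrix ι ι B} (hM : IsUnit M.det) (v : ι → B) :
    RowEquivMod 1 v (M *ᵥ v) := ⟨M - 1, by simpa using hM, by simp⟩

theorem exists_det (h : RowEquivMod 1 v w) : ∃ M : Matrix ι ι B, IsUnit M.det ∧ M *ᵥ v = w := by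
  obtain ⟨γ, h1, h2⟩ := h
  exact ⟨_, h1, h2⟩

theorem add_smul (s : B) (v a b : ι → B) (hab : b ⬝ᵥ a = 0) :
    RowEquivMod s v (v + (s * (b ⬝ᵥ v)) • a) := by
  refine ⟨vecMulVec a b, ?_, ?_⟩
  · have h : 1 + s • vecMulVec a b =
        1 + replicateCol Unit (s • a) * replicateRow Unit b := by
      rw [← smul_vecMulVec, vecMulVec_eq Unit]
    rw [h, det_one_add_replicateCol_mul_replicateRow, dotProduct_smul, hab]
    simp
  · rw [add_mulVec, one_mulVec, smul_mulVec, vecMulVec_mulVec, op_smul_eq_smul,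
      smul_smul]

theorem map {B' : Type*} [CommRing B'] (f : B →+* B') (h : RowEquivMod s v w) :
    RowEquivMod (f s) (f ∘ v) (f ∘ w) := by
  obtain ⟨γ, hu, rfl⟩ := h
  have h : 1 + f s • f.mapMatrix γ = f.mapMatrix (1 + s • γ) := by
    ext i j
    simp [one_apply, apply_ite f]
  refine ⟨f.mapMatrix γ, ?_, ?_⟩
  · rw [h, ← RingHom.map_det]; exact hu.map f
  · rw [h]; ext i; exact (RingHom.map_mulVec f _ v i).symm

theorem unimodular (h : RowEquivMod s v w) (hv : ∃ c, c ⬝ᵥ v = 1) : ∃ c, c ⬝ᵥ w = 1 := by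
  obtain ⟨γ, hu, rfl⟩ := h
  obtain ⟨c, hc⟩ := hv
  refine ⟨c ᵥ* (1 + s • γ)⁻¹, ?_⟩
  rw [dotProduct_mulVec, vecMul_vecMul, nonsing_inv_mul _ hu, vecMul_one, hc]

end

variable {B : Type*} [CommRing B] {n : ℕ}

theorem add_head (s a : B) (y c : Fin n → B) :
    RowEquivMod s (Fin.cons a y : Fin (n + 1) → B) (Fin.cons (a + s * (c ⬝ᵥ y)) y) := by
  convert add_smul s (Fin.cons a y : Fin (n + 1) → B) (Fin.cons 1 0) (Fin.cons 0 c) ?_ using 1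
  · ext i
    refine Fin.cases ?_ (fun i => ?_) i <;> simp [dotProduct, Fin.sum_univ_succ]
  · simp [dotProduct, Fin.sum_univ_succ]

theorem add_tail (s a : B) (y c : Fin n → B) :
    RowEquivMod s (Fin.cons a y : Fin (n + 1) → B) (Fin.cons a (y + (s * a) • c)) := by
  convert add_smul s (Fin.cons a y : Fin (n + 1) → B) (Fin.cons 0 c) (Fin.cons 1 0) ?_ using 1
  · ext i
    refine Fin.cases ?_ (fun i => ?_) i <;> simp [dotProduct, Fin.sum_univ_succ]
  · simp [dotProduct, Fin.sum_univ_succ]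

theorem pair (K : Matrix (Fin 2) (Fin 2) B) (hK : IsUnit K.det) (F G : B) (y : Fin n → B) :
    RowEquivMod 1 (Fin.cons F (Fin.cons G y : Fin (n + 1) → B) : Fin (n + 2) → B)
      (Fin.cons (K 0 0 * F + K 0 1 * G)
        (Fin.cons (K 1 0 * F + K 1 1 * G) y : Fin (n + 1) → B)) := by
  set E : Matrix (Fin (n + 2)) (Fin 2) B := of (fun i j => if (i : ℕ) = j then 1 else 0) with hE
  have hEE : Eᵀ * E = 1 := by
    ext i j
    fin_cases i <;> fin_cases j <;> simp [hE, mul_apply, Fin.sum_univ_succ]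
  have hdet : (1 + E * ((K - 1) * Eᵀ)).det = K.det := by
    rw [det_one_add_mul_comm, Matrix.mul_assoc, hEE]
    simp
  convert of_det (M := 1 + E * ((K - 1) * Eᵀ)) (by rwa [hdet]) _ using 1
  have hv : Eᵀ *ᵥ (Fin.cons F (Fin.cons G y : Fin (n + 1) → B) : Fin (n + 2) → B) = ![F, G] := by
    ext i
    fin_cases i <;> simp [hE, mulVec, dotProduct, Fin.sum_univ_succ]
  have hmul (w : Fin 2 → B) :
      E *ᵥ w = Fin.cons (w 0) (Fin.cons (w 1) 0 : Fin (n + 1) → B) := by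
    ext i
    change ∑ j, E i j * w j = _
    rw [Fin.sum_univ_two]
    refine Fin.cases ?_ (fun i => Fin.cases ?_ (fun i => ?_) i) i <;> simp [hE]
  rw [add_mulVec, one_mulVec, ← mulVec_mulVec, ← mulVec_mulVec, hv, hmul]
  ext i
  refine Fin.cases ?_ (fun i => Fin.cases ?_ (fun i => ?_) i) i <;>
    simp [mulVec, dotProduct, Fin.sum_univ_two, one_apply] <;> ring

end RowEquivMod

section DividedDifference

variable {R : Type*} [CommRing R]

/-- The divided difference `(f(b + z) - f(b)) / z`. -/
noncomputable def divDiff (b z f : R[X]) : R[X] :=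
  ((f.map C).comp (C b + X)).divX.eval z

theorem comp_add_eq_divDiff (b z f : R[X]) :
    f.comp (b + z) = f.comp b + z * divDiff b z f := by
  have h := congrArg (eval z) (divX_mul_X_add ((f.map C).comp (C b + X)))
  simp only [eval_add, eval_mul, eval_X, eval_C, eval_comp, coeff_zero_eq_eval_zero, add_zero] at h
  rw [eval_map, eval_map] at h
  rw [comp, comp, ← h, divDiff]
  ring

theorem divDiff_add (b z f g : R[X]) : divDiff b z (f + g) = divDiff b z f + divDiff b z g := by
  simp [divDiff, divX_add]

theorem divDiff_C (b z : R[X]) (c : R) : divDiff b z (C c) = 0 := by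
  simp [divDiff]

theorem divDiff_mul (b z f g : R[X]) :
    divDiff b z (f * g) = divDiff b z f * g.comp (b + z) + f.comp b * divDiff b z g := by
  set F := (f.map C).comp (C b + X) with hF
  set G := (g.map C).comp (C b + X) with hG
  have hFG : (F * G).divX = F.divX * G + C (F.coeff 0) * G.divX := by
    have h1 := divX_mul_X_add (F * G)
    have h2 := divX_mul_X_add F
    have h3 := divX_mul_X_add G
    have h4 : C ((F * G).coeff 0) = C (F.coeff 0) * C (G.coeff 0) := by
      rw [mul_coeff_zero, C_mul]
    apply (monic_X (R := R[X])).isRegular.right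
    show (F * G).divX * X = (F.divX * G + C (F.coeff 0) * G.divX) * X
    linear_combination h1 - h4 - G * h2 - C (F.coeff 0) * h3
  have h := congrArg (eval z) hFG
  simp only [eval_add, eval_mul, eval_C] at h
  have e1 : (G).eval z = g.comp (b + z) := by
    rw [hG, eval_comp, eval_map]; simp [comp]
  have e2 : F.coeff 0 = f.comp b := by
    rw [hF, coeff_zero_eq_eval_zero, eval_comp, eval_map]; simp [comp]
  rw [e1, e2] at h
  rw [divDiff, Polynomial.map_mul, mul_comp, h]
  rfl

end DividedDifference

namespace RowEquivMod

variable {B : Type*} [CommRing B] {n : ℕ}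

open Matrix

theorem add_second (s F G : B) (y c : Fin n → B) :
    RowEquivMod s (Fin.cons F (Fin.cons G y : Fin (n + 1) → B) : Fin (n + 2) → B)
      (Fin.cons F (Fin.cons (G + s * (c ⬝ᵥ y)) y : Fin (n + 1) → B)) := by
  convert add_smul s (Fin.cons F (Fin.cons G y : Fin (n + 1) → B) : Fin (n + 2) → B)
    (Fin.cons 0 (Fin.cons 1 0 : Fin (n + 1) → B)) (Fin.cons 0 (Fin.cons 0 c : Fin (n + 1) → B))
    ?_ using 1
  · ext i
    refine Fin.cases ?_ (fun i => Fin.cases ?_ (fun i => ?_) i) i <;>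
      simp [dotProduct, Fin.sum_univ_succ]
  · simp [dotProduct, Fin.sum_univ_succ]

theorem add_tails (s F G p q : B) (y c : Fin n → B) :
    RowEquivMod s (Fin.cons F (Fin.cons G y : Fin (n + 1) → B) : Fin (n + 2) → B)
      (Fin.cons F (Fin.cons G (y + (s * (p * F + q * G)) • c) : Fin (n + 1) → B)) := by
  convert add_smul s (Fin.cons F (Fin.cons G y : Fin (n + 1) → B) : Fin (n + 2) → B)
    (Fin.cons 0 (Fin.cons 0 c : Fin (n + 1) → B)) (Fin.cons p (Fin.cons q 0 : Fin (n + 1) → B))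
    ?_ using 1
  · ext i
    refine Fin.cases ?_ (fun i => Fin.cases ?_ (fun i => ?_) i) i <;>
      simp [dotProduct, Fin.sum_univ_succ]
  · simp [dotProduct, Fin.sum_univ_succ]

end RowEquivMod

section Suslin

variable {R : Type*} [CommRing R] {n : ℕ}

open Matrix

/-- If `c` lies in the ideal generated by `f₀` and an elementary modification of `f₁`, then the
values of the row at two points that differ by a multiple of `c` are equivalent. -/
theorem rowEquivMod_comp_add (f₀ f₁ : R[X]) (y l : Fin n → R[X]) (c : R) (p q : R[X])
    (h : p * f₀ + q * (f₁ + l ⬝ᵥ y) = C c) (b x : R[X]) :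
    RowEquivMod 1
      (Fin.cons (f₀.comp b) (Fin.cons (f₁.comp b) (fun i => (y i).comp b) : Fin (n + 1) → R[X]) :
        Fin (n + 2) → R[X])
      (Fin.cons (f₀.comp (b + C c * x)) (Fin.cons (f₁.comp (b + C c * x))
        (fun i => (y i).comp (b + C c * x)) : Fin (n + 1) → R[X])) := by
  set g := f₁ + l ⬝ᵥ y with hg
  have hgt (t : R[X]) : g.comp t =
      f₁.comp t + 1 * ((fun i => (l i).comp t) ⬝ᵥ (fun i => (y i).comp t)) := by
    simp [hg, dotProduct, Polynomial.sum_comp]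
  have h1 (t : R[X]) : RowEquivMod 1
      (Fin.cons (f₀.comp t) (Fin.cons (f₁.comp t) (fun i => (y i).comp t) : Fin (n + 1) → R[X]) :
        Fin (n + 2) → R[X])
      (Fin.cons (f₀.comp t) (Fin.cons (g.comp t) (fun i => (y i).comp t) :
        Fin (n + 1) → R[X])) := by
    rw [hgt]
    exact RowEquivMod.add_second ..
  refine (h1 b).trans (RowEquivMod.trans ?_ (h1 _).symm)
  set z := C c * x with hz
  set u := divDiff b z f₀
  set w := divDiff b z g
  set p₁ := divDiff b z p
  set q₁ := divDiff b z q
  have hD : p₁ * f₀.comp (b + z) + p.comp b * u + (q₁ * g.comp (b + z) + q.comp b * w) = 0 := by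
    rw [← divDiff_mul, ← divDiff_mul, ← divDiff_add, h, divDiff_C]
  have hF : f₀.comp (b + z) = f₀.comp b + z * u := comp_add_eq_divDiff ..
  have hG : g.comp (b + z) = g.comp b + z * w := comp_add_eq_divDiff ..
  have hc (t : R[X]) : p.comp t * f₀.comp t + q.comp t * g.comp t = C c := by
    rw [← mul_comp, ← mul_comp, ← add_comp, h, C_comp]
  have hy (i : Fin n) : (y i).comp (b + z) = (y i).comp b + z * divDiff b z (y i) :=
    comp_add_eq_divDiff ..
  set F := f₀.comp b
  set G := g.comp b
  set P := p.comp b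
  set Q := q.comp b
  set K : Matrix (Fin 2) (Fin 2) R[X] :=
    !![1 + x * (u * P + q₁ * G), x * (u * Q - q₁ * F);
      x * (w * P - p₁ * G), 1 + x * (w * Q + p₁ * F)] with hK
  have hb := hc b
  change P * F + Q * G = C c at hb
  have hdet : K.det = 1 := by
    rw [hK, det_fin_two_of]
    rw [hF, hG, hz] at hD
    linear_combination x * hD + (x * x * (p₁ * u + q₁ * w)) * hb
  have h2 := RowEquivMod.pair K (by rw [hdet]; exact isUnit_one) F G (fun i => (y i).comp b)
  have e1 : K 0 0 * F + K 0 1 * G = f₀.comp (b + z) := by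
    rw [hF, hz, ← hb]; simp [hK]; ring
  have e2 : K 1 0 * F + K 1 1 * G = g.comp (b + z) := by
    rw [hG, hz, ← hb]; simp [hK]; ring
  rw [e1, e2] at h2
  refine h2.trans ?_
  convert RowEquivMod.add_tails 1 (f₀.comp (b + z)) (g.comp (b + z)) (p.comp (b + z))
    (q.comp (b + z)) (fun i => (y i).comp b) (fun i => x * divDiff b z (y i)) using 3
  ext1 i
  rw [hc, hy]
  simp [hz]
  ring

theorem exists_isCoprime_add_mul {B : Type*} [CommRing B] [IsDomain B] [IsPrincipalIdealRing B]
    {f₀ f₁ h a b : B} (h₀ : f₀ ≠ 0) (hab : a * f₀ + b * f₁ + h = 1) :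
    ∃ t, IsCoprime f₀ (f₁ + t * h) := by
  classical
  refine ⟨((UniqueFactorizationMonoid.factors f₀).filter (fun q => ¬ q ∣ f₁)).prod, ?_⟩
  set t := ((UniqueFactorizationMonoid.factors f₀).filter (fun q => ¬ q ∣ f₁)).prod with ht
  refine isCoprime_of_prime_dvd (fun h' => h₀ h'.1) fun p hp hpf hpg => ?_
  by_cases hpf₁ : p ∣ f₁
  · have hpth : p ∣ t * h := (dvd_add_right hpf₁).1 hpg
    rcases hp.dvd_or_dvd hpth with hpt | hph
    · obtain ⟨q, hq, hpq⟩ := hp.exists_mem_multiset_dvd hpt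
      rw [Multiset.mem_filter] at hq
      have hq' := UniqueFactorizationMonoid.prime_of_factor q hq.1
      exact hq.2 (((hp.associated_of_dvd hq' hpq).symm.dvd).trans hpf₁)
    · exact hp.not_isUnit (isUnit_of_dvd_one (hab ▸
        (dvd_add (dvd_add (hpf.mul_left a) (hpf₁.mul_left b)) hph)))
  · obtain ⟨q, hq, hpq⟩ := UniqueFactorizationMonoid.exists_mem_factors_of_dvd h₀ hp.irreducible hpf
    have hqt : q ∣ t := Multiset.dvd_prod (Multiset.mem_filter.2
      ⟨hq, fun hqf => hpf₁ (hpq.dvd.trans hqf)⟩)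
    exact hpf₁ ((dvd_add_left ((hpq.dvd.trans hqt).mul_right h)).1 hpg)

theorem exists_notMem_of_monic (m : Ideal R) [m.IsMaximal] {f₀ f₁ h a b : R[X]} (h₀ : f₀.Monic)
    (hab : a * f₀ + b * f₁ + h = 1) :
    ∃ c ∉ m, ∃ t p q : R[X], p * f₀ + q * (f₁ + t * h) = C c := by
  let : Field (R ⧸ m) := Ideal.Quotient.field m
  set π : R[X] →+* (R ⧸ m)[X] := mapRingHom (Ideal.Quotient.mk m) with hπ
  have hsurj : Function.Surjective π := map_surjective _ Ideal.Quotient.mk_surjective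
  obtain ⟨t, ht⟩ := exists_isCoprime_add_mul (f₀ := π f₀) (f₁ := π f₁) (h := π h)
    (a := π a) (b := π b) (h₀.map _).ne_zero
    (by simpa only [map_add, map_mul, map_one] using congrArg π hab)
  obtain ⟨t, rfl⟩ := hsurj t
  rw [← map_mul, ← map_add] at ht
  set g := f₁ + t * h
  obtain ⟨p, q, hpq⟩ := ht
  obtain ⟨p, rfl⟩ := hsurj p
  obtain ⟨q, rfl⟩ := hsurj q
  set I : Ideal R[X] := Ideal.span {f₀, g} with hI
  have hmem : 1 - (p * f₀ + q * g) ∈ m.map (C : R →+* R[X]) := by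
    have hk : RingHom.ker π = m.map (C : R →+* R[X]) := by
      rw [hπ, ker_mapRingHom, Ideal.mk_ker]
    rw [← hk, RingHom.mem_ker, map_sub, map_one, map_add, map_mul, map_mul, hpq, sub_self]
  have hle : Ideal.span {f₀} ≤ I := Ideal.span_mono (by simp)
  have : Module.Finite R (R[X] ⧸ Ideal.span {f₀}) := h₀.finite_adjoinRoot
  have : Module.Finite R (R[X] ⧸ I) := by
    refine Module.Finite.of_surjective (M := R[X] ⧸ Ideal.span {f₀})
      (Ideal.Quotient.factorₐ R hle).toLinearMap ?_
    exact Ideal.Quotient.factor_surjective hle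
  have hone : (1 : R[X] ⧸ I) ∈ m.map (algebraMap R (R[X] ⧸ I)) := by
    have h1 := Ideal.mem_map_of_mem (Ideal.Quotient.mk I) hmem
    have h2 : Ideal.Quotient.mk I (p * f₀ + q * g) = 0 :=
      Ideal.Quotient.eq_zero_iff_mem.2 (Ideal.mem_span_pair.2 ⟨p, q, rfl⟩)
    rw [map_sub, h2, sub_zero, map_one, Ideal.map_map] at h1
    exact h1
  obtain ⟨r, hr, hr0⟩ := Submodule.exists_sub_one_mem_and_smul_eq_zero_of_fg_of_le_smul m
    (⊤ : Submodule R (R[X] ⧸ I)) Module.Finite.fg_top (by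
      rw [Ideal.smul_top_eq_map, (Ideal.eq_top_iff_one _).2 hone]; exact le_of_eq rfl)
  refine ⟨r, fun hrm => ?_, t, ?_⟩
  · exact (Ideal.ne_top_iff_one m).1 (Ideal.IsMaximal.ne_top ‹_›) (by simpa using sub_mem hrm hr)
  · have h3 : Ideal.Quotient.mk I (C r) = 0 := by
      have h4 : Ideal.Quotient.mk I (r • (1 : R[X])) = 0 := hr0 1 trivial
      rwa [smul_eq_C_mul, mul_one] at h4
    exact Ideal.mem_span_pair.1 (Ideal.Quotient.eq_zero_iff_mem.1 h3)

/-- Suslin's theorem: a unimodular row of polynomials with a monic entry is equivalent to its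
value at zero. -/
theorem rowEquivMod_eval_zero (v : Fin (n + 2) → R[X]) (h₀ : (v 0).Monic)
    (hv : ∃ c, c ⬝ᵥ v = 1) : RowEquivMod 1 v (fun i => C ((v i).eval 0)) := by
  obtain ⟨c, hc⟩ := hv
  let J : Ideal R :=
    { carrier := {r | ∀ b x : R[X],
        RowEquivMod 1 (fun i => (v i).comp b) (fun i => (v i).comp (b + C r * x))}
      add_mem' := fun {r r'} h h' b x => by
        have h2 := (h b x).trans (h' _ x)
        rwa [add_assoc, ← add_mul, ← C_add] at h2
      zero_mem' := fun b x => by simpa using RowEquivMod.refl _ _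
      smul_mem' := fun r r' h b x => by
        have h2 := h b (C r * x)
        rwa [← mul_assoc, ← C_mul, mul_comm r'] at h2 }
  have hJ : J = ⊤ := by
    by_contra hne
    obtain ⟨m, hm, hJm⟩ := Ideal.exists_le_maximal J hne
    set y : Fin n → R[X] := fun i => v i.succ.succ with hy
    set e : Fin n → R[X] := fun i => c i.succ.succ with he
    obtain ⟨r, hr, t, p, q, hpq⟩ := exists_notMem_of_monic m (f₁ := v 1) (h := e ⬝ᵥ y)
      (a := c 0) (b := c 1) h₀ (by
        rw [← hc]
        simp [dotProduct, Fin.sum_univ_succ, add_assoc, hy, he])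
    refine hr (hJm fun b x => ?_)
    have h := rowEquivMod_comp_add (v 0) (v 1) y (t • e) r p q
      (by rw [smul_dotProduct, smul_eq_mul, hpq]) b x
    convert h using 1 <;> ext1 i <;>
      refine Fin.cases ?_ (fun i => Fin.cases ?_ (fun i => ?_) i) i <;> simp [hy]
  have h1 : (1 : R) ∈ J := hJ ▸ Submodule.mem_top
  simpa using h1 X (-X)

end Suslin

section MatrixNotation

open Matrix

theorem Ideal.exists_mem_submonoid_of_forall_prime {A : Type*} [CommRing A] (I : Ideal A)
    (S : Submonoid A) (h : ∀ M : Ideal A, M.IsPrime → I ≤ M → ∃ x ∈ S, x ∈ M) :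
    ∃ x ∈ S, x ∈ I := by
  by_contra! hcon
  obtain ⟨M, hM, hIM, hdisj⟩ := Ideal.exists_le_prime_disjoint I S
    (Set.disjoint_left.2 fun x hxI hxS => hcon x hxS hxI)
  obtain ⟨x, hxS, hxM⟩ := h M hM hIM
  exact Set.disjoint_left.1 hdisj hxM hxS

theorem Ideal.mem_span_range_iff_dotProduct {A ι : Type*} [CommRing A] [Fintype ι] {x : A}
    {v : ι → A} : x ∈ Ideal.span (Set.range v) ↔ ∃ c : ι → A, c ⬝ᵥ v = x :=
  Ideal.mem_span_range_iff_exists_fun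

theorem Ideal.exists_mem_notMem_prime_of_dotProduct_eq_one {A : Type*} [CommRing A] {n : ℕ} {a : A}
    {y c : Fin n → A} {c₀ : A} (h : c₀ * a + c ⬝ᵥ y = 1) (M : Ideal A) (hM : M.IsPrime)
    (hy : ∀ i, y i ∈ M) : a ∉ M := fun ha =>
  hM.ne_top ((Ideal.eq_top_iff_one _).2 (h ▸ add_mem (M.mul_mem_left _ ha)
    (show ∑ i, c i * y i ∈ M from M.sum_mem fun i _ => M.mul_mem_left _ (hy i))))

section DimensionRows

variable {R : Type*} [CommRing R] [IsNoetherianRing R] {d : ℕ}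

theorem exists_span_height_ge {A : Type*} [CommRing A] [IsNoetherianRing A] (r : ℕ)
    (v : Fin (r + 1) → A) (hv : ∃ c, c ⬝ᵥ v = 1) : ∃ a, ∃ y : Fin r → A,
      RowEquivMod 1 v (Fin.cons a y) ∧
        ∀ M : Ideal A, M.IsPrime → (∀ i, y i ∈ M) → (r : ℕ∞) ≤ M.height := by
  obtain ⟨a, y, rfl⟩ : ∃ (a : A) (y : Fin r → A), v = Fin.cons a y :=
    ⟨v 0, Fin.tail v, (Fin.cons_self_tail v).symm⟩
  obtain ⟨b, hb⟩ := exists_general_position_height a r y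
  have h1 := RowEquivMod.add_tail 1 a y b
  rw [one_mul] at h1
  refine ⟨a, _, h1, fun M hM hMy => (hb M hM hMy).resolve_left ?_⟩
  obtain ⟨c, hc⟩ := h1.unimodular hv
  refine Ideal.exists_mem_notMem_prime_of_dotProduct_eq_one (c₀ := c 0) (c := Fin.tail c) ?_
    M hM hMy
  rw [← hc]
  simp [dotProduct, Fin.sum_univ_succ, Fin.tail]

theorem rowEquivMod_of_tail_unimodular {A : Type*} [CommRing A] {n : ℕ} (a : A) (y c : Fin n → A)
    (hc : c ⬝ᵥ y = 1) :
    RowEquivMod 1 (Fin.cons a y : Fin (n + 1) → A) (Fin.cons 1 0) := by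
  have h1 := RowEquivMod.add_head 1 a y ((1 - a) • c)
  rw [smul_dotProduct, hc, one_mul, smul_eq_mul, mul_one, add_sub_cancel] at h1
  have h2 := RowEquivMod.add_tail 1 1 y (-y)
  rw [one_mul, one_smul, add_neg_cancel] at h2
  exact h1.trans h2

theorem rowEquivMod_of_ringKrullDim_lt {A : Type*} [CommRing A] [IsNoetherianRing A]
    (hd : ringKrullDim A ≤ d) (v : Fin (d + 2) → A) (hv : ∃ c, c ⬝ᵥ v = 1) :
    RowEquivMod 1 v (Fin.cons 1 0 : Fin (d + 2) → A) := by
  obtain ⟨a, y, h, hy⟩ := exists_span_height_ge (d + 1) v hv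
  obtain ⟨x, hx, hxI⟩ := Ideal.exists_mem_submonoid_of_forall_prime (Ideal.span (Set.range y)) ⊥
    fun M hM hIM => by
      have h1 := hy M hM fun i => hIM (Ideal.subset_span ⟨i, rfl⟩)
      have h2 := M.height_le_ringKrullDim_of_isPrime.trans hd
      have h3 : ((d + 1 : ℕ) : ℕ∞) ≤ (d : ℕ∞) := h1.trans (WithBot.coe_le_coe.1 h2)
      exact absurd (Nat.cast_le.1 h3) (by omega)
  rw [Submonoid.mem_bot.1 hx, Ideal.mem_span_range_iff_dotProduct] at hxI
  obtain ⟨c, hc⟩ := hxI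
  exact h.trans (rowEquivMod_of_tail_unimodular a y c hc)

/-- Unimodular rows of length at least `dim R + 2` over `R[X]` can be completed. -/
theorem rowEquivMod_polynomial (hd : ringKrullDim R ≤ d) (v : Fin (d + 2) → R[X])
    (hv : ∃ c, c ⬝ᵥ v = 1) : RowEquivMod 1 v (Fin.cons 1 0 : Fin (d + 2) → R[X]) := by
  obtain ⟨a, y, h, hy⟩ := exists_span_height_ge (d + 1) v hv
  obtain ⟨f, hf, hfI⟩ := Ideal.exists_mem_submonoid_of_forall_prime (Ideal.span (Set.range y))
    { carrier := {p : R[X] | p.Monic}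
      mul_mem' := fun hp hq => Monic.mul hp hq
      one_mem' := monic_one } fun M hM hIM => by
      obtain ⟨-, f, hfM, hf⟩ := exists_monic_mem_of_dim_lt_height hd M
        (hy M hM fun i => hIM (Ideal.subset_span ⟨i, rfl⟩))
      exact ⟨f, hf, hfM⟩
  replace hf : f.Monic := hf
  obtain ⟨c, hc⟩ := Ideal.mem_span_range_iff_dotProduct.1 hfI
  have h1 := RowEquivMod.add_head 1 a y ((X ^ (a.natDegree + 1) : R[X]) • c)
  rw [smul_dotProduct, hc, one_mul, smul_eq_mul] at h1
  have hmonic : (a + X ^ (a.natDegree + 1) * f).Monic := by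
    nontriviality R
    refine Monic.add_of_right ((monic_X_pow _).mul hf) (degree_lt_degree ?_)
    rw [(monic_X_pow _).natDegree_mul hf, natDegree_X_pow]
    omega
  have h2 := h.trans h1
  have h3 := rowEquivMod_eval_zero (Fin.cons (a + X ^ (a.natDegree + 1) * f) y) hmonic
    (h2.unimodular hv)
  have h4 := h2.trans h3
  refine h4.trans ?_
  set w : Fin (d + 2) → R := fun i =>
    ((Fin.cons (a + X ^ (a.natDegree + 1) * f) y : Fin (d + 2) → R[X]) i).eval 0
  obtain ⟨e, he⟩ := h4.unimodular hv
  have h5 := (rowEquivMod_of_ringKrullDim_lt hd w ⟨fun i => (e i).eval 0, by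
    have := congrArg (eval 0) he
    simpa [dotProduct, eval_finsetSum] using this⟩).map (C : R →+* R[X])
  rw [map_one] at h5
  convert h5 using 1 <;> ext1 i <;> refine Fin.cases ?_ (fun i => ?_) i <;> simp [w]

end DimensionRows

section Excision

variable {R : Type*} [CommRing R]

theorem ringKrullDim_le_of_isIntegral {S : Type*} [CommRing S] [Algebra R S]
    [Algebra.IsIntegral R S] : ringKrullDim S ≤ ringKrullDim R :=
  Order.krullDim_le_of_strictMono (fun p => ⟨p.asIdeal.comap (algebraMap R S), inferInstance⟩)
    fun p _ h => Ideal.IsIntegral.comap_lt_comap (I := p.asIdeal) h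

theorem rowEquivMod_polynomial_relative [IsNoetherianRing R] {d : ℕ} (hd : ringKrullDim R ≤ d)
    (s : R) (x : R[X]) (w : Fin (d + 1) → R[X])
    (hv : ∃ c, c ⬝ᵥ (Fin.cons (1 + C s * x) (C s • w) : Fin (d + 2) → R[X]) = 1) :
    RowEquivMod (C s) (Fin.cons (1 + C s * x) (C s • w) : Fin (d + 2) → R[X])
      (Fin.cons 1 0) := by
  obtain ⟨c, hc⟩ := hv
  simp only [dotProduct, Fin.sum_univ_succ (n := d + 1), Fin.cons_zero, Fin.cons_succ,
    Pi.smul_apply, smul_eq_mul] at hc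
  set q : R[X] := X ^ 2 - C s * X with hq
  have hmon : q.Monic := by
    exact monic_X_pow_sub ((degree_C_mul_X_le s).trans_lt (by exact_mod_cast one_lt_two))
  have hfin : Module.Finite R (AdjoinRoot q) := hmon.finite_adjoinRoot
  have hnoeth : IsNoetherianRing (AdjoinRoot q) := IsNoetherianRing.of_finite R _
  have hdim : ringKrullDim (AdjoinRoot q) ≤ d := ringKrullDim_le_of_isIntegral.trans hd
  set Z : (AdjoinRoot q)[X] := C (AdjoinRoot.root q) with hZ
  set τ : R[X] →+* (AdjoinRoot q)[X] := mapRingHom (AdjoinRoot.of q) with hτ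
  have hZZ : Z * Z = τ (C s) * Z := by
    have h1 := AdjoinRoot.eval₂_root q
    rw [hq, eval₂_sub, eval₂_mul, eval₂_pow, eval₂_X, eval₂_C, sub_eq_zero] at h1
    rw [hτ, coe_mapRingHom, map_C, hZ, ← C_mul, ← C_mul, ← h1, pow_two]
  set V : Fin (d + 2) → (AdjoinRoot q)[X] :=
    Fin.cons (1 + τ x * Z) (fun i : Fin (d + 1) => τ (w i) * Z) with hV
  have hVu : ∃ c, c ⬝ᵥ V = 1 := by
    refine ⟨Fin.cons (1 - τ x * τ (c 0) * Z)
      (fun i : Fin (d + 1) => - (τ x * τ (c i.succ) * Z)), ?_⟩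
    have h1 : (∑ i : Fin (d + 1), -(τ x * τ (c i.succ) * Z) * (τ (w i) * Z)) =
        - (τ x * Z * ∑ i : Fin (d + 1), τ (c i.succ) * (τ (C s) * τ (w i))) := by
      rw [Finset.mul_sum, ← Finset.sum_neg_distrib]
      refine Finset.sum_congr rfl fun i _ => ?_
      linear_combination (-(τ x * τ (c i.succ) * τ (w i))) * hZZ
    have h2 := congrArg τ hc
    simp only [map_add, map_mul, map_one, map_sum] at h2
    simp only [hV, dotProduct, Fin.sum_univ_succ (n := d + 1), Fin.cons_zero, Fin.cons_succ]
    rw [h1]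
    linear_combination (-(τ x * Z)) * h2 - τ x * τ x * τ (c 0) * hZZ
  obtain ⟨M, hM, hMV⟩ := (rowEquivMod_polynomial hdim V hVu).exists_det
  have hroot (t : R) (ht : t * t = s * t) : q.eval₂ (RingHom.id R) t = 0 := by
    simp [hq, pow_two, ht]
  set ε₁ : (AdjoinRoot q)[X] →+* R[X] :=
    mapRingHom (AdjoinRoot.lift (RingHom.id R) s (hroot s rfl)) with hε₁
  set ε₀ : (AdjoinRoot q)[X] →+* R[X] :=
    mapRingHom (AdjoinRoot.lift (RingHom.id R) 0 (hroot 0 (by simp))) with hε₀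
  have hdvd (P : (AdjoinRoot q)[X]) : C s ∣ ε₁ P - ε₀ P := by
    rw [C_dvd_iff_dvd_coeff]
    intro i
    rw [coeff_sub, hε₁, hε₀, coe_mapRingHom, coe_mapRingHom, coeff_map, coeff_map]
    obtain ⟨p, hp⟩ := AdjoinRoot.mk_surjective (P.coeff i)
    rw [← hp, AdjoinRoot.lift_mk, AdjoinRoot.lift_mk]
    have h1 := sub_dvd_eval_sub s 0 p
    rwa [sub_zero] at h1
  choose N hN using fun i j => hdvd (M i j)
  have hM₀ : IsUnit (ε₀.mapMatrix M).det := by rw [← RingHom.map_det]; exact hM.map _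
  have hM₁ : IsUnit (ε₁.mapMatrix M).det := by rw [← RingHom.map_det]; exact hM.map _
  have hτ₁ (p : R[X]) : ε₁ (τ p) = p := by
    rw [hε₁, hτ, coe_mapRingHom, coe_mapRingHom, Polynomial.map_map]
    ext i; simp
  have hτ₀ (p : R[X]) : ε₀ (τ p) = p := by
    rw [hε₀, hτ, coe_mapRingHom, coe_mapRingHom, Polynomial.map_map]
    ext i; simp
  have hZ₁ : ε₁ Z = C s := by simp [hε₁, hZ]
  have hZ₀ : ε₀ Z = 0 := by simp [hε₀, hZ]
  have hsub : ε₁.mapMatrix M = ε₀.mapMatrix M + C s • of N := by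
    ext1 i j
    change ε₁ (M i j) = ε₀ (M i j) + C s * N i j
    rw [← hN i j, add_sub_cancel]
  have hV₁ : ε₁.mapMatrix M *ᵥ (Fin.cons (1 + C s * x) (C s • w) : Fin (d + 2) → R[X]) =
      (Fin.cons 1 0 : Fin (d + 2) → R[X]) := by
    have e1 : (Fin.cons (1 + C s * x) (C s • w) : Fin (d + 2) → R[X]) = ε₁ ∘ V := by
      ext1 i
      refine Fin.cases ?_ (fun i => ?_) i <;> simp [hV, hτ₁, hZ₁, mul_comm]
    rw [e1]
    ext1 i
    refine ((RingHom.map_mulVec ε₁ M V i).symm).trans ?_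
    rw [hMV]
    refine Fin.cases ?_ (fun i => ?_) i <;> simp
  have hV₀ : ε₀.mapMatrix M *ᵥ (Fin.cons 1 0 : Fin (d + 2) → R[X]) =
      (Fin.cons 1 0 : Fin (d + 2) → R[X]) := by
    have e1 : (Fin.cons 1 0 : Fin (d + 2) → R[X]) = ε₀ ∘ V := by
      ext1 i
      refine Fin.cases ?_ (fun i => ?_) i <;> simp [hV, hτ₀, hZ₀]
    rw [e1]
    ext1 i
    refine ((RingHom.map_mulVec ε₀ M V i).symm).trans ?_
    rw [hMV, ← e1]
    refine Fin.cases ?_ (fun i => ?_) i <;> simp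
  have h1 : 1 + C s • ((ε₀.mapMatrix M)⁻¹ * of N) = (ε₀.mapMatrix M)⁻¹ * ε₁.mapMatrix M := by
    rw [hsub, mul_add, nonsing_inv_mul _ hM₀, Matrix.mul_smul]
  refine ⟨(ε₀.mapMatrix M)⁻¹ * of N, ?_, ?_⟩
  · rw [h1, det_mul]
    exact (isUnit_nonsing_inv_det _ hM₀).mul hM₁
  · rw [h1, ← mulVec_mulVec, hV₁]
    conv_lhs => rw [← hV₀]
    rw [mulVec_mulVec, nonsing_inv_mul _ hM₀, one_mulVec]

end Excision

/-- The ring `A` contains the polynomial ring `R[X]`, every element of `A` becomes a polynomial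
after multiplication by powers of `s` and `g`, and `g` becomes a unit once `s` is inverted. -/
structure IsPolynomialModel {R A : Type*} [CommRing R] [CommRing A] (i : R[X] →+* A) (s : R)
    (g : R[X]) : Prop where
  injective : Function.Injective i
  exists_pow_mul_eq : ∀ y : A, ∃ (k j : ℕ) (q : R[X]), i (C s) ^ k * i g ^ j * y = i q
  exists_dvd_pow : ∃ k : ℕ, i g ∣ i (C s) ^ k

namespace IsPolynomialModel

variable {R A : Type*} [CommRing R] [CommRing A] {i : R[X] →+* A} {s : R} {g : R[X]}

theorem exists_forall_pow_mul_eq (H : IsPolynomialModel i s g) {n : ℕ} (y : Fin n → A) :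
    ∃ (k j : ℕ) (q : Fin n → R[X]), ∀ l, i (C s) ^ k * i g ^ j * y l = i (q l) := by
  choose k j q hq using fun l => H.exists_pow_mul_eq (y l)
  refine ⟨∑ l, k l, ∑ l, j l, fun l => C s ^ (∑ l, k l - k l) * g ^ (∑ l, j l - j l) * q l,
    fun l => ?_⟩
  have hk : k l ≤ ∑ l, k l := Finset.single_le_sum (fun _ _ => Nat.zero_le _) (Finset.mem_univ l)
  have hj : j l ≤ ∑ l, j l := Finset.single_le_sum (fun _ _ => Nat.zero_le _) (Finset.mem_univ l)
  rw [map_mul, map_mul, map_pow, map_pow, ← hq]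
  nth_rewrite 1 [← Nat.sub_add_cancel hk]
  nth_rewrite 1 [← Nat.sub_add_cancel hj]
  rw [pow_add, pow_add]
  ring

theorem image_notMem (H : IsPolynomialModel i s g) {M : Ideal A} (hM : M.IsPrime)
    (hs : i (C s) ∉ M) : i g ∉ M := fun hg => by
  obtain ⟨k, hk⟩ := H.exists_dvd_pow
  exact hs (hM.mem_of_pow_mem k (M.mem_of_dvd hk hg))

theorem comap_lt_comap (H : IsPolynomialModel i s g) {M N : Ideal A} (hN : N.IsPrime)
    (hs : i (C s) ∉ M) (hNM : N < M) : N.comap i < M.comap i := by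
  obtain ⟨y, hyM, hyN⟩ := SetLike.exists_of_lt hNM
  obtain ⟨k, j, q, hq⟩ := H.exists_pow_mul_eq y
  refine SetLike.lt_iff_le_and_exists.2 ⟨Ideal.comap_mono hNM.le, q, ?_, fun hqN => ?_⟩
  · rw [Ideal.mem_comap, ← hq]
    exact M.mul_mem_left _ hyM
  · rw [Ideal.mem_comap, ← hq] at hqN
    have hsN : i (C s) ∉ N := fun h => hs (hNM.le h)
    rcases hN.mem_or_mem hqN with h | h
    · rcases hN.mem_or_mem h with h | h
      · exact hsN (hN.mem_of_pow_mem _ h)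
      · exact H.image_notMem hN hsN (hN.mem_of_pow_mem _ h)
    · exact hyN h

theorem height_lt_of_height_comap_lt [IsNoetherianRing R] (H : IsPolynomialModel i s g) (n : ℕ) :
    ∀ M : Ideal A, M.IsPrime → i (C s) ∉ M → (M.comap i).height < n → M.height < n := by
  induction n with
  | zero => intro M hM hs h; simp at h
  | succ n ih =>
    intro M hM hs h
    rw [Nat.cast_add_one, ENat.lt_add_one_iff (ENat.natCast_ne_top n)] at h ⊢
    refine Ideal.height_le_iff.2 fun q hq hqM => ih q hq (fun h => hs (hqM.le h)) ?_
    exact (Ideal.height_strict_mono_of_isPrime (H.comap_lt_comap hq hs hqM)).trans_le h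

/-- Modulo an ideal of height greater than `dim R` that is comaximal with `s`, every element of
`A` is a polynomial divisible by `g`. -/
theorem exists_mul_sub_mem [IsNoetherianRing R] {d : ℕ} (H : IsPolynomialModel i s g)
    (hd : ringKrullDim R ≤ d) (I : Ideal A)
    (hI : ∀ M : Ideal A, M.IsPrime → I ≤ M → i (C s) ∉ M ∧ ((d + 1 : ℕ) : ℕ∞) ≤ M.height) (x : A) :
    ∃ q, i (g * q) - x ∈ I := by
  obtain ⟨_, ⟨p, hp, rfl⟩, hpI⟩ := Ideal.exists_mem_submonoid_of_forall_prime I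
    (Submonoid.map i
    { carrier := {p : R[X] | IsCoprime p (C s * g)}
      mul_mem' := fun hp hq => IsCoprime.mul_left hp hq
      one_mem' := isCoprime_one_left }) fun M hM hIM => by
      obtain ⟨hsM, hht⟩ := hI M hM hIM
      have hprime : (M.comap i).IsPrime := inferInstance
      obtain ⟨hmax, -⟩ := exists_monic_mem_of_dim_lt_height hd (M.comap i) (by
        by_contra! hlt
        exact absurd (H.height_lt_of_height_comap_lt _ M hM hsM hlt) hht.not_gt)
      obtain ⟨e, p, hpM, he⟩ := hmax.exists_inv (x := C s * g) fun h => by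
        rcases hprime.mem_or_mem h with h | h
        · exact hsM h
        · exact H.image_notMem hM hsM h
      exact ⟨i p, ⟨p, ⟨1, e, by linear_combination he⟩, rfl⟩, hpM⟩
  replace hp : IsCoprime p (C s * g) := hp
  obtain ⟨k, j, q, hq⟩ := H.exists_pow_mul_eq x
  obtain ⟨e₁, e₂, he⟩ : IsCoprime p (C s ^ k * g ^ j) :=
    (hp.of_mul_right_left.pow_right).mul_right hp.of_mul_right_right.pow_right
  obtain ⟨u, w, huw⟩ := hp.of_mul_right_right
  refine ⟨e₂ * q * w, ?_⟩
  have h1 := congrArg i he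
  have h2 := congrArg i huw
  simp only [map_add, map_mul, map_pow, map_one] at h1 h2
  have : i (g * (e₂ * q * w)) - x = - (i e₂ * i q * i u + i e₁ * x) * i p := by
    simp only [map_mul]
    rw [← hq]
    linear_combination (i e₂ * (i (C s) ^ k * i g ^ j * x)) * h2 + x * h1
  rw [this]
  exact I.mul_mem_left _ hpI

theorem exists_unimodular_of_map [IsNoetherianRing R] (H : IsPolynomialModel i s g) {n : ℕ}
    (a : R[X]) (y : Fin n → R[X]) (ha : IsCoprime a (C s * g))
    (h : ∃ c, c ⬝ᵥ (i ∘ (Fin.cons a y : Fin (n + 1) → R[X])) = 1) :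
    ∃ c, c ⬝ᵥ (Fin.cons a y : Fin (n + 1) → R[X]) = 1 := by
  obtain ⟨c, hc⟩ := h
  obtain ⟨k, j, q, hq⟩ := H.exists_forall_pow_mul_eq c
  have h1 : q ⬝ᵥ (Fin.cons a y : Fin (n + 1) → R[X]) = C s ^ k * g ^ j := by
    apply H.injective
    rw [RingHom.map_dotProduct]
    have : i ∘ q = (i (C s) ^ k * i g ^ j) • c := by
      ext l; simp [hq]
    rw [this, smul_dotProduct, hc]
    simp
  obtain ⟨e₁, e₂, he⟩ : IsCoprime a (C s ^ k * g ^ j) :=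
    (ha.of_mul_right_left.pow_right).mul_right ha.of_mul_right_right.pow_right
  refine ⟨e₂ • q + Fin.cons e₁ 0, ?_⟩
  rw [add_dotProduct, smul_dotProduct, h1, ← he]
  simp [dotProduct, Fin.sum_univ_succ]
  ring

theorem rowEquivMod [IsNoetherianRing R] [IsNoetherianRing A] {d : ℕ}
    (H : IsPolynomialModel i s g) (hd : ringKrullDim R ≤ d) (x : A) (z : Fin (d + 1) → A)
    (hv : ∃ c, c ⬝ᵥ (Fin.cons (1 + i (C s) ^ 2 * x) (i (C s) • z) : Fin (d + 2) → A) = 1) :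
    RowEquivMod (i (C s)) (Fin.cons (1 + i (C s) ^ 2 * x) (i (C s) • z) : Fin (d + 2) → A)
      (Fin.cons 1 0) := by
  set σ := i (C s) with hσ
  set a := 1 + σ ^ 2 * x with ha
  obtain ⟨z, hz, h₁⟩ : ∃ z' : Fin (d + 1) → A, σ ∣ z' 0 - 1 ∧
      RowEquivMod σ (Fin.cons a (σ • z) : Fin (d + 2) → A) (Fin.cons a (σ • z')) := by
    refine ⟨z + a • Pi.single 0 (1 - z 0), ⟨σ * x * (1 - z 0), ?_⟩, ?_⟩
    · simp only [Pi.add_apply, Pi.smul_apply, Pi.single_eq_same, smul_eq_mul, ha]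
      ring
    · rw [smul_add, smul_smul]
      exact RowEquivMod.add_tail ..
  obtain ⟨b, hb⟩ := exists_general_position_height (σ * a) (d + 1) z
  have h₂ := RowEquivMod.add_tail σ a (σ • z) (σ • b)
  rw [smul_comm (σ * a) σ b, ← smul_add] at h₂
  set y := z + (σ * a) • b with hy
  have h₁₂ := h₁.trans h₂
  obtain ⟨c, hc⟩ := h₁₂.unimodular hv
  have hI (M : Ideal A) (hM : M.IsPrime) (hyM : Ideal.span (Set.range y) ≤ M) :
      σ ∉ M ∧ ((d + 1 : ℕ) : ℕ∞) ≤ M.height := by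
    have hyM' (l) : y l ∈ M := hyM (Ideal.subset_span ⟨l, rfl⟩)
    have hσ : σ ∉ M := fun h => by
      have e1 : (1 : A) = y 0 - (z 0 - 1) - σ * (a * b 0) := by
        simp only [hy, Pi.add_apply, Pi.smul_apply, smul_eq_mul]
        ring
      exact hM.ne_top ((Ideal.eq_top_iff_one _).2 (e1 ▸ sub_mem (sub_mem (hyM' 0)
        (M.mem_of_dvd hz h)) (M.mul_mem_right _ h)))
    refine ⟨hσ, (hb M hM hyM').resolve_left fun h => ?_⟩
    rcases hM.mem_or_mem h with h | h
    · exact hσ h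
    · refine Ideal.exists_mem_notMem_prime_of_dotProduct_eq_one (a := a) (y := σ • y)
        (c₀ := c 0) (c := Fin.tail c) ?_ M hM (fun l => M.mul_mem_left _ (hyM' l)) h
      rw [← hc]
      simp [dotProduct, Fin.sum_univ_succ, Fin.tail]
  obtain ⟨q, hq⟩ := H.exists_mul_sub_mem hd _ hI x
  obtain ⟨e, he⟩ := Ideal.mem_span_range_iff_dotProduct.1 hq
  set a' : R[X] := 1 + C s * (C s * (g * q)) with ha'
  have h₃ : RowEquivMod σ (Fin.cons a (σ • y) : Fin (d + 2) → A) (Fin.cons (i a') (σ • y)) := by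
    convert RowEquivMod.add_head σ a (σ • y) e using 2
    rw [dotProduct_smul, he, ha', ha, hσ]
    simp only [map_add, map_mul, map_one, smul_eq_mul]
    ring
  have hcop : IsCoprime a' (C s * g) := ⟨1, - (C s * q), by rw [ha']; ring⟩
  obtain ⟨k, j, p, hp⟩ := H.exists_forall_pow_mul_eq y
  obtain ⟨e₁, e₂, he'⟩ : IsCoprime a' (C s ^ k * g ^ j) :=
    (hcop.of_mul_right_left.pow_right).mul_right hcop.of_mul_right_right.pow_right
  have h₄ := RowEquivMod.add_tail σ (i a') (σ • y) ((-i e₁) • y)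
  have hw : σ • y + (σ * i a') • (-i e₁) • y = σ • (i ∘ (e₂ • p)) := by
    ext l
    have h1 := congrArg i he'
    simp only [map_add, map_mul, map_pow, map_one] at h1
    simp only [Pi.add_apply, Pi.smul_apply, smul_eq_mul, Function.comp_apply, map_mul, ← hp]
    linear_combination (-(σ * y l)) * h1
  rw [hw] at h₄
  have h₅ := (h₁₂.trans h₃).trans h₄
  have hrow : (Fin.cons (i a') (σ • (i ∘ (e₂ • p))) : Fin (d + 2) → A) =
      i ∘ (Fin.cons a' (C s • (e₂ • p)) : Fin (d + 2) → R[X]) := by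
    ext l
    refine Fin.cases ?_ (fun l => ?_) l <;> simp [hσ]
  have h₆ := (rowEquivMod_polynomial_relative hd s (C s * (g * q)) (e₂ • p)
    (H.exists_unimodular_of_map _ _ hcop (hrow ▸ h₅.unimodular hv))).map i
  refine h₅.trans ?_
  rw [hrow]
  convert h₆ using 1
  ext l
  refine Fin.cases ?_ (fun l => ?_) l <;> simp

end IsPolynomialModel

section CommonDenominator

theorem exists_common_denominator {A Λ : Type*} [CommRing A] [CommRing Λ] [Algebra A Λ]
    (S : Submonoid A) (hS : ∀ x : Λ, ∃ t ∈ S, ∃ a, algebraMap A Λ a = algebraMap A Λ t * x)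
    {κ : Type*} [Fintype κ] (x : κ → Λ) :
    ∃ t ∈ S, ∃ a : κ → A, ∀ k, algebraMap A Λ (a k) = algebraMap A Λ t * x k := by
  choose t ht a ha using fun k => hS (x k)
  choose u hu using fun k => Finset.dvd_prod_of_mem t (Finset.mem_univ k)
  refine ⟨∏ k, t k, prod_mem fun k _ => ht k, fun k => u k * a k, fun k => ?_⟩
  rw [hu k, map_mul, map_mul, ha]
  ring

open TensorProduct in
theorem exists_smul_eq_one_tmul {A Λ P : Type*} [CommRing A] [CommRing Λ] [Algebra A Λ]
    [AddCommGroup P] [Module A P]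
    (S : Submonoid A) (hS : ∀ x : Λ, ∃ t ∈ S, ∃ a, algebraMap A Λ a = algebraMap A Λ t * x)
    (x : Λ ⊗[A] P) : ∃ t ∈ S, ∃ p : P, t • x = 1 ⊗ₜ p := by
  induction x with
  | zero => exact ⟨1, one_mem _, 0, by simp⟩
  | tmul l p =>
    obtain ⟨t, ht, a, ha⟩ := hS l
    refine ⟨t, ht, a • p, ?_⟩
    rw [smul_tmul', Algebra.smul_def, ← ha, ← mul_one (algebraMap A Λ a), ← Algebra.smul_def,
      smul_tmul]
  | add x y hx hy =>
    obtain ⟨t, ht, p, hp⟩ := hx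
    obtain ⟨t', ht', p', hp'⟩ := hy
    refine ⟨t * t', mul_mem ht ht', t' • p + t • p', ?_⟩
    rw [smul_add, mul_comm, mul_smul, hp, mul_comm, mul_smul, hp', tmul_add, tmul_smul, tmul_smul]

open TensorProduct in
/-- A projective module of rank at least `r` has a free summand of rank `r` after base change to
a principal ideal domain; clearing denominators gives vectors and functionals that are dual to
each other up to a scalar. -/
theorem exists_dual_family {A Λ P : Type*} [CommRing A] [CommRing Λ] [Algebra A Λ] [IsDomain Λ]
    [IsPrincipalIdealRing Λ]
    [AddCommGroup P] [Module A P] [Module.Finite A P] [Module.Projective A P]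
    (S : Submonoid A) (hS : ∀ x : Λ, ∃ t ∈ S, ∃ a, algebraMap A Λ a = algebraMap A Λ t * x)
    (r : ℕ) (hr : ∀ q : PrimeSpectrum A, r ≤ Module.rankAtStalk P q) :
    ∃ t ∈ S, ∃ (p : Fin r → P) (φ : Fin r → P →ₗ[A] A), ∀ j k,
      algebraMap A Λ (φ j (p k)) = algebraMap A Λ (if j = k then t else 0) := by
  have : Module.Free Λ (Λ ⊗[A] P) := Module.free_of_finite_type_torsion_free'
  have hfin : r ≤ Module.finrank Λ (Λ ⊗[A] P) := by
    have h1 := Module.rankAtStalk_baseChange (R := A) (M := P) (S := Λ) ⟨⊥, inferInstance⟩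
    rw [Module.rankAtStalk_eq_finrank_of_free] at h1
    have h2 := hr (PrimeSpectrum.comap (algebraMap A Λ) ⟨⊥, inferInstance⟩)
    rw [← h1] at h2
    simpa using h2
  set b := Module.finBasis Λ (Λ ⊗[A] P)
  choose t ht p hp using fun k : Fin r => exists_smul_eq_one_tmul S hS (b (Fin.castLE hfin k))
  choose u hu using fun k => Finset.dvd_prod_of_mem t (Finset.mem_univ k)
  obtain ⟨n, F, G, -, -, hFG⟩ := Module.Finite.exists_comp_eq_id_of_projective A P
  have hx (x : P) : x = ∑ l, G x l • F (Pi.single l 1) := by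
    conv_lhs => rw [← LinearMap.id_apply (R := A) x, ← hFG, LinearMap.comp_apply,
      pi_eq_sum_univ' (G x), map_sum]
    simp only [map_smul]
  obtain ⟨t', ht', c, hc⟩ := exists_common_denominator S hS (κ := Fin r × Fin n)
    fun jl => b.coord (Fin.castLE hfin jl.1) (1 ⊗ₜ F (Pi.single jl.2 1))
  have hφ (j : Fin r) (x : P) : algebraMap A Λ (∑ l, c (j, l) * G x l) =
      algebraMap A Λ t' * b.coord (Fin.castLE hfin j) (1 ⊗ₜ x) := by
    conv_rhs => rw [hx x]
    simp only [tmul_sum, map_sum, Finset.mul_sum, map_mul, hc]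
    refine Finset.sum_congr rfl fun l _ => ?_
    rw [tmul_smul, ← algebraMap_smul Λ (G x l), map_smul, smul_eq_mul]
    ring
  refine ⟨t' * ∏ k, t k, mul_mem ht' (prod_mem fun k _ => ht k), fun k => u k • p k,
    fun j => ∑ l, c (j, l) • (LinearMap.proj l ∘ₗ G), fun j k => ?_⟩
  have h1 : (1 : Λ) ⊗ₜ[A] (u k • p k) =
      algebraMap A Λ (∏ k, t k) • b (Fin.castLE hfin k) := by
    rw [tmul_smul, ← hp, smul_smul, mul_comm, ← hu k, algebraMap_smul]
  have h2 := hφ j (u k • p k)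
  rw [h1, LinearMap.map_smul (b.coord _), Module.Basis.coord_apply, Module.Basis.repr_self,
    Finsupp.single_apply] at h2
  simp only [LinearMap.sum_apply, LinearMap.smul_apply, LinearMap.comp_apply, LinearMap.proj_apply]
  simp only [smul_eq_mul] at h2 ⊢
  rw [h2]
  simp only [Fin.castLE_inj, eq_comm (a := k), apply_ite (algebraMap A Λ), map_zero, map_mul]
  split_ifs <;> simp

end CommonDenominator

/-- Glueing of dual families given at finitely many pairwise incomparable primes. -/
theorem exists_dual_family_of_primes {R A P κ : Type*} [CommRing R] [CommRing A] [AddCommGroup P]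
    [Module A P] [Finite κ] (i : R →+* A) (p : κ → Ideal R) (hp : ∀ k, (p k).IsPrime)
    (hanti : ∀ k l, p k ≤ p l → k = l) (q : κ → Ideal A) (hpq : ∀ k, p k ≤ (q k).comap i)
    (r : ℕ) (h : ∀ k, ∃ t ∉ p k, ∃ (x : Fin r → P) (φ : Fin r → P →ₗ[A] A), ∀ a b,
      φ a (x b) - (if a = b then i t else 0) ∈ q k) :
    ∃ t, (∀ k, t ∉ p k) ∧ ∃ (x : Fin r → P) (φ : Fin r → P →ₗ[A] A), ∀ k a b,
      φ a (x b) - (if a = b then i t else 0) ∈ q k := by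
  classical
  have := Fintype.ofFinite κ
  choose t ht x φ hφ using h
  have hu (k : κ) : ∃ u, u ∉ p k ∧ ∀ l ≠ k, u ∈ p l := by
    have : ¬ (Finset.univ.erase k).inf p ≤ p k := by
      rw [(hp k).inf_le']
      rintro ⟨l, hl, hlk⟩
      exact (Finset.mem_erase.1 hl).1 (hanti l k hlk)
    obtain ⟨u, hu, huk⟩ := Set.not_subset.1 this
    refine ⟨u, huk, fun l hl => ?_⟩
    exact (Submodule.mem_finsetInf.1 hu) l (Finset.mem_erase.2 ⟨hl, Finset.mem_univ _⟩)
  choose u hu hul using hu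
  refine ⟨∑ k, u k ^ 2 * t k, fun m hm => ?_, fun b => ∑ k, i (u k) • x k b,
    fun a => ∑ k, i (u k) • φ k a, fun m a b => ?_⟩
  · rw [← Finset.add_sum_erase _ _ (Finset.mem_univ m)] at hm
    have h1 : ∑ k ∈ Finset.univ.erase m, u k ^ 2 * t k ∈ p m :=
      sum_mem fun k hk => (p m).mul_mem_right _
        ((p m).pow_mem_of_mem (hul k m (Finset.mem_erase.1 hk).1.symm) 2 two_pos)
    have h2 := (Submodule.add_mem_iff_left _ h1).1 hm
    rcases (hp m).mem_or_mem h2 with h3 | h3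
    · exact hu m ((hp m).mem_of_pow_mem 2 h3)
    · exact ht m h3
  · have hz (k : κ) (hk : k ≠ m) : Ideal.Quotient.mk (q m) (i (u k)) = 0 :=
      Ideal.Quotient.eq_zero_iff_mem.2 (hpq m (hul k m hk.symm))
    have h1 := Ideal.Quotient.eq_zero_iff_mem.2 (hφ m a b)
    rw [← Ideal.Quotient.eq_zero_iff_mem]
    rw [map_sub, sub_eq_zero] at h1 ⊢
    have h2 : Ideal.Quotient.mk (q m) ((∑ k, i (u k) • φ k a) (∑ k, i (u k) • x k b)) =
        Ideal.Quotient.mk (q m) (i (u m)) ^ 2 * Ideal.Quotient.mk (q m) (φ m a (x m b)) := by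
      simp only [map_sum, map_smul, LinearMap.sum_apply, LinearMap.smul_apply, smul_eq_mul, map_mul]
      rw [Finset.sum_eq_single m, Finset.sum_eq_single m]
      · ring
      · intro k _ hk; rw [hz k hk]; simp
      · simp
      · intro k _ hk; rw [hz k hk]; simp
      · simp
    have h3 : Ideal.Quotient.mk (q m) (i (∑ k, u k ^ 2 * t k)) =
        Ideal.Quotient.mk (q m) (i (u m)) ^ 2 * Ideal.Quotient.mk (q m) (i (t m)) := by
      simp only [map_sum, map_mul, map_pow]
      rw [Finset.sum_eq_single m]
      · intro k _ hk; rw [hz k hk]; simp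
      · simp
    rw [h2, h1]
    simp only [apply_ite (Ideal.Quotient.mk (q m)), h3, map_zero, mul_ite, mul_zero]

theorem exists_dual_family_minimalPrimes {A P : Type*} [CommRing A] [IsNoetherianRing A]
    [AddCommGroup P] [Module A P] [Module.Finite A P] [Module.Projective A P] (I : Ideal A) (r : ℕ)
    (hr : ∀ q : PrimeSpectrum A, r ≤ Module.rankAtStalk P q) :
    ∃ t, (∀ q ∈ I.minimalPrimes, t ∉ q) ∧ ∃ (x : Fin r → P) (φ : Fin r → P →ₗ[A] A),
      ∀ q ∈ I.minimalPrimes, ∀ j k, φ j (x k) - (if j = k then t else 0) ∈ q := by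
  have hfin : Finite I.minimalPrimes := Ideal.finite_minimalPrimes_of_isNoetherianRing A I
  obtain ⟨t, ht, x, φ, h⟩ := exists_dual_family_of_primes (P := P) (RingHom.id A)
    (fun q : I.minimalPrimes => (q : Ideal A)) (fun q => q.2.1.1)
    (fun q q' hq => Subtype.ext (le_antisymm hq (q'.2.2 q.2.1 hq)))
    (fun q => (q : Ideal A)) (fun q => le_rfl) r fun q => by
      have hq : (q : Ideal A).IsPrime := q.2.1.1
      obtain ⟨t, ht, x, φ, h⟩ := exists_dual_family (Λ := (q : Ideal A).ResidueField) (P := P)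
        (q : Ideal A).primeCompl (fun y => by
          obtain ⟨a, b, hb, rfl⟩ := IsFractionRing.div_surjective (A := A ⧸ (q : Ideal A)) y
          obtain ⟨a, rfl⟩ := Ideal.Quotient.mk_surjective a
          obtain ⟨b, rfl⟩ := Ideal.Quotient.mk_surjective b
          have hb0 := nonZeroDivisors.ne_zero hb
          refine ⟨b, fun h => hb0 (Ideal.Quotient.eq_zero_iff_mem.2 h), a, ?_⟩
          have h1 (z : A) : algebraMap A (q : Ideal A).ResidueField z =
            algebraMap (A ⧸ (q : Ideal A)) _ (Ideal.Quotient.mk _ z) := rfl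
          rw [h1, h1, mul_div_cancel₀]
          rwa [Ne, FaithfulSMul.algebraMap_eq_zero_iff]) r hr
      refine ⟨t, ht, x, φ, fun j k => ?_⟩
      rw [← Ideal.algebraMap_residueField_eq_zero, map_sub, h j k, RingHom.id_apply, sub_self]
  exact ⟨t, fun q hq => ht ⟨q, hq⟩, x, φ, fun q hq => h ⟨q, hq⟩⟩

/-- Bass: over a ring of dimension less than the rank of `P`, a unimodular element `(a, p)` can be
transformed so that its component in `P` becomes unimodular. -/
theorem exists_unimodular_add_smul {A P : Type*} [CommRing A] [IsNoetherianRing A]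
    [AddCommGroup P] [Module A P] [Module.Finite A P] [Module.Projective A P] (n : ℕ)
    (hr : ∀ q : PrimeSpectrum A, n ≤ Module.rankAtStalk P q) (I : Ideal A)
    (hI : ∀ l : LTSeries (PrimeSpectrum A), I ≤ l.head.asIdeal → l.length < n)
    (a c : A) (p : P) (ψ : P →ₗ[A] A) (h : c * a + ψ p - 1 ∈ I) :
    ∃ (q : P) (ψ' : P →ₗ[A] A), ψ' (p + a • q) - 1 ∈ I := by
  induction n generalizing I c p ψ with
  | zero =>
    suffices hI1 : I = ⊤ from ⟨0, 0, by simp [hI1]⟩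
    by_contra hne
    obtain ⟨M, hM, hIM⟩ := Ideal.exists_le_maximal I hne
    exact absurd (hI (RelSeries.singleton _ ⟨M, hM.isPrime⟩) hIM) (Nat.not_lt_zero _)
  | succ n ih =>
    obtain ⟨s, hs, x, φ, hφ⟩ := exists_dual_family_minimalPrimes (P := P) I (n + 1) hr
    obtain ⟨q₀, ψ₀, h₀⟩ := ih (fun q => (Nat.le_succ n).trans (hr q)) (I ⊔ Ideal.span {s})
      (fun l hl => by
        have := l.head.isPrime
        obtain ⟨q, hq, hql⟩ := Ideal.exists_minimalPrimes_le (le_sup_left.trans hl)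
        have hlt : (⟨q, hq.1.1⟩ : PrimeSpectrum A) < l.head := by
          refine lt_of_le_of_ne hql fun h => hs q hq ?_
          have : s ∈ l.head.asIdeal :=
            hl (Ideal.mem_sup_right (Ideal.mem_span_singleton_self s))
          rwa [← h] at this
        have := hI (l.cons _ hlt) (by simpa using hq.1.2)
        simpa using this) c p ψ (Ideal.mem_sup_left h)
    obtain ⟨b, hb⟩ := exists_general_position I (a * s ^ 2) (n + 1) fun j => φ j (p + a • q₀)
    set q := q₀ + s • ∑ k, b k • x k with hq
    refine ⟨q, ?_⟩
    suffices hO : I ⊔ LinearMap.range (LinearMap.applyₗ (R := A) (M₂ := A) (p + a • q)) = ⊤ by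
      obtain ⟨y, hy, _, ⟨ψ', rfl⟩, h1⟩ := Submodule.mem_sup.1 ((Ideal.eq_top_iff_one _).1 hO)
      refine ⟨ψ', ?_⟩
      rw [← h1, LinearMap.applyₗ_apply_apply, sub_add_cancel_right]
      exact I.neg_mem hy
    by_contra hne
    obtain ⟨M, hM, hIM⟩ := Ideal.exists_le_maximal _ hne
    have hMp := hM.isPrime
    have hO (χ : P →ₗ[A] A) : χ (p + a • q) ∈ M := hIM (Submodule.mem_sup_right ⟨χ, rfl⟩)
    have hI' : I ≤ M := le_sup_left.trans hIM
    have key : a * s ^ 2 ∈ M := by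
      refine (hb ⟨M, hMp⟩ hI' fun j => ?_).resolve_right ?_
      · obtain ⟨q', hq', hqM⟩ := Ideal.exists_minimalPrimes_le hI'
        have h1 : φ j (p + a • q) - (φ j (p + a • q₀) + a * s ^ 2 * b j) =
            ∑ k, a * s * b k * (φ j (x k) - (if j = k then s else 0)) := by
          simp only [hq, map_add, map_smul, map_sum, smul_eq_mul, mul_sub, Finset.sum_sub_distrib,
            mul_ite, mul_zero, Finset.sum_ite_eq, Finset.mem_univ, if_true, Finset.mul_sum]
          simp only [mul_add, Finset.mul_sum, ← mul_assoc]
          ring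
        have h2 : φ j (p + a • q) - (φ j (p + a • q₀) + a * s ^ 2 * b j) ∈ M := by
          rw [h1]
          exact sum_mem fun k _ => M.mul_mem_left _ (hqM (hφ q' hq' j k))
        exact (Submodule.sub_mem_iff_right M (hO (φ j))).1 h2
      · rintro ⟨l, hl, -, hlen⟩
        exact absurd (hI l hl) (by omega)
    rcases hMp.mem_or_mem key with ha | hs2
    · have h1 : ψ (p + a • q) = ψ p + a * ψ q := by simp
      have h2 := hO ψ
      rw [h1] at h2
      apply hM.ne_top
      rw [Ideal.eq_top_iff_one]
      have h3 := M.sub_mem (M.sub_mem (M.add_mem h2 (M.mul_mem_left c ha)) (hI' h))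
        (M.mul_mem_right (ψ q) ha)
      convert h3 using 1
      ring
    · have hsM := hMp.mem_of_pow_mem 2 hs2
      have h1 : ψ₀ (p + a • q) = ψ₀ (p + a • q₀) + s * (a * ψ₀ (∑ k, b k • x k)) := by
        simp only [hq, map_add, map_smul, smul_eq_mul]
        ring
      have h2 := hO ψ₀
      rw [h1] at h2
      have h4 : I ⊔ Ideal.span {s} ≤ M :=
        sup_le hI' ((Ideal.span_singleton_le_iff_mem M).2 hsM)
      apply hM.ne_top
      rw [Ideal.eq_top_iff_one]
      have h3 := M.sub_mem (M.sub_mem h2 (h4 h₀))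
        (M.mul_mem_right (a * ψ₀ (∑ k, b k • x k)) hsM)
      convert h3 using 1
      ring

theorem IsPrincipalIdealRing.of_exists_isUnit_mul {B Λ : Type*} [CommRing B] [CommRing Λ]
    [IsPrincipalIdealRing B] (h : B →+* Λ) (hh : ∀ y, ∃ u b, IsUnit u ∧ u * y = h b) :
    IsPrincipalIdealRing Λ := by
  refine ⟨fun J => ?_⟩
  obtain ⟨b, hb⟩ := IsPrincipalIdealRing.principal (J.comap h)
  refine ⟨h b, le_antisymm (fun y hy => ?_) ?_⟩
  · obtain ⟨u, c, hu, hc⟩ := hh y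
    have h1 : c ∈ J.comap h := by
      rw [Ideal.mem_comap, ← hc]
      exact J.mul_mem_left u hy
    rw [hb] at h1
    obtain ⟨e, rfl⟩ := Submodule.mem_span_singleton.1 h1
    refine (Ideal.unit_mul_mem_iff_mem (Ideal.span {h b}) hu).1 ?_
    rw [hc, smul_eq_mul, map_mul]
    exact Ideal.mul_mem_left _ _ (Ideal.mem_span_singleton_self _)
  · rw [Submodule.span_singleton_le_iff_mem]
    have : b ∈ J.comap h := by
      rw [hb]
      exact Submodule.mem_span_singleton_self b
    exact this

theorem isNilpotent_of_forall_mem_minimalPrimes {R : Type*} [CommRing R] {x : R}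
    (h : ∀ p ∈ minimalPrimes R, x ∈ p) : IsNilpotent x := by
  rw [← mem_nilradical, nilradical, ← Ideal.sInf_minimalPrimes, Ideal.mem_sInf]
  exact fun {p} hp => h p hp

namespace IsPolynomialModel

variable {R A : Type*} [CommRing R] [CommRing A] {i : R[X] →+* A} {s : R} {g : R[X]}

theorem exists_dual_family_of_prime (H : IsPolynomialModel i s g) {P : Type*} [AddCommGroup P]
    [Module A P] [Module.Finite A P] [Module.Projective A P] (r : ℕ)
    (hr : ∀ q : PrimeSpectrum A, r ≤ Module.rankAtStalk P q) (q : Ideal A) [hq : q.IsPrime]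
    (hs : i (C s) ∉ q) :
    ∃ t, i (C t) ∉ q ∧ ∃ (x : Fin r → P) (φ : Fin r → P →ₗ[A] A), ∀ a b,
      φ a (x b) - (if a = b then i (C t) else 0) ∈ q := by
  set p : Ideal R := q.comap (i.comp C) with hp
  have hpp : p.IsPrime := Ideal.comap_isPrime _ _
  set f : R →+* A := i.comp C with hf
  have hf0 (t : R) : Ideal.Quotient.mk q (f t) = 0 ↔ t ∈ p := Ideal.Quotient.eq_zero_iff_mem
  set M : Submonoid (A ⧸ q) := Submonoid.map ((Ideal.Quotient.mk q).comp f) p.primeCompl with hM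
  have hM0 : M ≤ nonZeroDivisors (A ⧸ q) := by
    rintro _ ⟨t, ht, rfl⟩
    exact mem_nonZeroDivisors_of_ne_zero fun h => ht ((hf0 t).1 h)
  let Λ := Localization M
  have hdom : IsDomain Λ := IsLocalization.isDomain_localization hM0
  have hinj : Function.Injective (algebraMap (A ⧸ q) Λ) := IsLocalization.injective _ hM0
  have halg (a : A) : algebraMap A Λ a = algebraMap (A ⧸ q) Λ (Ideal.Quotient.mk q a) := rfl
  have hunit (t : R) (ht : t ∉ p) : IsUnit (algebraMap A Λ (f t)) :=
    IsLocalization.map_units Λ (⟨_, ⟨t, ht, rfl⟩⟩ : M)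
  have hsurj (y : Λ) : ∃ t, t ∉ p ∧ ∃ a, algebraMap A Λ a = algebraMap A Λ (f t) * y := by
    obtain ⟨⟨a, _, t, ht, rfl⟩, hy⟩ := IsLocalization.surj M y
    obtain ⟨a, rfl⟩ := Ideal.Quotient.mk_surjective a
    exact ⟨t, ht, a, by rw [mul_comm]; exact hy.symm⟩
  have hker (x : R) (hx : x ∈ p) : algebraMap A Λ (f x) = 0 := by
    rw [halg, (hf0 x).2 hx, map_zero]
  let f₁ : R ⧸ p →+* Λ := Ideal.Quotient.lift p ((algebraMap A Λ).comp f) hker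
  have hf₁ (x : R) : f₁ (Ideal.Quotient.mk p x) = algebraMap A Λ (f x) := rfl
  let f₂ : FractionRing (R ⧸ p) →+* Λ := IsLocalization.lift (M := nonZeroDivisors (R ⧸ p))
    (g := f₁) fun y => by
      obtain ⟨t, ht⟩ := Ideal.Quotient.mk_surjective (y : R ⧸ p)
      rw [← ht, hf₁]
      exact hunit t fun h => nonZeroDivisors.ne_zero y.2 (by
        rw [← ht, Ideal.Quotient.eq_zero_iff_mem.2 h])
  have hf₂ (x : R) : f₂ (algebraMap _ _ (Ideal.Quotient.mk p x)) = algebraMap A Λ (f x) := by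
    rw [IsLocalization.lift_eq, hf₁]
  have hpid : IsPrincipalIdealRing Λ := by
    refine IsPrincipalIdealRing.of_exists_isUnit_mul
      (Polynomial.eval₂RingHom f₂ (algebraMap A Λ (i X))) fun y => ?_
    have hcomp (w : R[X]) : Polynomial.eval₂RingHom f₂ (algebraMap A Λ (i X))
        (w.map ((algebraMap (R ⧸ p) (FractionRing (R ⧸ p))).comp (Ideal.Quotient.mk p))) =
          algebraMap A Λ (i w) := by
      rw [Polynomial.coe_eval₂RingHom, Polynomial.eval₂_map]
      have : (f₂.comp ((algebraMap (R ⧸ p) (FractionRing (R ⧸ p))).comp (Ideal.Quotient.mk p))) =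
          ((algebraMap A Λ).comp i).comp C := by
        ext x
        exact hf₂ x
      rw [this]
      have h2 : Polynomial.eval₂RingHom (((algebraMap A Λ).comp i).comp C) (algebraMap A Λ (i X)) =
          (algebraMap A Λ).comp i := by
        ext <;> simp
      exact congrArg (fun h : R[X] →+* Λ => h w) h2
    obtain ⟨t, ht, a, ha⟩ := hsurj y
    obtain ⟨k, j, w, hw⟩ := H.exists_pow_mul_eq a
    have hsu : IsUnit (algebraMap A Λ (i (C s))) := hunit s hs
    have hgu : IsUnit (algebraMap A Λ (i g)) := by
      obtain ⟨k, hk⟩ := H.exists_dvd_pow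
      exact isUnit_of_dvd_unit (map_dvd (algebraMap A Λ) hk) (by rw [map_pow]; exact hsu.pow k)
    refine ⟨_, w.map ((algebraMap (R ⧸ p) (FractionRing (R ⧸ p))).comp (Ideal.Quotient.mk p)),
      ((hsu.pow k).mul (hgu.pow j)).mul (hunit t ht), ?_⟩
    rw [mul_assoc, ← ha, hcomp, ← hw]
    simp only [map_mul, map_pow]
  obtain ⟨_, ⟨t, ht, rfl⟩, x, φ, h⟩ := exists_dual_family (Λ := Λ) (P := P)
    (Submonoid.map f p.primeCompl) (fun y => by
      obtain ⟨t, ht, a, ha⟩ := hsurj y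
      exact ⟨_, ⟨t, ht, rfl⟩, a, ha⟩) r hr
  refine ⟨t, ht, x, φ, fun a b => ?_⟩
  have h1 := hinj (h a b)
  rw [← Ideal.Quotient.eq_zero_iff_mem, map_sub, sub_eq_zero]
  exact h1

theorem isNilpotent_of_pow_mul_eq (H : IsPolynomialModel i s g) (hs : i (C s) ∈ nonZeroDivisors A)
    {k j : ℕ} {y : A} {w : R[X]} (hw : i (C s) ^ k * i g ^ j * y = i w) (hwn : IsNilpotent w) :
    IsNilpotent y := by
  obtain ⟨l, hl⟩ := hwn
  obtain ⟨k', e, he⟩ := H.exists_dvd_pow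
  have h1 : i (C s) ^ (k + k' * j) * y = e ^ j * i w := by
    rw [← hw, pow_add, pow_mul, he]
    ring
  refine ⟨l, ?_⟩
  have h2 : y ^ l * (i (C s) ^ (k + k' * j)) ^ l = 0 := by
    rw [← mul_pow, mul_comm, h1, mul_pow, ← map_pow, hl, map_zero, mul_zero]
  exact mem_nonZeroDivisors_iff_right.1 (pow_mem (pow_mem hs _) _) _ h2

theorem notMem_minimalPrimes_polynomial (H : IsPolynomialModel i s g)
    (hs : i (C s) ∈ nonZeroDivisors A) {p : Ideal R[X]} (hp : p ∈ minimalPrimes R[X]) :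
    C s ∉ p := by
  have hsX : C s ∈ nonZeroDivisors R[X] := by
    rw [mem_nonZeroDivisors_iff_right] at hs ⊢
    intro w hw
    apply H.injective
    rw [map_zero]
    exact hs _ (by rw [← map_mul, hw, map_zero])
  exact fun h => Set.disjoint_left.1 (Ideal.disjoint_nonZeroDivisors_of_mem_minimalPrimes hp) h hsX

/-- An element of `R[X]` outside all minimal primes stays outside all minimal primes of `A`. -/
theorem image_notMem_minimalPrimes (H : IsPolynomialModel i s g)
    (hs : i (C s) ∈ nonZeroDivisors A) {t : R[X]} (ht : ∀ p ∈ minimalPrimes R[X], t ∉ p)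
    {q : Ideal A} (hq : q ∈ minimalPrimes A) : i t ∉ q := fun htq => by
  obtain ⟨y, hy, hty⟩ := (Ideal.iUnion_minimalPrimes (I := (⊥ : Ideal A))).subset
    (Set.mem_biUnion hq htq)
  obtain ⟨k, j, w, hw⟩ := H.exists_pow_mul_eq y
  refine hy (H.isNilpotent_of_pow_mul_eq hs hw (isNilpotent_of_forall_mem_minimalPrimes
    fun p hp => ?_))
  have h1 : IsNilpotent (i (t * w)) := by
    rw [map_mul, ← hw, mul_left_comm]
    exact (Commute.all _ _).isNilpotent_mul_left hty
  have h2 : t * w ∈ p := by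
    obtain ⟨n, hn⟩ := (IsNilpotent.map_iff H.injective).1 h1
    exact hp.1.1.mem_of_pow_mem n (hn ▸ p.zero_mem)
  exact (hp.1.1.mem_or_mem h2).resolve_left (ht p hp)

theorem length_lt (H : IsPolynomialModel i s g) (hs : i (C s) ∈ nonZeroDivisors A) {t : R[X]}
    (ht : ∀ p ∈ minimalPrimes R[X], t ∉ p) {n : ℕ} (hdim : ringKrullDim A ≤ n)
    (l : LTSeries (PrimeSpectrum A)) (hl : i t ∈ l.head.asIdeal) : l.length < n := by
  have := l.head.isPrime
  obtain ⟨q, hq, hql⟩ := Ideal.exists_minimalPrimes_le (bot_le : ⊥ ≤ l.head.asIdeal)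
  have hlt : (⟨q, hq.1.1⟩ : PrimeSpectrum A) < l.head := by
    refine lt_of_le_of_ne hql fun h => H.image_notMem_minimalPrimes hs ht hq ?_
    rwa [← h] at hl
  have h1 : (((l.cons _ hlt).length : ℕ) : WithBot ℕ∞) ≤ n :=
    (Order.LTSeries.length_le_krullDim _).trans hdim
  have h2 : (l.cons _ hlt).length ≤ n := by exact_mod_cast h1
  simpa using h2

/-- A projective module of rank at least `r` over a polynomial model has an exact scaled dual
family of size `r`. -/
theorem exists_dual_family [IsNoetherianRing R] (H : IsPolynomialModel i s g)
    (hs : i (C s) ∈ nonZeroDivisors A) {P : Type*} [AddCommGroup P]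
    [Module A P] [Module.Finite A P] [Module.Projective A P] (r : ℕ)
    (hr : ∀ q : PrimeSpectrum A, r ≤ Module.rankAtStalk P q) :
    ∃ t, (∀ q ∈ minimalPrimes R[X], C t ∉ q) ∧ ∃ (x : Fin r → P) (φ : Fin r → P →ₗ[A] A), ∀ a b,
      φ a (x b) = if a = b then i (C t) else 0 := by
  have hlift (p : Ideal R[X]) (hp : p ∈ minimalPrimes R[X]) :
      ∃ q : Ideal A, q.IsPrime ∧ q.comap i = p :=
    Ideal.exists_comap_eq_of_mem_minimalPrimes_of_injective H.injective p hp
  choose! q hq hqp using hlift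
  have hfin : Finite (minimalPrimes R[X]) := minimalPrimes.finite_of_isNoetherianRing R[X]
  obtain ⟨t, ht, x, φ, h⟩ := exists_dual_family_of_primes (P := P) (i.comp C)
    (fun p : minimalPrimes R[X] => (p : Ideal R[X]).comap C)
    (fun p => have := p.2.1.1; Ideal.comap_isPrime _ _)
    (fun p p' hpp => by
      have h1 := p.2.1.1
      have h2 : (Ideal.map C ((p : Ideal R[X]).comap C)).IsPrime :=
        Ideal.isPrime_map_C_of_isPrime
      have h3 : (p : Ideal R[X]) ≤ Ideal.map C ((p : Ideal R[X]).comap C) :=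
        p.2.2 ⟨h2, bot_le⟩ Ideal.map_comap_le
      have h4 : (p : Ideal R[X]) ≤ p' :=
        h3.trans ((Ideal.map_mono hpp).trans Ideal.map_comap_le)
      exact Subtype.ext (le_antisymm h4 (p'.2.2 p.2.1 h4)))
    (fun p : minimalPrimes R[X] => q p)
    (fun p => by rw [← Ideal.comap_comap, hqp p p.2]) r fun p => by
      have hqq := hq p p.2
      have hmem (w : R[X]) : i w ∈ q p ↔ w ∈ (p : Ideal R[X]) := by
        rw [← Ideal.mem_comap, hqp p p.2]
      obtain ⟨t, ht, x, φ, h⟩ := H.exists_dual_family_of_prime (P := P) r hr (q p)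
        fun h => H.notMem_minimalPrimes_polynomial hs p.2 ((hmem _).1 h)
      exact ⟨t, fun h => ht ((hmem _).2 h), x, φ, h⟩
  have hnil (y : A) (hy : ∀ p ∈ minimalPrimes R[X], y ∈ q p) : IsNilpotent y := by
    obtain ⟨k, j, w, hw⟩ := H.exists_pow_mul_eq y
    have hwn : IsNilpotent w := isNilpotent_of_forall_mem_minimalPrimes fun p hp => by
      have h1 : i w ∈ q p := by
        rw [← hw]
        exact (q p).mul_mem_left _ (hy p hp)
      rwa [← Ideal.mem_comap, hqp p hp] at h1
    exact H.isNilpotent_of_pow_mul_eq hs hw hwn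
  set σ := i (C t) with hσ
  let M : Matrix (Fin r) (Fin r) A := Matrix.of fun a b => φ a (x b)
  have hdet : IsNilpotent (σ ^ r - M.det) := by
    refine hnil _ fun p hp => ?_
    rw [← Ideal.Quotient.eq_zero_iff_mem, map_sub, sub_eq_zero, RingHom.map_det]
    have h1 : (Ideal.Quotient.mk (q p)).mapMatrix M =
        (Ideal.Quotient.mk (q p) σ) • (1 : Matrix (Fin r) (Fin r) _) := by
      ext a b
      have h2 := Ideal.Quotient.eq_zero_iff_mem.2 (h ⟨p, hp⟩ a b)
      rw [map_sub, sub_eq_zero] at h2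
      rw [RingHom.mapMatrix_apply, Matrix.map_apply, Matrix.smul_apply, Matrix.one_apply]
      refine h2.trans ?_
      split_ifs <;> simp [hσ]
    rw [h1, Matrix.det_smul, Matrix.det_one, Fintype.card_fin, map_pow, mul_one]
  obtain ⟨N, hN⟩ := hdet
  obtain ⟨c, hc⟩ : M.det ∣ (σ ^ r) ^ N := by
    have := sub_dvd_pow_sub_pow (σ ^ r) (σ ^ r - M.det) N
    rwa [hN, sub_zero, sub_sub_cancel] at this
  refine ⟨(t ^ r) ^ N, fun p hp h => ?_, x, fun a => c • ∑ b, M.adjugate a b • φ b, fun a b => ?_⟩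
  · have := hp.1.1
    rw [map_pow, map_pow] at h
    exact ht ⟨p, hp⟩ (this.mem_of_pow_mem _ (this.mem_of_pow_mem _ h))
  · have h1 : (c • ∑ k, M.adjugate a k • φ k) (x b) = c * (M.adjugate * M) a b := by
      simp [Matrix.mul_apply, M]
    rw [h1, Matrix.adjugate_mul, Matrix.smul_apply, Matrix.one_apply, map_pow, map_pow, map_pow,
      map_pow, ← hσ, hc]
    split_ifs <;> simp [mul_comm]

end IsPolynomialModel

section Transitivity

variable {A P : Type*} [CommRing A] [AddCommGroup P] [Module A P]

/-- An invertible endomorphism `1 + σ γ` descends along maps `ι`, `κ` with `κ ∘ ι = σ`. -/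
theorem exists_linearEquiv_of_comp_eq_smul {V E : Type*} [AddCommGroup V] [Module A V]
    [AddCommGroup E] [Module A E] (ι : V →ₗ[A] E) (κ : E →ₗ[A] V) (σ : A)
    (hκ : ∀ v, κ (ι v) = σ • v) (γ γ' : V →ₗ[A] V) (h₁ : ∀ v, γ v + γ' v + σ • γ (γ' v) = 0)
    (h₂ : ∀ v, γ v + γ' v + σ • γ' (γ v) = 0) :
    ∃ e : E ≃ₗ[A] E, ∀ v, e (ι v) = ι (v + σ • γ v) := by
  refine ⟨LinearEquiv.ofLinearMap (LinearMap.id + ι ∘ₗ γ ∘ₗ κ) (LinearMap.id + ι ∘ₗ γ' ∘ₗ κ) ?_ ?_,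
    fun v => ?_⟩
  · ext x
    have := congrArg ι (h₁ (κ x))
    simp only [map_add, map_smul, map_zero] at this
    simp only [LinearMap.comp_apply, LinearMap.add_apply, LinearMap.id_apply, map_add, hκ, map_smul]
    rw [add_assoc, add_eq_left, ← this]
    abel
  · ext x
    have := congrArg ι (h₂ (κ x))
    simp only [map_add, map_smul, map_zero] at this
    simp only [LinearMap.comp_apply, LinearMap.add_apply, LinearMap.id_apply, map_add, hκ, map_smul]
    rw [add_assoc, add_eq_left, ← this]
    abel
  · simp [hκ]

theorem exists_linearEquiv_of_rowEquivMod {n : ℕ} {E : Type*} [AddCommGroup E] [Module A E]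
    (ι : (Fin n → A) →ₗ[A] E) (κ : E →ₗ[A] (Fin n → A)) (σ : A) (hκ : ∀ v, κ (ι v) = σ • v)
    {v w : Fin n → A} (h : RowEquivMod σ v w) : ∃ e : E ≃ₗ[A] E, e (ι v) = ι w := by
  obtain ⟨γ, hγ, rfl⟩ := h
  set β := 1 + σ • γ with hβ
  have h1 : γ - γ * β⁻¹ - σ • (γ * (γ * β⁻¹)) = 0 := by
    have : γ * β⁻¹ + σ • (γ * (γ * β⁻¹)) = γ * (β * β⁻¹) := by
      rw [hβ]; noncomm_ring
    rw [sub_sub, this, Matrix.mul_nonsing_inv _ hγ, mul_one, sub_self]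
  have h2 : γ - γ * β⁻¹ - σ • (γ * β⁻¹ * γ) = 0 := by
    have : γ * β⁻¹ + σ • (γ * β⁻¹ * γ) = γ * (β⁻¹ * β) := by
      rw [hβ, mul_add, mul_add, mul_one, mul_smul_comm, mul_smul_comm, mul_assoc]
    rw [sub_sub, this, Matrix.nonsing_inv_mul _ hγ, mul_one, sub_self]
  obtain ⟨e, he⟩ := exists_linearEquiv_of_comp_eq_smul ι κ σ hκ γ.mulVecLin
    (-(γ * β⁻¹)).mulVecLin (fun v => by
      have := congrArg (· *ᵥ v) h1
      simpa [Matrix.add_mulVec, Matrix.neg_mulVec, Matrix.smul_mulVec, sub_eq_add_neg,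
        Matrix.mulVec_neg] using this) (fun v => by
      have := congrArg (· *ᵥ v) h2
      simpa [Matrix.add_mulVec, Matrix.neg_mulVec, Matrix.smul_mulVec, sub_eq_add_neg,
        mul_assoc] using this)
  refine ⟨e, ?_⟩
  rw [he, hβ, Matrix.add_mulVec, Matrix.one_mulVec, Matrix.smul_mulVec, Matrix.mulVecLin_apply]

/-- A vector whose coordinates generate the unit ideal up to one more generator `c` can be moved
by multiples of `c` to a unimodular vector, provided it is longer than the dimension. -/
theorem exists_unimodular_add_mul [IsNoetherianRing A] {n : ℕ} (hdim : ringKrullDim A < n)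
    (c : A) (v : Fin n → A)
    (hv : ∀ M : Ideal A, M.IsPrime → (∀ j, v j ∈ M) → c ∉ M) :
    ∃ b w : Fin n → A, w ⬝ᵥ (fun j => v j + c * b j) = 1 := by
  obtain ⟨b, hb⟩ := exists_general_position_height c n v
  refine ⟨b, ?_⟩
  have : Ideal.span (Set.range fun j => v j + c * b j) = ⊤ := by
    by_contra hne
    obtain ⟨M, hM, hIM⟩ := Ideal.exists_le_maximal _ hne
    have hMp := hM.isPrime
    have hmem (j) : v j + c * b j ∈ M := hIM (Ideal.subset_span ⟨j, rfl⟩)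
    rcases hb M hMp hmem with h | h
    · exact hv M hMp (fun j => (Submodule.add_mem_iff_left M (M.mul_mem_right _ h)).1 (hmem j)) h
    · have h1 : ((n : ℕ∞) : WithBot ℕ∞) ≤ ringKrullDim A :=
        (WithBot.coe_le_coe.2 h).trans (Ideal.height_le_ringKrullDim_of_ne_top hMp.ne_top)
      exact absurd (h1.trans_lt hdim) (lt_irrefl _)
  exact Ideal.mem_span_range_iff_dotProduct.1 ((Ideal.eq_top_iff_one _).1 this)

theorem exists_linearEquiv_of_add_smul {E : Type*} [AddCommGroup E] [Module A E] (f : E →ₗ[A] A)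
    (w v e₀ : E) (hf : f w = 0) (hv : ∃ χ : E →ₗ[A] A, χ v = 1)
    (h : (∃ χ : E →ₗ[A] A, χ (v + f v • w) = 1) → ∃ e : E ≃ₗ[A] E, e (v + f v • w) = e₀) :
    ∃ e : E ≃ₗ[A] E, e v = e₀ := by
  obtain ⟨χ, hχ⟩ := hv
  obtain ⟨e, he⟩ := h ⟨χ ∘ₗ (LinearEquiv.transvection hf).symm.toLinearMap, by
    rw [← LinearEquiv.transvection.apply hf, LinearMap.comp_apply, LinearEquiv.coe_coe,
      LinearEquiv.symm_apply_apply, hχ]⟩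
  exact ⟨(LinearEquiv.transvection hf).trans e, he⟩

theorem apply_prod_eq_add (χ : A × P →ₗ[A] A) (a : A) (p : P) :
    χ (a, p) = χ (1, 0) * a + (χ ∘ₗ LinearMap.inr A A P) p := by
  have : ((a, p) : A × P) = a • (1, 0) + (0, p) := by simp
  rw [this, map_add, map_smul, smul_eq_mul, mul_comm, LinearMap.comp_apply, LinearMap.inr_apply]

theorem exists_linearEquiv_apply_eq_one_zero_of_congr [IsNoetherianRing A] {d : ℕ}
    (hdim : ringKrullDim A ≤ (d + 1 : ℕ)) (σ : A)
    (hrow : ∀ (x : A) (z : Fin (d + 1) → A),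
      (∃ c, c ⬝ᵥ (Fin.cons (1 + σ ^ 2 * x) (σ • z) : Fin (d + 2) → A) = 1) →
      RowEquivMod σ (Fin.cons (1 + σ ^ 2 * x) (σ • z) : Fin (d + 2) → A) (Fin.cons 1 0))
    (x : Fin (d + 1) → P) (φ : Fin (d + 1) → P →ₗ[A] A)
    (hφ : ∀ j k, φ j (x k) = if j = k then σ else 0) (t : A) (p : P)
    (hu : ∃ χ : A × P →ₗ[A] A, χ (1 + σ ^ 2 * t, σ ^ 2 • p) = 1) :
    ∃ e : (A × P) ≃ₗ[A] (A × P), e (1 + σ ^ 2 * t, σ ^ 2 • p) = (1, 0) := by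
  have hsum (y : Fin (d + 1) → A) (j) : φ j (∑ k, y k • x k) = σ * y j := by
    simp [hφ, mul_comm]
  obtain ⟨χ, hχ⟩ := hu
  have hχ' : χ (1, 0) * (1 + σ ^ 2 * t) + (χ ∘ₗ LinearMap.inr A A P) (σ ^ 2 • p) = 1 :=
    (apply_prod_eq_add χ _ _).symm.trans hχ
  set ψ := χ ∘ₗ LinearMap.inr A A P
  set h := σ • p - ∑ k, φ k p • x k with hh
  have hφh (j) : φ j h = 0 := by
    rw [hh, map_sub, hsum, map_smul, smul_eq_mul, sub_self]
  have hp : σ ^ 2 • p = ∑ k, (σ * φ k p) • x k + σ • h := by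
    rw [hh, smul_sub, Finset.smul_sum, sq, mul_smul]
    simp only [mul_smul]
    abel
  have hσM (M : Ideal A) (hM : M.IsPrime) (y : A) (hy : 1 + σ * y ∈ M) : σ ∉ M := fun h =>
    hM.ne_top ((Ideal.eq_top_iff_one _).2
      ((Submodule.add_mem_iff_left M (M.mul_mem_right y h)).1 hy))
  obtain ⟨b, w, hw⟩ := exists_unimodular_add_mul (n := d + 2)
    (hdim.trans_lt (by exact_mod_cast Nat.lt_succ_self _)) (σ ^ 2 * ψ h)
    (Fin.cons (1 + σ ^ 2 * t) fun k => σ * φ k p) fun M hM hv hc => by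
      have h0 : 1 + σ ^ 2 * t ∈ M := hv 0
      have hs := hσM M hM (σ * t) (by convert h0 using 1; ring)
      have hψ := (hM.mem_or_mem hc).resolve_left fun h => hs (hM.mem_of_pow_mem 2 h)
      refine hM.ne_top ((Ideal.eq_top_iff_one _).2 ?_)
      rw [← hχ', hp, map_add, map_sum, map_smul]
      refine M.add_mem (M.mul_mem_left _ h0) (M.add_mem (sum_mem fun k _ => ?_)
        (M.mul_mem_left _ hψ))
      rw [map_smul]
      exact M.mul_mem_right _ (hv k.succ)
  let θ : P →ₗ[A] A := ψ ∘ₗ (σ • LinearMap.id - ∑ k, (φ k).smulRight (x k))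
  have hθ (q : P) : θ q = ψ (σ • q - ∑ k, φ k q • x k) := by
    simp [θ]
  have hθx (y : Fin (d + 1) → A) : θ (∑ k, y k • x k) = 0 := by
    rw [hθ]
    simp only [hsum, mul_smul, ← Finset.smul_sum, sub_self, map_zero]
  have hθp : θ (σ ^ 2 • p) = σ ^ 2 * ψ h := by
    rw [hp, map_add, hθx, zero_add, map_smul, hθ]
    simp [hφh, sq, mul_assoc]
  refine exists_linearEquiv_of_add_smul (θ ∘ₗ LinearMap.snd A A P)
    (b 0, ∑ k, b k.succ • x k) _ _ (hθx _) ⟨χ, hχ⟩ fun _ => ?_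
  set t' := t + ψ h * b 0 with ht'
  set z := fun k => φ k p + σ * ψ h * b (Fin.succ k) with hz
  have hu' : ((1 + σ ^ 2 * t, σ ^ 2 • p) : A × P) +
      (θ ∘ₗ LinearMap.snd A A P) (1 + σ ^ 2 * t, σ ^ 2 • p) • (b 0, ∑ k, b k.succ • x k) =
      (1 + σ ^ 2 * t', ∑ k, (σ * z k) • x k + σ • h) := by
    rw [LinearMap.comp_apply, LinearMap.snd_apply, hθp]
    ext
    · simp only [Prod.fst_add, Prod.smul_fst, smul_eq_mul, ht']
      ring
    · simp only [Prod.snd_add, Prod.smul_snd, hz]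
      rw [hp, add_right_comm, Finset.smul_sum, ← Finset.sum_add_distrib]
      congr 1
      refine Finset.sum_congr rfl fun k _ => ?_
      rw [smul_smul, ← add_smul]
      congr 1
      ring
  have hv' : (fun j => (Fin.cons (1 + σ ^ 2 * t) (fun k => σ * φ k p) : Fin (d + 2) → A) j +
      σ ^ 2 * ψ h * b j) = Fin.cons (1 + σ ^ 2 * t') (σ • z) := by
    ext j
    refine Fin.cases ?_ (fun k => ?_) j
    · simp only [Fin.cons_zero, ht']
      ring
    · simp only [Fin.cons_succ, hz, Pi.smul_apply, smul_eq_mul]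
      ring
  rw [hv'] at hw
  rw [hu']
  obtain ⟨c, hc⟩ : ∃ c : Fin (d + 2) → A,
      c ⬝ᵥ Fin.cons (1 + σ ^ 2 * t') (fun k => σ * (σ * z k)) = 1 := by
    refine Ideal.mem_span_range_iff_dotProduct.1 ((Ideal.eq_top_iff_one _).1 ?_)
    by_contra hne
    obtain ⟨M, hM, hIM⟩ := Ideal.exists_le_maximal _ hne
    have hMp := hM.isPrime
    have hmem (j) := hIM (Ideal.subset_span ⟨j, rfl⟩)
    have h0 : 1 + σ ^ 2 * t' ∈ M := hmem 0
    have hs := hσM M hMp (σ * t') (by convert h0 using 1; ring)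
    refine hM.ne_top ((Ideal.eq_top_iff_one _).2 ?_)
    rw [← hw]
    refine sum_mem fun j _ => M.mul_mem_left _ ?_
    refine Fin.cases h0 (fun k => ?_) j
    exact (hMp.mem_or_mem (hmem k.succ)).resolve_left hs
  let f : A × P →ₗ[A] A := c 0 • LinearMap.fst A A P +
    ∑ k : Fin (d + 1), c k.succ • (φ k ∘ₗ LinearMap.snd A A P)
  have hf (v : A × P) : f v = c 0 * v.1 + ∑ k : Fin (d + 1), c k.succ * φ k v.2 := by
    simp [f]
  have hf1 : f (1 + σ ^ 2 * t', ∑ k, (σ * z k) • x k + σ • h) = 1 := by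
    refine (hf _).trans (Eq.trans ?_ hc)
    refine Eq.trans ?_ (Fin.sum_univ_succ _).symm
    simp only [map_add, hsum, map_smul, hφh, smul_zero, add_zero, Fin.cons_zero, Fin.cons_succ]
  refine exists_linearEquiv_of_add_smul f (0, -(σ • h)) _ _ (by simp [hf, hφh]) ⟨f, hf1⟩
    fun _ => ?_
  rw [hf1, one_smul, Prod.mk_add_mk, add_zero, add_neg_cancel_right]
  let ι : (Fin (d + 2) → A) →ₗ[A] A × P := (LinearMap.proj 0).prod
    (∑ k : Fin (d + 1), (LinearMap.proj k.succ).smulRight (x k))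
  have hι (v : Fin (d + 2) → A) : ι v = (v 0, ∑ k : Fin (d + 1), v k.succ • x k) := by
    simp [ι]
  let κ : A × P →ₗ[A] (Fin (d + 2) → A) := LinearMap.pi
    (Fin.cons (σ • LinearMap.fst A A P) fun k => φ k ∘ₗ LinearMap.snd A A P)
  obtain ⟨e, he⟩ := exists_linearEquiv_of_rowEquivMod ι κ σ (fun v => by
    ext j
    refine Fin.cases ?_ (fun k => ?_) j
    · simp [κ, hι]
    · rw [hι, Pi.smul_apply, smul_eq_mul, ← hsum (fun k => v k.succ)]
      simp [κ]) (hrow t' z ⟨w, hw⟩)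
  refine ⟨e, ?_⟩
  rw [hι, hι] at he
  simpa using he

theorem exists_linearEquiv_apply_eq_one_zero [IsNoetherianRing A] [Module.Finite A P]
    [Module.Projective A P] {d : ℕ} (hdim : ringKrullDim A ≤ (d + 1 : ℕ))
    (hr : ∀ q : PrimeSpectrum A, d + 1 ≤ Module.rankAtStalk P q) (σ : A)
    (hσ : ∀ l : LTSeries (PrimeSpectrum A), σ ∈ l.head.asIdeal → l.length < d + 1)
    (hrow : ∀ (x : A) (z : Fin (d + 1) → A),
      (∃ c, c ⬝ᵥ (Fin.cons (1 + σ ^ 2 * x) (σ • z) : Fin (d + 2) → A) = 1) →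
      RowEquivMod σ (Fin.cons (1 + σ ^ 2 * x) (σ • z) : Fin (d + 2) → A) (Fin.cons 1 0))
    (x : Fin (d + 1) → P) (φ : Fin (d + 1) → P →ₗ[A] A)
    (hφ : ∀ j k, φ j (x k) = if j = k then σ else 0)
    (u : A × P) (hu : ∃ χ : A × P →ₗ[A] A, χ u = 1) :
    ∃ e : (A × P) ≃ₗ[A] (A × P), e u = (1, 0) := by
  obtain ⟨a, p⟩ := u
  obtain ⟨χ, hχ⟩ := hu
  have hχ' : χ (1, 0) * a + (χ ∘ₗ LinearMap.inr A A P) p - 1 = 0 := by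
    rw [← apply_prod_eq_add, hχ, sub_self]
  obtain ⟨q, ψ₁, hψ₁⟩ := exists_unimodular_add_smul (d + 1) hr (Ideal.span {σ ^ 2})
    (fun l hl => hσ l (l.head.isPrime.mem_of_pow_mem 2 (hl (Ideal.mem_span_singleton_self _))))
    a (χ (1, 0)) p (χ ∘ₗ LinearMap.inr A A P) (by rw [hχ']; exact zero_mem _)
  refine exists_linearEquiv_of_add_smul (LinearMap.fst A A P) (0, q) _ _ rfl ⟨χ, hχ⟩
    fun hχ₁ => ?_
  refine exists_linearEquiv_of_add_smul ((1 - a) • ψ₁ ∘ₗ LinearMap.snd A A P) (1, 0) _ _ (by simp)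
    hχ₁ fun hχ₂ => ?_
  refine exists_linearEquiv_of_add_smul (LinearMap.fst A A P) (0, -(p + a • q)) _ _ rfl
    hχ₂ ?_
  obtain ⟨y, hy⟩ := Ideal.mem_span_singleton'.1 hψ₁
  set v := ((a, p) : A × P) + LinearMap.fst A A P (a, p) • (0, q) with hv
  have hv1 : v = (a, p + a • q) := by simp [hv]
  rw [hv1]
  have h1 : ((a, p + a • q) : A × P) + ((1 - a) • ψ₁ ∘ₗ LinearMap.snd A A P) (a, p + a • q) •
      (1, 0) = (1 + σ ^ 2 * ((1 - a) * y), p + a • q) := by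
    simp only [LinearMap.smul_apply, LinearMap.comp_apply, LinearMap.snd_apply, smul_eq_mul]
    ext
    · simp only [Prod.fst_add, Prod.smul_fst, smul_eq_mul, mul_one]
      linear_combination (-(1 - a)) * hy
    · simp
  have h2 : ((1 + σ ^ 2 * ((1 - a) * y), p + a • q) : A × P) +
      LinearMap.fst A A P (1 + σ ^ 2 * ((1 - a) * y), p + a • q) • (0, -(p + a • q)) =
      (1 + σ ^ 2 * ((1 - a) * y), σ ^ 2 • (-((1 - a) * y) • (p + a • q))) := by
    ext
    · simp
    · simp only [Prod.snd_add, Prod.smul_snd, LinearMap.fst_apply]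
      module
  rw [h1, h2]
  exact exists_linearEquiv_apply_eq_one_zero_of_congr hdim σ hrow x φ hφ _ _

end Transitivity

theorem symm_apply_snd_snd {A M N : Type*} [CommRing A] [AddCommGroup M] [Module A M]
    [AddCommGroup N] [Module A N] (Θ : (A × M) ≃ₗ[A] (A × N)) (hΘ : Θ.symm (1, 0) = (1, 0))
    (m : M) : (Θ.symm (0, (Θ (0, m)).2)).2 = m := by
  have : ((0, (Θ (0, m)).2) : A × N) = Θ (0, m) - (Θ (0, m)).1 • (1, 0) := by
    ext <;> simp
  rw [this, map_sub, map_smul, hΘ, LinearEquiv.symm_apply_apply]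
  simp

theorem nonempty_linearEquiv_of_prod {A P Q : Type*} [CommRing A] [AddCommGroup P] [Module A P]
    [AddCommGroup Q] [Module A Q]
    (h : ∀ u : A × P, (∃ χ : A × P →ₗ[A] A, χ u = 1) → ∃ e : (A × P) ≃ₗ[A] (A × P), e u = (1, 0))
    (θ : (A × Q) ≃ₗ[A] (A × P)) : Nonempty (Q ≃ₗ[A] P) := by
  obtain ⟨e, he⟩ := h (θ (1, 0)) ⟨LinearMap.fst A A Q ∘ₗ θ.symm.toLinearMap, by simp⟩
  set Θ := θ.trans e with hΘ
  have h1 : Θ (1, 0) = (1, 0) := he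
  have h2 : Θ.symm (1, 0) = (1, 0) := by rw [LinearEquiv.symm_apply_eq, h1]
  exact ⟨LinearEquiv.ofLinearMap (LinearMap.snd A A P ∘ₗ Θ.toLinearMap ∘ₗ LinearMap.inr A A Q)
    (LinearMap.snd A A Q ∘ₗ Θ.symm.toLinearMap ∘ₗ LinearMap.inr A A P)
    (LinearMap.ext fun p => symm_apply_snd_snd Θ.symm h1 p)
    (LinearMap.ext fun q => symm_apply_snd_snd Θ h2 q)⟩

namespace IsPolynomialModel

variable {R A : Type*} [CommRing R] [CommRing A] {i : R[X] →+* A} {s : R} {g : R[X]}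

theorem mul_right (H : IsPolynomialModel i s g) (t : R) : IsPolynomialModel i (s * t) g where
  injective := H.injective
  exists_pow_mul_eq y := by
    obtain ⟨k, j, q, h⟩ := H.exists_pow_mul_eq y
    refine ⟨k, j, C t ^ k * q, ?_⟩
    rw [C_mul, map_mul, map_mul, map_pow, ← h]
    ring
  exists_dvd_pow := by
    obtain ⟨k, h⟩ := H.exists_dvd_pow
    refine ⟨k, h.trans ?_⟩
    rw [C_mul, map_mul]
    exact pow_dvd_pow_of_dvd (dvd_mul_right _ _) k

/-- Projective modules of rank exceeding `dim R` over a polynomial model of dimension at most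
`dim R + 1` are cancellative. -/
theorem nonempty_linearEquiv [IsNoetherianRing R] [IsNoetherianRing A] {d : ℕ}
    (H : IsPolynomialModel i s g) (hs : i (C s) ∈ nonZeroDivisors A) (hd : ringKrullDim R ≤ d)
    (hdim : ringKrullDim A ≤ (d + 1 : ℕ)) {P Q : Type*} [AddCommGroup P] [Module A P]
    [Module.Finite A P] [Module.Projective A P] [AddCommGroup Q] [Module A Q]
    (hr : ∀ q : PrimeSpectrum A, d + 1 ≤ Module.rankAtStalk P q)
    (θ : (A × Q) ≃ₗ[A] (A × P)) : Nonempty (Q ≃ₗ[A] P) := by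
  obtain ⟨t, ht, x, φ, hφ⟩ := H.exists_dual_family hs (d + 1) hr
  refine nonempty_linearEquiv_of_prod (fun u hu =>
    exists_linearEquiv_apply_eq_one_zero hdim hr (i (C (s * t)))
      (H.length_lt hs (fun p hp h => ?_) hdim) ((H.mul_right t).rowEquivMod hd)
      (fun k => i (C s) • x k) φ (fun j k => ?_) u hu) θ
  · rw [C_mul] at h
    exact (hp.1.1.mem_or_mem h).elim (H.notMem_minimalPrimes_polynomial hs hp) (ht p hp)
  · rw [map_smul, hφ, C_mul, map_mul]
    split_ifs <;> simp

end IsPolynomialModel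

end MatrixNotation

theorem Polynomial.scaleRoots_comp_C_mul_X {R : Type*} [CommRing R] (q : R[X]) (c : R) :
    (q.scaleRoots c).comp (C c * X) = C (c ^ q.natDegree) * q := by
  ext n
  rw [comp_C_mul_X_coeff, coeff_scaleRoots, coeff_C_mul]
  rcases le_or_gt n q.natDegree with h | h
  · rw [mul_assoc, ← pow_add, Nat.sub_add_cancel h, mul_comm]
  · simp [coeff_eq_zero_of_natDegree_lt h]

section GeometricSubring

variable {R : Type*} [CommRing R] {f : R[X]}

theorem algebraMap_mul_fzpow_neg (m : ℕ) :
    algebraMap R[X] (Localization.Away f) f * (algebraMap R[X] (Localization.Away f) f ^ m *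
      fzpow f (-(m + 1 : ℕ))) = 1 := by
  set u := (IsLocalization.map_units (M := Submonoid.powers f) (Localization.Away f)
    ⟨f, Submonoid.mem_powers f⟩).unit with hu
  have h1 : algebraMap R[X] (Localization.Away f) f = u := rfl
  have h2 : fzpow f (-(m + 1 : ℕ)) = ((u ^ (-((m + 1 : ℕ) : ℤ)) : (Localization.Away f)ˣ) :
    Localization.Away f) := rfl
  rw [h1, h2, ← mul_assoc, ← pow_succ', ← Units.val_pow_eq_pow_val, ← Units.val_mul, zpow_neg,
    zpow_natCast, mul_inv_cancel, Units.val_one]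

theorem exists_algebraMap_eq_of_mem_RTfn {n : ℕ} {y : Localization.Away f} (hy : y ∈ RTfn f n) :
    ∃ q, y = algebraMap R[X] (Localization.Away f) q := by
  have : RTfn f n ≤ ⊥ := by
    refine Algebra.adjoin_le (Set.singleton_subset_iff.2 (Algebra.mem_bot.2 ⟨f ^ n, ?_⟩))
    rw [map_pow, fzpow, zpow_natCast, Units.val_pow_eq_pow_val]
    rfl
  obtain ⟨q, hq⟩ := Algebra.mem_bot.1 (this hy)
  exact ⟨q, hq.symm⟩

theorem algebraMap_C_mem_nonZeroDivisors {s : R}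
    (hs : s ∈ nonZeroDivisors R) :
    algebraMap R[X] (Localization.Away f) (C s) ∈ nonZeroDivisors (Localization.Away f) := by
  refine IsLocalization.map_nonZeroDivisors_le (Submonoid.powers f) _ ⟨C s, ?_, rfl⟩
  rw [SetLike.mem_coe, mem_nonZeroDivisors_iff_right]
  intro q hq
  ext j
  have := congrArg (coeff · j) hq
  simp only [coeff_mul_C, coeff_zero] at this
  exact mem_nonZeroDivisors_iff_right.1 hs _ this

/-- A geometric subring of `R[T, f^n]` is a polynomial model. -/
theorem exists_isPolynomialModel (hf : f ∈ nonZeroDivisors R[X]) (n : ℤ)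
    (A : Subring (Localization.Away f))
    (hRA : ∀ r : R, algebraMap R[X] (Localization.Away f) (C r) ∈ A)
    (hAsub : A ≤ (RTfn f n).toSubring)
    (hloc : ∃ s : R, s ∈ nonZeroDivisors R ∧ ∀ y ∈ RTfn f n, ∃ k : ℕ,
      (algebraMap R[X] (Localization.Away f) (C s)) ^ k * y ∈ A) :
    ∃ (i : R[X] →+* A) (s : R) (g : R[X]), IsPolynomialModel i s g ∧
      i (C s) ∈ nonZeroDivisors A := by
  obtain ⟨s, hs, hloc⟩ := hloc
  set L := Localization.Away f
  set j := algebraMap R[X] L with hj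
  have hjinj : Function.Injective j :=
    IsLocalization.injective _ (Submonoid.powers_le.2 hf)
  obtain ⟨k, hk⟩ := hloc (j X) (algebraMap_mem _ _)
  set c := s ^ k with hc
  have hcX : j (C c * X) ∈ A := by
    rwa [map_mul, hc, C_pow, map_pow]
  have hmem (p : R[X]) : j (p.comp (C c * X)) ∈ A := by
    induction p using Polynomial.induction_on' with
    | add p q hp hq =>
      rw [add_comp, map_add]
      exact A.add_mem hp hq
    | monomial m a =>
      rw [monomial_comp, map_mul, map_pow]
      exact A.mul_mem (hRA a) (A.pow_mem hcX m)
  let i : R[X] →+* A := (j.comp (Polynomial.compRingHom (C c * X))).codRestrict A hmem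
  have hi (p : R[X]) : (i p : L) = j (p.comp (C c * X)) := rfl
  have hiC (a : R) : (i (C a) : L) = j (C a) := by rw [hi, C_comp]
  have hiscale (q : R[X]) : (i (q.scaleRoots c) : L) = j (C c) ^ q.natDegree * j q := by
    rw [hi, scaleRoots_comp_C_mul_X, map_mul, C_pow, map_pow]
  have hinj : Function.Injective i := by
    refine (injective_iff_map_eq_zero i).2 fun p hp => ?_
    have h1 : p.comp (C c * X) = 0 := hjinj (by rw [← hi, hp, map_zero]; rfl)
    exact (comp_C_mul_X_eq_zero_iff (pow_mem hs k)).1 h1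
  have hjc : j (C c) = j (C s) ^ k := by rw [hc, C_pow, map_pow]
  refine ⟨i, s, ?_⟩
  have hnz : i (C s) ∈ nonZeroDivisors A := by
    rw [mem_nonZeroDivisors_iff_right]
    intro y hy
    refine Subtype.ext (mem_nonZeroDivisors_iff_right.1 (algebraMap_C_mem_nonZeroDivisors hs)
      (y : L) ?_)
    rw [← hj, ← hiC]
    exact congrArg Subtype.val hy
  rcases le_or_gt 0 n with hn | hn
  · lift n to ℕ using hn
    refine ⟨1, ⟨hinj, fun y => ?_, 0, by simp⟩, hnz⟩
    obtain ⟨q, hq⟩ := exists_algebraMap_eq_of_mem_RTfn (hAsub y.2)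
    refine ⟨k * q.natDegree, 0, q.scaleRoots c, Subtype.ext ?_⟩
    rw [hiscale, hjc, pow_zero, mul_one, A.coe_mul, A.coe_pow, hiC, hq, pow_mul]
  · obtain ⟨m, rfl⟩ : ∃ m : ℕ, n = -(m + 1 : ℕ) := ⟨(-n - 1).toNat, by omega⟩
    refine ⟨f.scaleRoots c, ⟨hinj, fun y => ?_, ?_⟩, hnz⟩
    · obtain ⟨N, q, hq⟩ := IsLocalization.Away.surj (S := L) f (y : L)
      refine ⟨k * q.natDegree, N, C (c ^ (f.natDegree * N)) * q.scaleRoots c, Subtype.ext ?_⟩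
      have hjcp (e : ℕ) : j (C (c ^ e)) = (j (C s) ^ k) ^ e := by rw [C_pow, map_pow, hjc]
      rw [map_mul, A.coe_mul, A.coe_mul, A.coe_mul, A.coe_pow, A.coe_pow, hiscale, hiscale, hiC,
        hiC, ← hq, hjcp, hjc, ← hj]
      ring
    · obtain ⟨l, hl⟩ := hloc (j f ^ m * fzpow f (-(m + 1 : ℕ)))
        (mul_mem (pow_mem (algebraMap_mem _ _) m) (Algebra.subset_adjoin rfl))
      refine ⟨k * f.natDegree + l, ⟨_, hl⟩, Subtype.ext ?_⟩
      rw [A.coe_pow, A.coe_mul, hiC, hiscale, hjc]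
      linear_combination (-(j (C s) ^ (k * f.natDegree + l))) * algebraMap_mul_fzpow_neg (f := f) m

end GeometricSubring

theorem stmt_2 {R : Type*} [CommRing R] [IsNoetherianRing R] (d : ℕ) (hd : 1 ≤ d)
    (hdim : ringKrullDim R = (d : ℕ))
    (f : Polynomial R) (hfR : f ∉ Set.range (C : R →+* Polynomial R))
    (hfnzd : f ∈ nonZeroDivisors (Polynomial R)) (n : ℤ)
    (A : Subring (Localization.Away f))
    (hRA : ∀ r : R, algebraMap (Polynomial R) (Localization.Away f) (C r) ∈ A)
    (hAsub : A ≤ (RTfn f n).toSubring)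
    (hNoeth : IsNoetherianRing A)
    (hloc : ∃ s : R, s ∈ nonZeroDivisors R ∧ ∀ y ∈ RTfn f n, ∃ k : ℕ,
      (algebraMap (Polynomial R) (Localization.Away f) (C s)) ^ k * y ∈ A)
    (hdimA : ringKrullDim A = (d + 1 : ℕ))
    (P : Type v) [AddCommGroup P] [Module A P] [Module.Finite A P] [Module.Projective A P]
    (hrank : ∀ (p : Ideal A) (hp : p.IsPrime), d + 1 ≤ rankAt (R := A) P p hp) :
    ∀ (Q : Type v) [AddCommGroup Q] [Module A Q] [Module.Finite A Q],
      Nonempty ((A × Q) ≃ₗ[A] (A × P)) → Nonempty (Q ≃ₗ[A] P) := by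
  intro Q _ _ _ ⟨θ⟩
  obtain ⟨i, s, g, H, hs⟩ := exists_isPolynomialModel hfnzd n A hRA hAsub hloc
  exact H.nonempty_linearEquiv hs hdim.le hdimA.le (fun q => hrank q.asIdeal q.isPrime) θ
end

section
/- Let R be a commutative Noetherian ring of finite Krull dimension d ≥ 1 and let A be a geometric subring of R[T]. Let s, t ∈ R be such that A_s = R_s[T] and sR + tR = R. Let M be a finitely generated A-module, and let 'bar' denote reduction modulo I_A M (resp. modulo I_A). Let z ∈ M̄ = M/I_A M. Suppose there exist a basic element m₁ of the A_s-module M_s with m̄₁ = z_s, and a basic element m₂ of the A_t-module M_t with m̄₂ = z_t. Set N₁ = M_s/(m₁A_s) and N₂ = M_t/(m₂A_t), and assume that (N₁)_t and (N₂)_s are projective A_st-modules extended from the base ring R_st. Then there exists a basic element m of M with m̄ = z. -/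
open Polynomial

set_option maxHeartbeats 1000000
set_option synthInstance.maxHeartbeats 400000

/-- `A` is a geometric subring of `R[T]`, where `d = dim R`. -/
def IsGeometricSubring {R : Type*} [CommRing R] (A : Subalgebra R (Polynomial R)) (d : ℕ) : Prop :=
  IsNoetherianRing A ∧
  (∃ s : R, s ∈ nonZeroDivisors R ∧ ∀ f : Polynomial R, ∃ k : ℕ, (C s) ^ k * f ∈ A) ∧
  ringKrullDim A = (d + 1 : ℕ)

/-- The ideal `I_A = { f ∈ A : f(0) = 0 }` of a subring `A` of `R[T]`. -/
noncomputable def idealIA {R : Type*} [CommRing R] (A : Subalgebra R (Polynomial R)) : Ideal A :=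
  RingHom.ker ((evalRingHom (0 : R)).comp A.val.toRingHom)

/-- The canonical map between localizations of a module at nested multiplicative sets. -/
noncomputable def locToLoc {A : Type*} [CommRing A] {S T : Submonoid A} (h : S ≤ T)
    (M : Type*) [AddCommGroup M] [Module A M] :
    LocalizedModule S M →ₗ[A] LocalizedModule T M :=
  IsLocalizedModule.lift S (LocalizedModule.mkLinearMap S M)
    (LocalizedModule.mkLinearMap T M)
    (fun s => IsLocalizedModule.map_units (LocalizedModule.mkLinearMap T M) ⟨s.1, h s.2⟩)

universe v

/-- A module `N` over `S` is extended along the ring map `φ : R₀ →+* S` if `N ≅ S ⊗[R₀] N₀`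
for some `R₀`-module `N₀`. -/
def IsExtendedAlong {R₀ S : Type*} [CommRing R₀] [CommRing S] (φ : R₀ →+* S)
    (N : Type v) [AddCommGroup N] [Module S N] : Prop :=
  ∃ (N₀ : Type v) (_ : AddCommGroup N₀) (_ : Module R₀ N₀),
    letI : Algebra R₀ S := φ.toAlgebra
    Nonempty ((TensorProduct R₀ S N₀) ≃ₗ[S] N)

section maps

variable {R : Type*} [CommRing R] (A : Subalgebra R (Polynomial R)) (s t : R)

theorem powers_sup_le_comap :
    Submonoid.powers s ⊔ Submonoid.powers t ≤
      Submonoid.comap (algebraMap R A)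
        (Submonoid.powers (algebraMap R A s) ⊔ Submonoid.powers (algebraMap R A t)) := by
  apply sup_le
  · exact Submonoid.powers_le.mpr
      (Submonoid.mem_comap.mpr (SetLike.le_def.mp le_sup_left (Submonoid.mem_powers _)))
  · exact Submonoid.powers_le.mpr
      (Submonoid.mem_comap.mpr (SetLike.le_def.mp le_sup_right (Submonoid.mem_powers _)))

/-- The canonical map `R_st → A_st` induced by the inclusion `R ⊆ A` on the localizations at the
multiplicative set generated by `s` and `t`. -/
noncomputable def rstToAst :
    Localization (Submonoid.powers s ⊔ Submonoid.powers t) →+*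
      Localization (Submonoid.powers (algebraMap R A s) ⊔ Submonoid.powers (algebraMap R A t)) :=
  IsLocalization.map
    (Localization (Submonoid.powers (algebraMap R A s) ⊔ Submonoid.powers (algebraMap R A t)))
    (algebraMap R A) (powers_sup_le_comap A s t)

end maps

/-- `x` is a basic element of `M` at the prime `p`. -/
def IsBasicAt {R M : Type*} [CommRing R] [AddCommGroup M] [Module R M]
    (x : M) (p : Ideal R) (hp : p.IsPrime) : Prop :=
  letI := hp
  LocalizedModule.mkLinearMap p.primeCompl M x ∉
    (p.map (algebraMap R (Localization p.primeCompl))) •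
      (⊤ : Submodule (Localization p.primeCompl) (LocalizedModule p.primeCompl M))

/-- The quotient of `Q` by the cyclic submodule generated by `x` is a projective `S`-module which
is extended along `φ : R₀ →+* S`.  (The quotient is encoded by a surjection with kernel `S·x`.) -/
def IsProjExtQuotientBy {R₀ S : Type*} [CommRing R₀] [CommRing S] (φ : R₀ →+* S)
    (Q : Type*) [AddCommGroup Q] [Module S Q] (x : Q) : Prop :=
  ∃ (N : Type v) (iG : AddCommGroup N),
    letI := iG
    ∃ iM : Module S N,
      letI := iM
      ∃ ρ : Q →ₗ[S] N, Function.Surjective ρ ∧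
        LinearMap.ker ρ = Submodule.span S {x} ∧
        Module.Projective S N ∧ IsExtendedAlong φ N

open scoped TensorProduct

/-- Elementwise form of basicness: no element outside `p` multiplies `x` into `pM`. -/
def BasicAtPrime {A M : Type*} [CommRing A] [AddCommGroup M] [Module A M]
    (x : M) (p : Ideal A) : Prop :=
  ∀ r ∉ p, r • x ∉ p • (⊤ : Submodule A M)

section Localization

variable {A M : Type*} [CommRing A] [AddCommGroup M] [Module A M]

theorem mkLinearMap_mem_map_smul_top (S : Submonoid A) (I : Ideal A) {x : M}
    (hx : x ∈ I • (⊤ : Submodule A M)) :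
    LocalizedModule.mkLinearMap S M x ∈
      (I.map (algebraMap A (Localization S))) •
        (⊤ : Submodule (Localization S) (LocalizedModule S M)) := by
  refine Submodule.smul_induction_on hx (fun r hr n _ => ?_) (fun x y hx hy => ?_)
  · rw [map_smul, ← algebraMap_smul (Localization S)]
    exact Submodule.smul_mem_smul (Ideal.mem_map_of_mem _ hr) trivial
  · rw [map_add]; exact add_mem hx hy

theorem exists_smul_mkLinearMap_eq (S : Submonoid A) (u : LocalizedModule S M) :
    ∃ (x : M) (σ : A), σ ∈ S ∧ σ • u = LocalizedModule.mkLinearMap S M x := by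
  obtain ⟨⟨x, σ⟩, h⟩ := IsLocalizedModule.surj S (LocalizedModule.mkLinearMap S M) u
  exact ⟨x, σ, σ.2, h⟩

theorem exists_smul_eq_of_mem_map_smul_top (S : Submonoid A) (I : Ideal A)
    {u : LocalizedModule S M}
    (hu : u ∈ (I.map (algebraMap A (Localization S))) •
        (⊤ : Submodule (Localization S) (LocalizedModule S M))) :
    ∃ r ∈ S, ∃ x ∈ I • (⊤ : Submodule A M), r • u = LocalizedModule.mkLinearMap S M x := by
  refine Submodule.smul_induction_on hu (fun c hc n _ => ?_) (fun x y hx hy => ?_)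
  · obtain ⟨⟨a, σ⟩, h⟩ := (IsLocalization.mem_map_algebraMap_iff S _).1 hc
    obtain ⟨x, τ, hτ, h'⟩ := exists_smul_mkLinearMap_eq S n
    refine ⟨σ * τ, mul_mem σ.2 hτ, a.1 • x, Submodule.smul_mem_smul a.2 trivial, ?_⟩
    rw [map_smul, ← h', ← algebraMap_smul (Localization S) (a : A), ← h]
    simp only [← algebraMap_smul (Localization S) ((σ : A) * τ),
      ← algebraMap_smul (Localization S) τ, smul_smul, map_mul]
    congr 1; ring
  · obtain ⟨r, hr, x', hx', e⟩ := hx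
    obtain ⟨r', hr', y', hy', e'⟩ := hy
    refine ⟨r * r', mul_mem hr hr', r' • x' + r • y',
      add_mem (Submodule.smul_mem _ _ hx') (Submodule.smul_mem _ _ hy'), ?_⟩
    rw [map_add, map_smul, map_smul, ← e, ← e', smul_add, smul_smul, smul_smul, mul_comm r' r]

theorem mkLinearMap_mem_map_smul_top_iff (S : Submonoid A) (I : Ideal A) {x : M} :
    LocalizedModule.mkLinearMap S M x ∈
      (I.map (algebraMap A (Localization S))) •
        (⊤ : Submodule (Localization S) (LocalizedModule S M)) ↔
      ∃ r ∈ S, r • x ∈ I • (⊤ : Submodule A M) := by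
  constructor
  · intro h
    obtain ⟨r, hr, y, hy, e⟩ := exists_smul_eq_of_mem_map_smul_top S I h
    rw [← map_smul] at e
    obtain ⟨c, hc⟩ := (IsLocalizedModule.eq_iff_exists S (LocalizedModule.mkLinearMap S M)).1 e
    refine ⟨c * r, mul_mem c.2 hr, ?_⟩
    rw [mul_smul, show (c : A) • r • x = (c : A) • y from hc]
    exact Submodule.smul_mem _ _ hy
  · rintro ⟨r, hr, h⟩
    have h' := mkLinearMap_mem_map_smul_top S I h
    rw [map_smul, ← algebraMap_smul (Localization S)] at h'
    exact (Submodule.smul_mem_iff_of_isUnit _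
      (IsLocalization.map_units (Localization S) (⟨r, hr⟩ : S))).1 h'

theorem isBasicAt_iff (x : M) (p : Ideal A) (hp : p.IsPrime) :
    IsBasicAt x p hp ↔ BasicAtPrime x p := by
  unfold IsBasicAt BasicAtPrime
  rw [mkLinearMap_mem_map_smul_top_iff]
  simp [Ideal.mem_primeCompl_iff]

theorem basicAtPrime_smul_iff {p : Ideal A} (hp : p.IsPrime) {x : M} {σ : A} (hσ : σ ∉ p) :
    BasicAtPrime (σ • x) p ↔ BasicAtPrime x p := by
  constructor
  · intro h r hr hx
    refine h r hr ?_
    rw [smul_comm]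
    exact Submodule.smul_mem _ _ hx
  · intro h r hr hx
    rw [smul_smul] at hx
    exact h _ (fun h' => (hp.mem_or_mem h').elim hr hσ) hx

theorem basicAtPrime_add_iff {p : Ideal A} {x y : M} (hy : y ∈ p • (⊤ : Submodule A M)) :
    BasicAtPrime (x + y) p ↔ BasicAtPrime x p := by
  refine forall₂_congr fun r _ => not_congr ?_
  rw [smul_add]
  exact Submodule.add_mem_iff_left _ (Submodule.smul_mem _ _ hy)

theorem basicAtPrime_mkLinearMap_iff (S : Submonoid A) {p : Ideal (Localization S)}
    (hp : p.IsPrime) (x : M) :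
    BasicAtPrime (LocalizedModule.mkLinearMap S M x) p ↔
      BasicAtPrime x (p.comap (algebraMap A (Localization S))) := by
  have hmap : p = (p.comap (algebraMap A (Localization S))).map (algebraMap A (Localization S)) :=
    (IsLocalization.map_under S _ p).symm
  have key : ∀ r : A, algebraMap A (Localization S) r • LocalizedModule.mkLinearMap S M x ∈
      p • (⊤ : Submodule (Localization S) (LocalizedModule S M)) ↔
      ∃ c ∈ S, (c * r) • x ∈ p.comap (algebraMap A (Localization S)) • (⊤ : Submodule A M) := by
    intro r
    rw [algebraMap_smul, ← map_smul]
    nth_rewrite 1 [hmap]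
    rw [mkLinearMap_mem_map_smul_top_iff]
    simp only [mul_smul]
  have hu : ∀ c ∈ S, algebraMap A (Localization S) c ∉ p := fun c hc h =>
    hp.ne_top (Ideal.eq_top_of_isUnit_mem _ h
      (IsLocalization.map_units (Localization S) (⟨c, hc⟩ : S)))
  constructor
  · intro h r hr hx
    exact h _ hr ((key r).2 ⟨1, one_mem _, by rwa [one_mul]⟩)
  · intro h r' hr' hx
    obtain ⟨⟨a, σ⟩, ha⟩ := IsLocalization.surj S r'
    have ha' : algebraMap A (Localization S) a ∉ p := by
      rw [← ha]
      exact fun h' => (hp.mem_or_mem h').elim hr' (hu _ σ.2)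
    have : algebraMap A (Localization S) a • LocalizedModule.mkLinearMap S M x ∈
      p • (⊤ : Submodule (Localization S) (LocalizedModule S M)) := by
      rw [← ha, mul_comm, mul_smul]
      exact Submodule.smul_mem _ _ hx
    obtain ⟨c, hc, h'⟩ := (key a).1 this
    refine h (c * a) ?_ h'
    rw [Ideal.mem_comap, map_mul]
    exact fun h' => (hp.mem_or_mem h').elim (hu c hc) ha'

end Localization

section Family

/-- A family of elements of a module given by a polynomial in the parameter `b`. -/
def IsPolynomialFamily {S B X : Type*} [CommRing S] [CommRing B] [Algebra S B] [AddCommGroup X]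
    [Module B X] (F : S → X) : Prop :=
  ∃ e : ℕ →₀ X, ∀ b, F b = e.sum fun i x => algebraMap S B b ^ i • x

variable {S B X Y : Type*} [CommRing S] [CommRing B] [Algebra S B] [AddCommGroup X]
  [Module B X] [AddCommGroup Y] [Module B Y]

theorem IsPolynomialFamily.single (i : ℕ) (x : X) :
    IsPolynomialFamily (B := B) fun b : S => algebraMap S B b ^ i • x :=
  ⟨Finsupp.single i x, fun b => by simp⟩

theorem IsPolynomialFamily.add {F G : S → X} (hF : IsPolynomialFamily (B := B) F)
    (hG : IsPolynomialFamily (B := B) G) :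
    IsPolynomialFamily (B := B) fun b => F b + G b := by
  obtain ⟨e, he⟩ := hF
  obtain ⟨e', he'⟩ := hG
  refine ⟨e + e', fun b => ?_⟩
  simp only [he, he']
  rw [Finsupp.sum_add_index' (by simp) (by simp [smul_add])]

theorem IsPolynomialFamily.map {F : S → X} (hF : IsPolynomialFamily (B := B) F)
    (f : X →ₗ[B] Y) : IsPolynomialFamily (B := B) fun b => f (F b) := by
  obtain ⟨e, he⟩ := hF
  refine ⟨e.mapRange f (map_zero f), fun b => ?_⟩
  simp only [he]
  rw [Finsupp.sum_mapRange_index (by simp), map_finsuppSum]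
  simp

variable {T : B} (hgen : ∀ c : B, ∃ g : S[X], aeval T g = c)
  (φ : S → B →ₐ[S] B) (hφ : ∀ b, φ b T = algebraMap S B b * T)

include hgen hφ in
theorem IsPolynomialFamily.algHom (c : B) : IsPolynomialFamily (B := B) fun b => φ b c := by
  obtain ⟨g, rfl⟩ := hgen c
  induction g using Polynomial.induction_on' with
  | add p q hp hq => simpa using hp.add hq
  | monomial n a =>
    convert IsPolynomialFamily.single (S := S) (B := B) n (aeval T (monomial n a)) using 2 with b
    simp [aeval_monomial, hφ, mul_pow]
    ring

end Family

section Substitution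

theorem LinearMap.apply_mem_smul_top {B X Y : Type*} [CommRing B] [AddCommGroup X]
    [Module B X] [AddCommGroup Y] [Module B Y] (f : X →ₗ[B] Y) (P : Ideal B) {x : X}
    (hx : x ∈ P • (⊤ : Submodule B X)) : f x ∈ P • (⊤ : Submodule B Y) := by
  refine Submodule.smul_induction_on hx (fun r hr n _ => ?_) (fun x y hx hy => ?_)
  · rw [map_smul]; exact Submodule.smul_mem_smul hr trivial
  · rw [map_add]; exact add_mem hx hy

theorem LinearMap.apply_mem_of_mem_smul_top {B X : Type*} [CommRing B] [AddCommGroup X]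
    [Module B X] (f : X →ₗ[B] B) (P : Ideal B) {x : X} (hx : x ∈ P • (⊤ : Submodule B X)) :
    f x ∈ P := by
  refine Submodule.smul_induction_on hx (fun r hr n _ => ?_) (fun x y hx hy => ?_)
  · rw [map_smul, smul_eq_mul]; exact Ideal.mul_mem_right _ _ hr
  · rw [map_add]; exact add_mem hx hy

theorem Module.Projective.mem_smul_top {B X : Type*} [CommRing B] [AddCommGroup X]
    [Module B X] [Module.Projective B X] (P : Ideal B) {x : X}
    (hx : ∀ f : X →ₗ[B] B, f x ∈ P) : x ∈ P • (⊤ : Submodule B X) := by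
  obtain ⟨s, hs⟩ := Module.projective_def'.1 ‹Module.Projective B X›
  have h : Finsupp.linearCombination B id (s x) = x := LinearMap.congr_fun hs x
  rw [← h, Finsupp.linearCombination_apply]
  exact Submodule.sum_mem _ fun i _ =>
    Submodule.smul_mem_smul (hx (Finsupp.lapply i ∘ₗ s)) trivial

variable {S B Q E : Type*} [CommRing S] [CommRing B] [Algebra S B] [AddCommGroup Q]
  [Module S Q] [AddCommGroup E] [Module B E]

/-- A ring endomorphism of `B` acting on a module extended from `S`. -/
noncomputable def extendedMap (ψ : B →ₐ[S] B) : B ⊗[S] Q →ₗ[S] B ⊗[S] Q :=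
  ψ.toLinearMap.rTensor Q

theorem extendedMap_smul (ψ : B →ₐ[S] B) (c : B) (y : B ⊗[S] Q) :
    extendedMap ψ (c • y) = ψ c • extendedMap ψ y := by
  induction y with
  | zero => simp
  | tmul a q => simp [extendedMap, TensorProduct.smul_tmul']
  | add x y hx hy => rw [smul_add, map_add, map_add, smul_add, hx, hy]

theorem exists_apply_extendedMap_eq (ψ : B →ₐ[S] B) (f : B ⊗[S] Q →ₗ[B] B) :
    ∃ f' : B ⊗[S] Q →ₗ[B] B, ∀ y, f' (extendedMap ψ y) = ψ (f y) := by
  refine ⟨LinearMap.liftBaseChange B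
    (ψ.toLinearMap ∘ₗ f.restrictScalars S ∘ₗ TensorProduct.mk S B Q 1), fun y => ?_⟩
  induction y with
  | zero => simp
  | tmul a q =>
    simp only [extendedMap, LinearMap.rTensor_tmul, LinearMap.liftBaseChange_tmul,
      AlgHom.toLinearMap_apply, LinearMap.comp_apply, LinearMap.restrictScalars_apply,
      TensorProduct.mk_apply, smul_eq_mul]
    rw [← map_mul, ← smul_eq_mul, ← map_smul, TensorProduct.smul_tmul', smul_eq_mul, mul_one]
  | add x y hx hy => rw [map_add, map_add, map_add, map_add, hx, hy]

variable {T : B} (hgen : ∀ c : B, ∃ g : S[X], aeval T g = c)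
  (φ : S → B →ₐ[S] B) (hφ : ∀ b, φ b T = algebraMap S B b * T)

include hgen hφ in
theorem IsPolynomialFamily.extendedMap (y : B ⊗[S] Q) :
    IsPolynomialFamily (B := B) fun b => extendedMap (φ b) y := by
  induction y with
  | zero => exact ⟨0, by simp⟩
  | tmul a q =>
    exact (IsPolynomialFamily.algHom hgen φ hφ a).map
      ((TensorProduct.AlgebraTensorModule.mk S B B Q).flip q)
  | add x y hx hy => simpa using hx.add hy

include hgen hφ in
theorem algHom_one_eq_id : φ 1 = AlgHom.id S B := by
  ext c
  obtain ⟨g, rfl⟩ := hgen c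
  rw [← Polynomial.aeval_algHom_apply, hφ]
  simp

theorem exists_add_eq_one [Module.Projective B (B ⊗[S] Q)] {m₁ : E}
    (σ : B ⊗[S] Q →ₗ[B] E) {a : B} {x : B ⊗[S] Q}
    (h₂ : ∀ P : Ideal B, P.IsPrime → BasicAtPrime (a • m₁ + σ x) P) :
    ∃ (α : B) (f : B ⊗[S] Q →ₗ[B] B), α * a + f x = 1 := by
  by_contra! hne
  have htop : Ideal.span {a} ⊔ LinearMap.range (Module.Dual.eval B (B ⊗[S] Q) x) ≠ ⊤ := by
    intro h
    obtain ⟨y, hy, z, hz, h⟩ := Submodule.mem_sup.1 ((Ideal.eq_top_iff_one _).1 h)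
    obtain ⟨α, rfl⟩ := Ideal.mem_span_singleton'.1 hy
    obtain ⟨f, rfl⟩ := hz
    exact hne α f h
  obtain ⟨P, hP, hle⟩ := Ideal.exists_le_maximal _ htop
  have ha : a ∈ P := hle (Submodule.mem_sup_left (Ideal.mem_span_singleton_self a))
  have hx : x ∈ P • (⊤ : Submodule B (B ⊗[S] Q)) :=
    Module.Projective.mem_smul_top P fun f => hle (Submodule.mem_sup_right ⟨f, rfl⟩)
  refine h₂ P hP.isPrime 1 ((Ideal.ne_top_iff_one _).1 hP.ne_top) ?_
  rw [one_smul]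
  exact add_mem (Submodule.smul_mem_smul ha trivial) (σ.apply_mem_smul_top P hx)

theorem basicAtPrime_smul_add {P : Ideal B} (hP : P.IsPrime) {m₁ : E}
    (h₁ : BasicAtPrime m₁ P) (ρ : E →ₗ[B] B ⊗[S] Q) (σ : B ⊗[S] Q →ₗ[B] E)
    (hσ : ∀ y, ρ (σ y) = y) (hρ : ρ m₁ = 0) {a : B} {x : B ⊗[S] Q}
    {α : B} {f : B ⊗[S] Q →ₗ[B] B} (h : α * a + f x = 1) :
    BasicAtPrime (a • m₁ + σ x) P := by
  intro r hr hv
  have hρv : ρ (r • (a • m₁ + σ x)) = r • x := by simp [hσ, hρ]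
  have hx : f x ∈ P := by
    have := LinearMap.apply_mem_of_mem_smul_top (f ∘ₗ ρ) P hv
    rw [LinearMap.comp_apply, hρv, map_smul, smul_eq_mul] at this
    exact (hP.mem_or_mem this).resolve_left hr
  have ha : a ∈ P := by
    by_contra ha
    refine h₁ (r * a) (fun h' => (hP.mem_or_mem h').elim hr ha) ?_
    have h' := (σ ∘ₗ ρ).apply_mem_smul_top P hv
    rw [LinearMap.comp_apply, hρv] at h'
    have h'' := sub_mem hv h'
    rwa [map_smul, smul_add, add_sub_cancel_right, smul_smul] at h''
  exact hP.ne_top ((Ideal.eq_top_iff_one _).2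
    (h ▸ add_mem (Ideal.mul_mem_left _ _ ha) hx))

include hgen hφ in
/-- Substituting `T ↦ bT` in `m₂` produces a polynomial family of basic elements joining `m₁` to
`m₂`. -/
theorem exists_polynomial_family_basic [Module.Projective B (B ⊗[S] Q)] {m₁ m₂ w : E}
    (h₁ : ∀ P : Ideal B, P.IsPrime → BasicAtPrime m₁ P)
    (h₂ : ∀ P : Ideal B, P.IsPrime → BasicAtPrime m₂ P)
    (hw : m₂ = m₁ + T • w) (ρ : E →ₗ[B] B ⊗[S] Q) (hρ : Function.Surjective ρ)
    (hker : LinearMap.ker ρ = Submodule.span B {m₁}) :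
    ∃ F : S → E, IsPolynomialFamily (B := B) F ∧ m₂ = m₁ + T • F 1 ∧
      ∀ (b : S) (P : Ideal B), P.IsPrime → BasicAtPrime (m₁ + (algebraMap S B b * T) • F b) P := by
  obtain ⟨σ, hσ⟩ := Module.projective_lifting_property ρ LinearMap.id hρ
  replace hσ : ∀ y, ρ (σ y) = y := LinearMap.congr_fun hσ
  have hρm : ρ m₁ = 0 := by
    rw [← LinearMap.mem_ker, hker]; exact Submodule.mem_span_singleton_self m₁
  obtain ⟨c, hc⟩ : ∃ c : B, c • m₁ = w - σ (ρ w) := by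
    rw [← Submodule.mem_span_singleton, ← hker]
    simp [hσ]
  replace hc : w = c • m₁ + σ (ρ w) := by rw [hc]; abel
  have hm₂ : m₂ = (1 + T * c) • m₁ + σ (T • ρ w) := by
    rw [hw, map_smul, add_smul, one_smul, mul_smul, add_assoc, ← smul_add, ← hc]
  rw [hm₂] at h₂
  obtain ⟨α, f, hf⟩ := exists_add_eq_one σ h₂
  refine ⟨fun b => φ b c • m₁ + σ (extendedMap (φ b) (ρ w)), ?_, ?_, fun b P hP => ?_⟩
  · exact ((IsPolynomialFamily.algHom hgen φ hφ c).map (LinearMap.toSpanSingleton B E m₁)).add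
      ((IsPolynomialFamily.extendedMap hgen φ hφ (ρ w)).map σ)
  · have h1 : extendedMap (AlgHom.id S B) (ρ w) = ρ w := by
      simp [extendedMap]
    simp only [algHom_one_eq_id hgen φ hφ, h1, AlgHom.id_apply]
    rw [← hc, hw]
  · obtain ⟨f', hf'⟩ := exists_apply_extendedMap_eq (φ b) f
    have key := basicAtPrime_smul_add hP (h₁ P hP) ρ σ hσ hρm (a := φ b (1 + T * c))
      (x := extendedMap (φ b) (T • ρ w)) (α := φ b α) (f := f')
      (by rw [hf', ← map_mul, ← map_add, hf, map_one])
    convert key using 1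
    rw [extendedMap_smul, map_add, map_mul, map_one, hφ, map_smul, smul_add, add_smul, one_smul,
      mul_smul _ (φ b c), add_assoc]

end Substitution

section Gluing

variable {A M : Type*} [CommRing A] [AddCommGroup M] [Module A M]

@[simp]
theorem locToLoc_mkLinearMap {S₁ S₂ : Submonoid A} (h : S₁ ≤ S₂) (x : M) :
    locToLoc h M (LocalizedModule.mkLinearMap S₁ M x) = LocalizedModule.mkLinearMap S₂ M x :=
  IsLocalizedModule.lift_apply S₁ _ _ _ x

theorem smul_localizedModule_bijective {S : Submonoid A} {σ : A} (hσ : σ ∈ S) :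
    Function.Bijective fun u : LocalizedModule S M => σ • u :=
  (Module.End.isUnit_iff _).1
    (IsLocalizedModule.map_units (LocalizedModule.mkLinearMap S M) ⟨σ, hσ⟩)

theorem algebraMap_localization_notMem {S : Submonoid A} {P : Ideal (Localization S)}
    (hP : P.IsPrime) {σ : A} (hσ : σ ∈ S) : algebraMap A (Localization S) σ ∉ P := fun h =>
  hP.ne_top (Ideal.eq_top_of_isUnit_mem _ h
    (IsLocalization.map_units (Localization S) (⟨σ, hσ⟩ : S)))

theorem basicAtPrime_mkLinearMap_map_iff (S : Submonoid A) {p : Ideal A} (hp : p.IsPrime)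
    (hd : Disjoint (S : Set A) p) (x : M) :
    BasicAtPrime (LocalizedModule.mkLinearMap S M x)
      (p.map (algebraMap A (Localization S))) ↔ BasicAtPrime x p := by
  rw [basicAtPrime_mkLinearMap_iff S (IsLocalization.isPrime_of_isPrime_disjoint S _ p hp hd)]
  rw [show (p.map (algebraMap A (Localization S))).comap (algebraMap A (Localization S)) = p from
    IsLocalization.under_map_of_isPrime_disjoint S _ hp hd]

theorem BasicAtPrime.locToLoc {S₁ S₂ : Submonoid A} (h : S₁ ≤ S₂) {u : LocalizedModule S₁ M}
    (hu : ∀ q : Ideal (Localization S₁), q.IsPrime → BasicAtPrime u q)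
    {P : Ideal (Localization S₂)} (hP : P.IsPrime) : BasicAtPrime (locToLoc h M u) P := by
  obtain ⟨x, σ, hσ, hx⟩ := exists_smul_mkLinearMap_eq S₁ u
  have hp : (P.comap (algebraMap A (Localization S₂))).IsPrime := hP.comap _
  have hd : Disjoint (S₁ : Set A) (P.comap (algebraMap A (Localization S₂))) :=
    Set.disjoint_left.2 fun τ hτ h' => algebraMap_localization_notMem hP (h hτ) h'
  have hq := IsLocalization.isPrime_of_isPrime_disjoint S₁ (Localization S₁) _ hp hd
  have h1 := hu _ hq
  rw [← basicAtPrime_smul_iff hq (algebraMap_localization_notMem hq hσ), algebraMap_smul, hx,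
    basicAtPrime_mkLinearMap_map_iff S₁ hp hd] at h1
  rwa [← basicAtPrime_smul_iff hP (algebraMap_localization_notMem hP (h hσ)), algebraMap_smul,
    ← map_smul, hx, locToLoc_mkLinearMap, basicAtPrime_mkLinearMap_iff S₂ hP]

theorem locToLoc_mem_map_smul_top {S₁ S₂ : Submonoid A} (h : S₁ ≤ S₂) (I : Ideal A)
    {u : LocalizedModule S₁ M}
    (hu : u ∈ (I.map (algebraMap A (Localization S₁))) •
      (⊤ : Submodule (Localization S₁) (LocalizedModule S₁ M))) :
    locToLoc h M u ∈ (I.map (algebraMap A (Localization S₂))) •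
      (⊤ : Submodule (Localization S₂) (LocalizedModule S₂ M)) := by
  obtain ⟨r, hr, x, hx, e⟩ := exists_smul_eq_of_mem_map_smul_top S₁ I hu
  have h' := mkLinearMap_mem_map_smul_top S₂ I hx
  rw [← locToLoc_mkLinearMap h, ← e, map_smul, ← algebraMap_smul (Localization S₂)] at h'
  exact (Submodule.smul_mem_iff_of_isUnit _
    (IsLocalization.map_units (Localization S₂) (⟨r, h hr⟩ : S₂))).1 h'

theorem exists_smul_mem_range_locToLoc {S₁ S₂ S₃ : Submonoid A} (h : S₁ ≤ S₃)
    (h₃ : S₃ ≤ S₁ ⊔ S₂) (u : LocalizedModule S₃ M) :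
    ∃ τ ∈ S₂, τ • u ∈ LinearMap.range (locToLoc h M) := by
  obtain ⟨x, σ, hσ, hx⟩ := exists_smul_mkLinearMap_eq S₃ u
  obtain ⟨σ₁, h₁, τ, hτ, rfl⟩ := Submonoid.mem_sup.1 (h₃ hσ)
  obtain ⟨y, hy⟩ := (smul_localizedModule_bijective h₁).2 (LocalizedModule.mkLinearMap S₁ M x)
  refine ⟨τ, hτ, y, (smul_localizedModule_bijective (h h₁)).1 ?_⟩
  simp only at hy ⊢
  rw [← map_smul, hy, locToLoc_mkLinearMap, ← hx, mul_smul]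

theorem exists_pow_smul_mem_range_locToLoc {S₁ S₃ : Submonoid A} {t : A} (h : S₁ ≤ S₃)
    (h₃ : S₃ ≤ S₁ ⊔ Submonoid.powers t) (e : ℕ →₀ LocalizedModule S₃ M) :
    ∃ k : ℕ, ∀ n, k ≤ n → ∀ i, t ^ n • e i ∈ LinearMap.range (locToLoc h M) := by
  have : ∀ i, ∃ k : ℕ, t ^ k • e i ∈ LinearMap.range (locToLoc h M) := fun i => by
    obtain ⟨_, ⟨k, rfl⟩, hk⟩ := exists_smul_mem_range_locToLoc h h₃ (e i)
    exact ⟨k, hk⟩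
  choose k hk using this
  refine ⟨e.support.sup k, fun n hn i => ?_⟩
  by_cases hi : i ∈ e.support
  · rw [← Nat.sub_add_cancel ((Finset.le_sup hi).trans hn), pow_add, mul_smul]
    exact Submodule.smul_mem _ _ (hk i)
  · rw [Finsupp.notMem_support_iff.1 hi, smul_zero]
    exact zero_mem _

theorem exists_mul_pow_add_mul_pow_eq_one {s t : A} (hst : Ideal.span {s, t} = ⊤) (m n : ℕ) :
    ∃ c d : A, c * s ^ m + d * t ^ n = 1 := by
  have h : IsCoprime s t := by
    rw [← Ideal.isCoprime_span_singleton_iff, Ideal.isCoprime_iff_sup_eq, ← Ideal.span_insert, hst]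
  exact h.pow

theorem mem_of_pow_smul_mem {s t : A} (hst : Ideal.span {s, t} = ⊤) (N : Submodule A M) {x : M}
    (hs : ∃ r ∈ Submonoid.powers s, r • x ∈ N) (ht : ∃ r ∈ Submonoid.powers t, r • x ∈ N) :
    x ∈ N := by
  obtain ⟨_, ⟨m, rfl⟩, hs⟩ := hs
  obtain ⟨_, ⟨n, rfl⟩, ht⟩ := ht
  obtain ⟨c, d, h⟩ := exists_mul_pow_add_mul_pow_eq_one hst m n
  rw [← one_smul A x, ← h, add_smul, mul_smul, mul_smul]
  exact add_mem (N.smul_mem _ hs) (N.smul_mem _ ht)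

/-- Elements of `M_s` and `M_t` which agree on the overlap glue when `s` and `t` are comaximal. -/
theorem exists_glue {s t : A} (hst : Ideal.span {s, t} = ⊤)
    (u₁ : LocalizedModule (Submonoid.powers s) M) (u₂ : LocalizedModule (Submonoid.powers t) M)
    (h : locToLoc (le_sup_left : _ ≤ Submonoid.powers s ⊔ Submonoid.powers t) M u₁ =
      locToLoc (le_sup_right : _ ≤ Submonoid.powers s ⊔ Submonoid.powers t) M u₂) :
    ∃ m : M, LocalizedModule.mkLinearMap (Submonoid.powers s) M m = u₁ ∧
      LocalizedModule.mkLinearMap (Submonoid.powers t) M m = u₂ := by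
  obtain ⟨x, _, ⟨a, rfl⟩, hx⟩ := exists_smul_mkLinearMap_eq _ u₁
  obtain ⟨y, _, ⟨b, rfl⟩, hy⟩ := exists_smul_mkLinearMap_eq _ u₂
  simp only at hx hy
  have hxy : LocalizedModule.mkLinearMap (Submonoid.powers s ⊔ Submonoid.powers t) M (t ^ b • x) =
      LocalizedModule.mkLinearMap (Submonoid.powers s ⊔ Submonoid.powers t) M (s ^ a • y) := by
    rw [map_smul, map_smul, ← locToLoc_mkLinearMap le_sup_left, ← hx,
      ← locToLoc_mkLinearMap le_sup_right, ← hy, map_smul, map_smul, h, smul_comm]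
  obtain ⟨⟨c, hc⟩, hcxy⟩ := (IsLocalizedModule.eq_iff_exists
    (Submonoid.powers s ⊔ Submonoid.powers t) _).1 hxy
  obtain ⟨_, ⟨i, rfl⟩, _, ⟨j, rfl⟩, rfl⟩ := Submonoid.mem_sup.1 hc
  replace hcxy : (s ^ i * t ^ j) • t ^ b • x = (s ^ i * t ^ j) • s ^ a • y := hcxy
  obtain ⟨c, d, hcd⟩ := exists_mul_pow_add_mul_pow_eq_one hst (a + i) (b + j)
  have hxy' : t ^ (b + j) • s ^ i • x = s ^ (a + i) • t ^ j • y := by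
    convert hcxy using 1 <;> simp only [smul_smul] <;> congr 1 <;> ring
  refine ⟨c • s ^ i • x + d • t ^ j • y, ?_, ?_⟩
  · refine (smul_localizedModule_bijective (⟨a + i, rfl⟩ : s ^ (a + i) ∈ Submonoid.powers s)).1 ?_
    simp only
    rw [← map_smul, smul_add, smul_comm _ d, ← hxy', smul_comm _ c, ← mul_smul c, ← mul_smul d,
      ← add_smul, hcd, one_smul, map_smul, ← hx, smul_smul, ← pow_add, add_comm]
  · refine (smul_localizedModule_bijective (⟨b + j, rfl⟩ : t ^ (b + j) ∈ Submonoid.powers t)).1 ?_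
    simp only
    rw [← map_smul, smul_add, smul_comm _ c, hxy', smul_comm _ d, ← mul_smul c, ← mul_smul d,
      ← add_smul, hcd, one_smul, map_smul, ← hy, smul_smul, ← pow_add, add_comm]

theorem disjoint_powers_of_notMem {p : Ideal A} (hp : p.IsPrime) {s : A} (hs : s ∉ p) :
    Disjoint (Submonoid.powers s : Set A) p :=
  Set.disjoint_left.2 fun _ ⟨_, hn⟩ h => hs (hp.mem_of_pow_mem _ (hn ▸ h))

end Gluing

section Subalgebra

variable {R : Type*} [CommRing R] {A : Subalgebra R R[X]} {s t : R}

theorem exists_algebraMap_eq_pow_mul_aeval {B : Type*} [CommRing B] [Algebra R B] [Algebra A B]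
    [IsScalarTower R A B] {T : B} {n : ℕ} {a : A} (ha : (a : R[X]) = C s ^ n * X)
    (hT : algebraMap R B s ^ n * T = algebraMap A B a) (f : R[X]) :
    ∃ (k : ℕ) (g : A), (g : R[X]) = C s ^ k * f ∧
      algebraMap A B g = algebraMap R B s ^ k * aeval T f := by
  induction f using Polynomial.induction_on with
  | C r => exact ⟨0, algebraMap R A r, by simp, by simp [← IsScalarTower.algebraMap_apply]⟩
  | add p q hp hq =>
    obtain ⟨k, g, h1, h2⟩ := hp
    obtain ⟨l, g', h3, h4⟩ := hq
    refine ⟨k + l, algebraMap R A s ^ l * g + algebraMap R A s ^ k * g', ?_, ?_⟩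
    · simp [h1, h3]; ring
    · simp [h2, h4, ← IsScalarTower.algebraMap_apply]; ring
  | monomial m r h =>
    obtain ⟨k, g, h1, h2⟩ := h
    refine ⟨k + n, g * a, ?_, ?_⟩
    · simp [h1, ha]; ring
    · rw [map_mul, h2, ← hT]; simp; ring

theorem algebraMap_eq_aeval {B : Type*} [CommRing B] [Algebra R B] [Algebra A B]
    [IsScalarTower R A B] {T : B} {n : ℕ} {a : A} (ha : (a : R[X]) = C s ^ n * X)
    (hT : algebraMap R B s ^ n * T = algebraMap A B a) (hs : IsUnit (algebraMap R B s)) (f : A) :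
    algebraMap A B f = aeval T (f : R[X]) := by
  obtain ⟨k, g, h1, h2⟩ := exists_algebraMap_eq_pow_mul_aeval ha hT (f : R[X])
  have : g = algebraMap R A s ^ k * f := Subtype.ext (by simp [h1])
  rw [this, map_mul, map_pow, ← IsScalarTower.algebraMap_apply] at h2
  exact (hs.pow k).mul_left_cancel h2

theorem mem_map_idealIA_imp_dvd {B : Type*} [CommRing B] [Algebra R B] [Algebra A B]
    {T : B} (h : ∀ f : A, algebraMap A B f = aeval T (f : R[X])) {x : B}
    (hx : x ∈ (idealIA A).map (algebraMap A B)) : T ∣ x := by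
  rw [← Ideal.mem_span_singleton]
  refine Ideal.map_le_iff_le_comap.2 (fun f hf => ?_) hx
  have hf0 : (f : R[X]).eval 0 = 0 := hf
  rw [Ideal.mem_comap, Ideal.mem_span_singleton, h]
  obtain ⟨g, hg⟩ := Polynomial.X_dvd_iff.2 ((Polynomial.coeff_zero_eq_eval_zero _).trans hf0)
  rw [hg, map_mul, aeval_X]
  exact dvd_mul_right _ _

end Subalgebra

section Localization

variable {R : Type*} [CommRing R] (A : Subalgebra R R[X]) (s t : R)

/-- The multiplicative set generated by `s` and `t` in `A`. -/
noncomputable abbrev powersSup : Submonoid A :=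
  Submonoid.powers (algebraMap R A s) ⊔ Submonoid.powers (algebraMap R A t)

theorem algebraMap_mem_powersSup {σ : R} (hσ : σ ∈ Submonoid.powers s ⊔ Submonoid.powers t) :
    algebraMap R A σ ∈ powersSup A s t :=
  powers_sup_le_comap A s t hσ

theorem exists_algebraMap_eq_of_mem_powersSup {σ : A} (hσ : σ ∈ powersSup A s t) :
    ∃ τ ∈ Submonoid.powers s ⊔ Submonoid.powers t, algebraMap R A τ = σ := by
  obtain ⟨_, ⟨i, rfl⟩, _, ⟨j, rfl⟩, rfl⟩ := Submonoid.mem_sup.1 hσ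
  exact ⟨s ^ i * t ^ j, Submonoid.mul_mem_sup ⟨i, rfl⟩ ⟨j, rfl⟩, by simp⟩

theorem isUnit_algebraMap_of_mem {σ : R} (hσ : σ ∈ Submonoid.powers s ⊔ Submonoid.powers t) :
    IsUnit (algebraMap R (Localization (powersSup A s t)) σ) := by
  rw [IsScalarTower.algebraMap_apply R A]
  exact IsLocalization.map_units (Localization (powersSup A s t))
    (⟨_, algebraMap_mem_powersSup A s t hσ⟩ : powersSup A s t)

theorem rstToAst_algebraMap (r : R) :
    rstToAst A s t (algebraMap R (Localization (Submonoid.powers s ⊔ Submonoid.powers t)) r) =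
      algebraMap R (Localization (powersSup A s t)) r :=
  (IsLocalization.map_eq _ r).trans (IsScalarTower.algebraMap_apply R A _ r).symm

variable [Algebra (Localization (Submonoid.powers s ⊔ Submonoid.powers t))
    (Localization (powersSup A s t))]
  [IsScalarTower R (Localization (Submonoid.powers s ⊔ Submonoid.powers t))
    (Localization (powersSup A s t))]

variable {A s t} {T : Localization (powersSup A s t)}
  (h : ∀ f : A, algebraMap A (Localization (powersSup A s t)) f = aeval T (f : R[X]))

include h in
theorem exists_aeval_eq (c : Localization (powersSup A s t)) :
    ∃ g : (Localization (Submonoid.powers s ⊔ Submonoid.powers t))[X], aeval T g = c := by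
  obtain ⟨⟨f, σ, hσ⟩, hc⟩ := IsLocalization.surj (powersSup A s t) c
  obtain ⟨τ, hτ, rfl⟩ := exists_algebraMap_eq_of_mem_powersSup A s t hσ
  simp only [← IsScalarTower.algebraMap_apply] at hc
  refine ⟨C (IsLocalization.mk' _ (1 : R) (⟨τ, hτ⟩ :
    (Submonoid.powers s ⊔ Submonoid.powers t : Submonoid R))) *
    (f : R[X]).map (algebraMap R _), (isUnit_algebraMap_of_mem A s t hτ).mul_right_cancel ?_⟩
  rw [hc, h, map_mul, aeval_C, aeval_map_algebraMap, IsScalarTower.algebraMap_apply R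
    (Localization (Submonoid.powers s ⊔ Submonoid.powers t)), mul_right_comm, ← map_mul,
    IsLocalization.mk'_spec _ (1 : R) (⟨τ, hτ⟩ :
    (Submonoid.powers s ⊔ Submonoid.powers t : Submonoid R)), map_one, map_one, one_mul]

include h in
theorem exists_algHom_apply_eq {n : ℕ} {a : A} (ha : (a : R[X]) = C s ^ n * X)
    (b : Localization (Submonoid.powers s ⊔ Submonoid.powers t)) :
    ∃ ψ : Localization (powersSup A s t)
        →ₐ[Localization (Submonoid.powers s ⊔ Submonoid.powers t)] Localization (powersSup A s t),
      ψ T = algebraMap _ _ b * T := by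
  let θ : A →+* Localization (powersSup A s t) :=
    (aeval (R := R) (algebraMap _ (Localization (powersSup A s t)) b * T)).toRingHom.comp
      A.val.toRingHom
  have hθR : ∀ r : R, θ (algebraMap R A r) = algebraMap R _ r := fun r => by simp [θ]
  have hθ : ∀ σ : powersSup A s t, IsUnit (θ σ) := by
    rintro ⟨σ, hσ⟩
    obtain ⟨τ, hτ, rfl⟩ := exists_algebraMap_eq_of_mem_powersSup A s t hσ
    simp only [hθR]
    exact isUnit_algebraMap_of_mem A s t hτ
  have hψ : ∀ f : A, IsLocalization.lift (S := Localization (powersSup A s t)) hθ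
    (algebraMap A _ f) = θ f := IsLocalization.lift_eq hθ
  have hψR : ∀ r : R, IsLocalization.lift (S := Localization (powersSup A s t)) hθ
      (algebraMap R _ r) = algebraMap R _ r := fun r => by
    rw [IsScalarTower.algebraMap_apply R A, hψ, hθR, ← IsScalarTower.algebraMap_apply]
  refine ⟨⟨IsLocalization.lift (S := Localization (powersSup A s t)) hθ, fun r => ?_⟩, ?_⟩
  · refine RingHom.congr_fun (f := (IsLocalization.lift hθ).comp (algebraMap _ _))
      (g := algebraMap _ _)
      (IsLocalization.ringHom_ext (Submonoid.powers s ⊔ Submonoid.powers t) ?_) r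
    ext x
    simp only [RingHom.comp_apply, ← IsScalarTower.algebraMap_apply, hψR]
  · have hs : IsUnit (algebraMap R (Localization (powersSup A s t)) s ^ n) :=
      (isUnit_algebraMap_of_mem A s t (Submonoid.mem_sup_left ⟨1, pow_one s⟩)).pow n
    have h2 : IsLocalization.lift (S := Localization (powersSup A s t)) hθ
        (algebraMap R _ s ^ n * T) = θ a := by
      rw [← hψ, h, ha]
      simp only [map_mul, map_pow, aeval_C, aeval_X]
    rw [map_mul, map_pow, hψR] at h2
    refine hs.mul_left_cancel (h2.trans ?_)
    simp [θ, ha]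

end Localization

section Patching

variable {A M : Type*} [CommRing A] [AddCommGroup M] [Module A M]

theorem exists_sum_smul_eq_smul (β δ : A) (L : Submodule A M)
    (e : ℕ →₀ M) (he : ∀ i, δ • e i ∈ L) (g : ℕ → A) (hg : ∀ i, β * δ ∣ g i) :
    ∃ w ∈ L, e.sum (fun i x => g i • x) = β • w := by
  choose c hc using hg
  refine ⟨e.sum fun i x => c i • δ • x, Submodule.sum_mem _ fun i _ => L.smul_mem _ (he i), ?_⟩
  rw [Finsupp.smul_sum]
  refine Finsupp.sum_congr fun i _ => ?_
  rw [hc, smul_smul, smul_smul]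
  congr 1; ring

/-- For `r` divisible by a high power of `t` and with `r - 1` divisible by a high power of `s`, the
member at `r` of a polynomial family over the overlap lifts to both charts. -/
theorem exists_lifts {R : Type*} [CommRing R] [Algebra R A] {s t : R}
    (hst : Ideal.span {s, t} = ⊤) (a : A) {S₁ S₂ S₃ : Submonoid A} (h₁ : S₁ ≤ S₃) (h₂ : S₂ ≤ S₃)
    (h₁' : S₃ ≤ S₁ ⊔ Submonoid.powers (algebraMap R A t))
    (h₂' : S₃ ≤ S₂ ⊔ Submonoid.powers (algebraMap R A s))
    (m₁ : LocalizedModule S₁ M) (m₂ : LocalizedModule S₂ M) (e : ℕ →₀ LocalizedModule S₃ M)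
    (hm : locToLoc h₂ M m₂ = locToLoc h₁ M m₁ + a • e.sum fun _ x => x) :
    ∃ (r : R) (w₁ : LocalizedModule S₁ M) (w₂ : LocalizedModule S₂ M),
      locToLoc h₁ M (m₁ + a • algebraMap R A t • w₁) =
        locToLoc h₁ M m₁ + a • e.sum (fun i x => algebraMap R A r ^ (i + 1) • x) ∧
      locToLoc h₂ M (m₂ + a • algebraMap R A s • w₂) =
        locToLoc h₁ M m₁ + a • e.sum (fun i x => algebraMap R A r ^ (i + 1) • x) := by
  obtain ⟨k₁, hk₁⟩ := exists_pow_smul_mem_range_locToLoc h₁ h₁' e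
  obtain ⟨k₂, hk₂⟩ := exists_pow_smul_mem_range_locToLoc h₂ h₂' e
  set K := max k₁ k₂
  obtain ⟨c, d, hcd⟩ := exists_mul_pow_add_mul_pow_eq_one hst (K + 1) (K + 1)
  set β : A := algebraMap R A (d * t ^ (K + 1)) with hβ
  have hβt : ∀ i, algebraMap R A t * algebraMap R A t ^ K ∣ β ^ (i + 1) := fun i =>
    Dvd.dvd.trans ⟨algebraMap R A d, by simp only [hβ, map_mul, map_pow]; ring⟩
      (dvd_pow_self β i.succ_ne_zero)
  have hβs : ∀ i, algebraMap R A s * algebraMap R A s ^ K ∣ β ^ (i + 1) - 1 := fun i => by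
    have h1 : β - 1 = algebraMap R A s * algebraMap R A s ^ K * -algebraMap R A c := by
      have h2 := congrArg (algebraMap R A) hcd
      simp only [map_add, map_mul, map_pow, map_one] at h2
      simp only [hβ, map_mul, map_pow, ← h2]; ring
    have h3 := sub_dvd_pow_sub_pow β 1 (i + 1)
    rw [one_pow, h1] at h3
    exact (dvd_mul_right _ _).trans h3
  obtain ⟨_, ⟨w₁, rfl⟩, hw₁⟩ := exists_sum_smul_eq_smul _ _ _ e
    (hk₁ K (le_max_left _ _)) _ hβt
  obtain ⟨_, ⟨w₂, rfl⟩, hw₂⟩ := exists_sum_smul_eq_smul _ _ _ e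
    (hk₂ K (le_max_right _ _)) _ hβs
  refine ⟨d * t ^ (K + 1), w₁, w₂, ?_, ?_⟩
  · rw [hw₁, map_add, map_smul, map_smul]
  · rw [map_add, map_smul, map_smul, ← hw₂, hm, add_assoc, ← smul_add]
    simp only [Finsupp.sum, ← Finset.sum_add_distrib, sub_smul, one_smul, add_sub_cancel, hβ]

theorem smul_mem_map_smul_top (S : Submonoid A) {I : Ideal A} {r : A} (hr : r ∈ I)
    (u : LocalizedModule S M) : r • u ∈ I.map (algebraMap A (Localization S)) •
      (⊤ : Submodule (Localization S) (LocalizedModule S M)) := by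
  rw [← algebraMap_smul (Localization S)]
  exact Submodule.smul_mem_smul (Ideal.mem_map_of_mem _ hr) trivial

variable {s t a : A} {m : M}
  {m₁ w₁ : LocalizedModule (Submonoid.powers s) M} {m₂ w₂ : LocalizedModule (Submonoid.powers t) M}

theorem basicAtPrime_of_mkLinearMap_eq_add {p : Ideal A} (hp : p.IsPrime) (hs : s ∉ p)
    (ht : t ∈ p) (hm : LocalizedModule.mkLinearMap (Submonoid.powers s) M m = m₁ + a • t • w₁)
    (hb : ∀ q : Ideal (Localization (Submonoid.powers s)), q.IsPrime → BasicAtPrime m₁ q) :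
    BasicAtPrime m p := by
  have hd := disjoint_powers_of_notMem hp hs
  rw [← basicAtPrime_mkLinearMap_map_iff (Submonoid.powers s) hp hd, hm, smul_comm,
    basicAtPrime_add_iff (smul_mem_map_smul_top _ ht _)]
  exact hb _ (IsLocalization.isPrime_of_isPrime_disjoint _ _ p hp hd)

theorem basicAtPrime_of_glued (hst : Ideal.span {s, t} = ⊤)
    (hm₁ : LocalizedModule.mkLinearMap (Submonoid.powers s) M m = m₁ + a • t • w₁)
    (hm₂ : LocalizedModule.mkLinearMap (Submonoid.powers t) M m = m₂ + a • s • w₂)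
    (hb₁ : ∀ q : Ideal (Localization (Submonoid.powers s)), q.IsPrime → BasicAtPrime m₁ q)
    (hb₂ : ∀ q : Ideal (Localization (Submonoid.powers t)), q.IsPrime → BasicAtPrime m₂ q)
    (hb : ∀ P : Ideal (Localization (Submonoid.powers s ⊔ Submonoid.powers t)), P.IsPrime →
      BasicAtPrime (locToLoc (le_sup_left : _ ≤ Submonoid.powers s ⊔ Submonoid.powers t) M
        (m₁ + a • t • w₁)) P)
    {p : Ideal A} (hp : p.IsPrime) : BasicAtPrime m p := by
  by_cases hs : s ∈ p
  · refine basicAtPrime_of_mkLinearMap_eq_add hp (fun ht => hp.ne_top ?_) hs hm₂ hb₂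
    rw [eq_top_iff, ← hst, Ideal.span_le]
    rintro x (rfl | rfl) <;> assumption
  by_cases ht : t ∈ p
  · exact basicAtPrime_of_mkLinearMap_eq_add hp hs ht hm₁ hb₁
  have hd : Disjoint ((Submonoid.powers s ⊔ Submonoid.powers t : Submonoid A) : Set A) p := by
    rw [Set.disjoint_left]
    have hle : Submonoid.powers s ⊔ Submonoid.powers t ≤ p.primeCompl :=
      sup_le (Submonoid.powers_le.2 hs) (Submonoid.powers_le.2 ht)
    exact fun x hx => hle hx
  rw [← basicAtPrime_mkLinearMap_map_iff _ hp hd, ← locToLoc_mkLinearMap le_sup_left, hm₁]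
  exact hb _ (IsLocalization.isPrime_of_isPrime_disjoint _ _ p hp hd)

theorem mem_smul_top_of_glued (hst : Ideal.span {s, t} = ⊤) {I : Ideal A} (ha : a ∈ I) {z : M}
    (hm₁ : LocalizedModule.mkLinearMap (Submonoid.powers s) M m = m₁ + a • t • w₁)
    (hm₂ : LocalizedModule.mkLinearMap (Submonoid.powers t) M m = m₂ + a • s • w₂)
    (hz₁ : m₁ - LocalizedModule.mkLinearMap (Submonoid.powers s) M z ∈
      I.map (algebraMap A (Localization (Submonoid.powers s))) •
        (⊤ : Submodule (Localization (Submonoid.powers s)) _))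
    (hz₂ : m₂ - LocalizedModule.mkLinearMap (Submonoid.powers t) M z ∈
      I.map (algebraMap A (Localization (Submonoid.powers t))) •
        (⊤ : Submodule (Localization (Submonoid.powers t)) _)) :
    m - z ∈ I • (⊤ : Submodule A M) := by
  refine mem_of_pow_smul_mem hst _ ?_ ?_ <;>
    rw [← mkLinearMap_mem_map_smul_top_iff, map_sub]
  · rw [hm₁, add_sub_right_comm]
    exact add_mem hz₁ (smul_mem_map_smul_top _ ha _)
  · rw [hm₂, add_sub_right_comm]
    exact add_mem hz₂ (smul_mem_map_smul_top _ ha _)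

end Patching

section Extraction

theorem exists_eq_add_smul {B E : Type*} [CommRing B] [AddCommGroup E] [Module B E] {J : Ideal B}
    {T : B} (hJ : ∀ x ∈ J, T ∣ x) {m₁ m₂ z : E} (h₁ : m₁ - z ∈ J • (⊤ : Submodule B E))
    (h₂ : m₂ - z ∈ J • (⊤ : Submodule B E)) : ∃ w, m₂ = m₁ + T • w := by
  have h : ∀ y ∈ J • (⊤ : Submodule B E), ∃ w, y = T • w := by
    intro y hy
    refine Submodule.smul_induction_on hy (fun r hr y _ => ?_) ?_
    · obtain ⟨c, rfl⟩ := hJ r hr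
      exact ⟨c • y, mul_smul _ _ _⟩
    · rintro _ _ ⟨y, rfl⟩ ⟨y', rfl⟩
      exact ⟨y + y', (smul_add _ _ _).symm⟩
  obtain ⟨w, hw⟩ := h _ (sub_mem h₂ h₁)
  exact ⟨w, by rw [← hw]; abel⟩

variable {R S A B E : Type*} [CommRing R] [CommRing S] [CommRing A] [CommRing B]
  [Algebra R S] [Algebra R A] [Algebra R B] [Algebra S B] [Algebra A B]
  [IsScalarTower R S B] [IsScalarTower R A B]
  [AddCommGroup E] [Module A E] [Module B E] [IsScalarTower A B E]

theorem exists_finsupp_family_basic {T : B} (hgen : ∀ c : B, ∃ g : S[X], aeval T g = c)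
    (hφ : ∀ b : S, ∃ φ : B →ₐ[S] B, φ T = algebraMap S B b * T) {a : A} {ν : B}
    (hT : T = ν * algebraMap A B a) {m₁ m₂ w : E}
    (h₁ : ∀ P : Ideal B, P.IsPrime → BasicAtPrime m₁ P)
    (h₂ : ∀ P : Ideal B, P.IsPrime → BasicAtPrime m₂ P)
    (hw : m₂ = m₁ + T • w) {N Q : Type*} [AddCommGroup N] [Module B N] [Module.Projective B N]
    [AddCommGroup Q] [Module S Q] (ρ : E →ₗ[B] N) (hρ : Function.Surjective ρ)
    (hker : LinearMap.ker ρ = Submodule.span B {m₁}) (ε : B ⊗[S] Q ≃ₗ[B] N) :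
    ∃ e : ℕ →₀ E, (m₂ = m₁ + a • e.sum fun _ x => x) ∧ ∀ (r : R) (P : Ideal B), P.IsPrime →
      BasicAtPrime (m₁ + a • e.sum fun i x => algebraMap R A r ^ (i + 1) • x) P := by
  have : Module.Projective B (B ⊗[S] Q) := Module.Projective.of_equiv ε.symm
  choose φ hφ using hφ
  obtain ⟨F, ⟨e, he⟩, hF₁, hF⟩ := exists_polynomial_family_basic hgen φ hφ h₁ h₂ hw
    (ε.symm.toLinearMap ∘ₗ ρ) (ε.symm.surjective.comp hρ)
    (by rw [LinearEquiv.ker_comp]; exact hker)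
  have hFe : ∀ r : R, (algebraMap S B (algebraMap R S r) * T) • F (algebraMap R S r) =
      a • (e.mapRange (ν • ·) (smul_zero ν)).sum
        fun i x => algebraMap R A r ^ (i + 1) • x := fun r => by
    rw [he, Finsupp.sum_mapRange_index (by simp), Finsupp.smul_sum, Finsupp.smul_sum]
    refine Finsupp.sum_congr fun i _ => ?_
    rw [← algebraMap_smul B a, ← algebraMap_smul B (algebraMap R A r ^ (i + 1)), map_pow,
      ← IsScalarTower.algebraMap_apply R A B, ← IsScalarTower.algebraMap_apply R S B, hT]
    simp only [smul_smul]
    congr 1; ring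
  refine ⟨_, ?_, fun r P hP => hFe r ▸ hF _ P hP⟩
  have h := hFe 1
  simp only [map_one, one_mul, one_pow, one_smul] at h
  rw [hF₁, h]

end Extraction

section Overlap

variable {R : Type*} [CommRing R] {A : Subalgebra R R[X]} {s t : R}

theorem exists_algebraMap_eq_aeval {n : ℕ} {a : A} (ha : (a : R[X]) = C s ^ n * X) :
    ∃ ν : Localization (powersSup A s t), ∀ f : A,
      algebraMap A (Localization (powersSup A s t)) f =
        aeval (ν * algebraMap A (Localization (powersSup A s t)) a) (f : R[X]) := by
  have hs : IsUnit (algebraMap R (Localization (powersSup A s t)) s) :=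
    isUnit_algebraMap_of_mem A s t (Submonoid.mem_sup_left ⟨1, pow_one s⟩)
  obtain ⟨ν, hν⟩ := (hs.pow n).exists_left_inv
  refine ⟨ν, fun f => algebraMap_eq_aeval (B := Localization (powersSup A s t)) ha ?_ hs f⟩
  rw [← mul_assoc, mul_comm _ ν, hν, one_mul]

theorem exists_overlap_family
    [Algebra (Localization (Submonoid.powers s ⊔ Submonoid.powers t))
      (Localization (powersSup A s t))]
    [IsScalarTower R (Localization (Submonoid.powers s ⊔ Submonoid.powers t))
      (Localization (powersSup A s t))]
    {n : ℕ} {a : A} (ha : (a : R[X]) = C s ^ n * X)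
    {E : Type*} [AddCommGroup E] [Module A E] [Module (Localization (powersSup A s t)) E]
    [IsScalarTower A (Localization (powersSup A s t)) E] {m₁ m₂ z : E}
    (h₁ : ∀ P : Ideal (Localization (powersSup A s t)), P.IsPrime → BasicAtPrime (A := Localization (powersSup A s t)) m₁ P)
    (h₂ : ∀ P : Ideal (Localization (powersSup A s t)), P.IsPrime → BasicAtPrime (A := Localization (powersSup A s t)) m₂ P)
    (hz₁ : m₁ - z ∈ (idealIA A).map (algebraMap A (Localization (powersSup A s t))) •
      (⊤ : Submodule (Localization (powersSup A s t)) E))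
    (hz₂ : m₂ - z ∈ (idealIA A).map (algebraMap A (Localization (powersSup A s t))) •
      (⊤ : Submodule (Localization (powersSup A s t)) E))
    {N Q : Type*} [AddCommGroup N] [Module (Localization (powersSup A s t)) N]
    [Module.Projective (Localization (powersSup A s t)) N]
    [AddCommGroup Q] [Module (Localization (Submonoid.powers s ⊔ Submonoid.powers t)) Q]
    (ρ : E →ₗ[Localization (powersSup A s t)] N) (hρ : Function.Surjective ρ)
    (hker : LinearMap.ker ρ = Submodule.span (Localization (powersSup A s t)) {m₁})
    (ε : Localization (powersSup A s t) ⊗[Localization (Submonoid.powers s ⊔ Submonoid.powers t)] Q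
      ≃ₗ[Localization (powersSup A s t)] N) :
    ∃ e : ℕ →₀ E, (m₂ = m₁ + a • e.sum fun _ x => x) ∧
      ∀ (r : R) (P : Ideal (Localization (powersSup A s t))), P.IsPrime →
        BasicAtPrime (A := Localization (powersSup A s t)) (m₁ + a • e.sum fun i x => algebraMap R A r ^ (i + 1) • x) P := by
  obtain ⟨ν, hν⟩ := exists_algebraMap_eq_aeval (s := s) (t := t) ha
  obtain ⟨w, hw⟩ := exists_eq_add_smul (B := Localization (powersSup A s t))
    (fun x hx => mem_map_idealIA_imp_dvd (B := Localization (powersSup A s t)) hν hx) hz₁ hz₂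
  exact exists_finsupp_family_basic (R := R) (A := A) (B := Localization (powersSup A s t))
    (S := Localization (Submonoid.powers s ⊔ Submonoid.powers t)) (exists_aeval_eq hν)
    (exists_algHom_apply_eq hν ha) rfl h₁ h₂ hw ρ hρ hker ε

end Overlap

theorem stmt_4 {R : Type*} [CommRing R] [IsNoetherianRing R] (d : ℕ) (hd : 1 ≤ d)
    (hdim : ringKrullDim R = (d : ℕ))
    (A : Subalgebra R (Polynomial R)) (hA : IsGeometricSubring A d)
    (s t : R) (hst : Ideal.span {s, t} = (⊤ : Ideal R))
    (hAs : ∀ f : Polynomial R, ∃ k : ℕ, (C s) ^ k * f ∈ A)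
    (M : Type v) [AddCommGroup M] [Module A M] [Module.Finite A M]
    -- `z` is (a lift to `M` of) the given element of `M/I_A M`
    (z : M)
    (m₁ : LocalizedModule (Submonoid.powers (algebraMap R A s)) M)
    (m₂ : LocalizedModule (Submonoid.powers (algebraMap R A t)) M)
    -- `m₁` is a basic element of the `A_s`-module `M_s`, and `m₂` of `M_t`
    (hm₁basic : ∀ (q : Ideal (Localization (Submonoid.powers (algebraMap R A s))))
      (hq : q.IsPrime), IsBasicAt (R := Localization (Submonoid.powers (algebraMap R A s))) m₁ q hq)
    (hm₂basic : ∀ (q : Ideal (Localization (Submonoid.powers (algebraMap R A t))))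
      (hq : q.IsPrime), IsBasicAt (R := Localization (Submonoid.powers (algebraMap R A t))) m₂ q hq)
    -- `m̄₁ = z_s` and `m̄₂ = z_t` modulo `I_A`
    (hm₁z : m₁ - LocalizedModule.mkLinearMap (Submonoid.powers (algebraMap R A s)) M z ∈
      ((idealIA A).map (algebraMap A (Localization (Submonoid.powers (algebraMap R A s))))) •
        (⊤ : Submodule (Localization (Submonoid.powers (algebraMap R A s)))
          (LocalizedModule (Submonoid.powers (algebraMap R A s)) M)))
    (hm₂z : m₂ - LocalizedModule.mkLinearMap (Submonoid.powers (algebraMap R A t)) M z ∈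
      ((idealIA A).map (algebraMap A (Localization (Submonoid.powers (algebraMap R A t))))) •
        (⊤ : Submodule (Localization (Submonoid.powers (algebraMap R A t)))
          (LocalizedModule (Submonoid.powers (algebraMap R A t)) M)))
    -- `(N₁)_t = M_st/(m₁ A_st)` is an extended projective module from `R_st`
    (hN₁ : IsProjExtQuotientBy (rstToAst A s t)
      (LocalizedModule
        (Submonoid.powers (algebraMap R A s) ⊔ Submonoid.powers (algebraMap R A t)) M)
      (locToLoc (le_sup_left : Submonoid.powers (algebraMap R A s) ≤
        Submonoid.powers (algebraMap R A s) ⊔ Submonoid.powers (algebraMap R A t)) M m₁))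
    -- `(N₂)_s = M_st/(m₂ A_st)` is an extended projective module from `R_st`
    (hN₂ : IsProjExtQuotientBy (rstToAst A s t)
      (LocalizedModule
        (Submonoid.powers (algebraMap R A s) ⊔ Submonoid.powers (algebraMap R A t)) M)
      (locToLoc (le_sup_right : Submonoid.powers (algebraMap R A t) ≤
        Submonoid.powers (algebraMap R A s) ⊔ Submonoid.powers (algebraMap R A t)) M m₂)) :
    ∃ m : M, (∀ (p : Ideal A) (hp : p.IsPrime), IsBasicAt m p hp) ∧
      m - z ∈ (idealIA A) • (⊤ : Submodule A M) := by
  obtain ⟨n, hn⟩ := hAs X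
  obtain ⟨a, ha⟩ : ∃ a : A, (a : R[X]) = C s ^ n * X := ⟨⟨_, hn⟩, rfl⟩
  have haI : a ∈ idealIA A := by
    change (a : R[X]).eval 0 = 0
    simp [ha]
  have hst' : Ideal.span {algebraMap R A s, algebraMap R A t} = ⊤ := by
    have := congrArg (Ideal.map (algebraMap R A)) hst
    rwa [Ideal.map_span, Set.image_pair, Ideal.map_top] at this
  have hb₁ := fun q (hq : q.IsPrime) => (isBasicAt_iff _ q hq).1 (hm₁basic q hq)
  have hb₂ := fun q (hq : q.IsPrime) => (isBasicAt_iff _ q hq).1 (hm₂basic q hq)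
  have hz₁ := locToLoc_mem_map_smul_top (le_sup_left : _ ≤ powersSup A s t) _ hm₁z
  have hz₂ := locToLoc_mem_map_smul_top (le_sup_right : _ ≤ powersSup A s t) _ hm₂z
  rw [map_sub, locToLoc_mkLinearMap] at hz₁ hz₂
  obtain ⟨N, iN, iMN, ρ, hρ, hker, hproj, Q, iQ, iMQ, ⟨ε⟩⟩ := hN₁
  obtain ⟨e, he, hbasic⟩ := @exists_overlap_family R _ A s t (rstToAst A s t).toAlgebra
    (@IsScalarTower.of_algebraMap_eq _ _ _ _ _ _ _ (rstToAst A s t).toAlgebra _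
      fun r => (rstToAst_algebraMap A s t r).symm)
    n a ha _ _ _ _ _ _ _ _ (fun P hP => BasicAtPrime.locToLoc _ hb₁ hP)
    (fun P hP => BasicAtPrime.locToLoc _ hb₂ hP) hz₁ hz₂ N Q iN iMN hproj iQ iMQ ρ hρ hker ε
  obtain ⟨r, w₁, w₂, hv₁, hv₂⟩ := exists_lifts hst a _ _ le_rfl (sup_comm _ _).le m₁ m₂ e he
  obtain ⟨m, hm₁, hm₂⟩ := exists_glue hst' _ _ (hv₁.trans hv₂.symm)
  exact ⟨m, fun p hp => (isBasicAt_iff _ _ _).2 (basicAtPrime_of_glued hst' hm₁ hm₂ hb₁ hb₂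
    (fun P hP => hv₁ ▸ hbasic r P hP) hp), mem_smul_top_of_glued hst' haI hm₁ hm₂ hm₁z hm₂z⟩
end
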